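/- Let q ≥ 0, μ ∈ (0,1), let F be (λ,Λ)-elliptic, and let 0 ≤ κ ≤ κ₀ where κ₀ ∈ (0,1) is a small universal constant depending only on n, λ, Λ. Let u be a κ-grad viscosity solution of (|Du|−κ)₊^q F(D²u) = f in B₁. There exist constants ρ₀, γ ∈ (0,1) depending only on n, λ, Λ, and small positive constants ς₀, τ₀ depending only on μ, n, λ, Λ and q, such that if ‖f‖_{L^∞(B₁)} ≤ ς₀ and |u(x) − (ξ·x + b)| ≤ τ₀ for all x ∈ B₁, for some ξ ∈ ℝⁿ with |ξ| ≥ κ + 3μ and some b ∈ ℝ, then for each positive integer k there exist ξ_k ∈ ℝⁿ and b_k ∈ ℝ, with ξ₀ = ξ₁ = ξ and b₀ = b₁ = b, such that |ξ_k − ξ_{k−1}| ≤ Cτ₀ρ₀^{(k−1)γ}, |b_k − b_{k−1}| ≤ Cτ₀ρ₀^{(k−1)(1+γ)}, and |u(x) − (ξ_k·x + b_k)| ≤ τ₀ρ₀^{(k−1)(1+γ)} for all x ∈ B_{ρ₀^{k−1}}, for some constant C ≥ 1 depending only on n, λ and Λ. -/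

import Mathlib

open Metric Set Matrix MeasureTheory
open scoped RealInnerProductSpace

noncomputable section

abbrev Euc (n : ℕ) := EuclideanSpace ℝ (Fin n)

def EllMat (n : ℕ) (lam Lam : ℝ) : Set (Matrix (Fin n) (Fin n) ℝ) :=
  {A | A.IsSymm ∧ ∀ ξ : Fin n → ℝ,
      lam * (ξ ⬝ᵥ ξ) ≤ ξ ⬝ᵥ A.mulVec ξ ∧ ξ ⬝ᵥ A.mulVec ξ ≤ Lam * (ξ ⬝ᵥ ξ)}

/-- Pucci maximal operator `M⁺`. -/
def pucciSup (n : ℕ) (lam Lam : ℝ) (M : Matrix (Fin n) (Fin n) ℝ) : ℝ :=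
  sSup ((fun A => (A * M).trace) '' EllMat n lam Lam)

/-- Pucci minimal operator `M⁻`. -/
def pucciInf (n : ℕ) (lam Lam : ℝ) (M : Matrix (Fin n) (Fin n) ℝ) : ℝ :=
  sInf ((fun A => (A * M).trace) '' EllMat n lam Lam)

/-- `(λ,Λ)`-ellipticity of `F`. -/
def IsUniformlyElliptic (n : ℕ) (lam Lam : ℝ)
    (F : Matrix (Fin n) (Fin n) ℝ → ℝ) : Prop :=
  ∀ M N : Matrix (Fin n) (Fin n) ℝ, M.IsSymm → N.IsSymm →
    pucciInf n lam Lam (M - N) ≤ F M - F N ∧ F M - F N ≤ pucciSup n lam Lam (M - N)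

/-- Hessian matrix of `φ` at `x`. -/
def hess {n : ℕ} (φ : Euc n → ℝ) (x : Euc n) : Matrix (Fin n) (Fin n) ℝ :=
  fun i j => iteratedFDeriv ℝ 2 φ x ![EuclideanSpace.single i 1, EuclideanSpace.single j 1]

/-- `κ`-grad viscosity subsolution of `G(Du, D²u) = f` in `s`. -/
def GradSubSol {n : ℕ} (κ : ℝ) (G : Euc n → Matrix (Fin n) (Fin n) ℝ → ℝ)
    (f : Euc n → ℝ) (s : Set (Euc n)) (u : Euc n → ℝ) : Prop :=
  ∀ x₀ ∈ s, ∀ φ : Euc n → ℝ, ContDiff ℝ 2 φ →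
    IsLocalMax (fun x => u x - φ x) x₀ → κ < ‖gradient φ x₀‖ →
    f x₀ ≤ G (gradient φ x₀) (hess φ x₀)

/-- `κ`-grad viscosity supersolution of `G(Du, D²u) = f` in `s`. -/
def GradSupSol {n : ℕ} (κ : ℝ) (G : Euc n → Matrix (Fin n) (Fin n) ℝ → ℝ)
    (f : Euc n → ℝ) (s : Set (Euc n)) (u : Euc n → ℝ) : Prop :=
  ∀ x₀ ∈ s, ∀ φ : Euc n → ℝ, ContDiff ℝ 2 φ →
    IsLocalMin (fun x => u x - φ x) x₀ → κ < ‖gradient φ x₀‖ →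
    G (gradient φ x₀) (hess φ x₀) ≤ f x₀

/-- `κ`-grad viscosity solution. -/
def GradSol {n : ℕ} (κ : ℝ) (G : Euc n → Matrix (Fin n) (Fin n) ℝ → ℝ)
    (f : Euc n → ℝ) (s : Set (Euc n)) (u : Euc n → ℝ) : Prop :=
  GradSubSol κ G f s u ∧ GradSupSol κ G f s u

/-- Classical viscosity solution (no restriction on the slope of test functions). -/
def ViscSol {n : ℕ} (G : Euc n → Matrix (Fin n) (Fin n) ℝ → ℝ)
    (f : Euc n → ℝ) (s : Set (Euc n)) (u : Euc n → ℝ) : Prop :=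
  (∀ x₀ ∈ s, ∀ φ : Euc n → ℝ, ContDiff ℝ 2 φ →
    IsLocalMax (fun x => u x - φ x) x₀ → f x₀ ≤ G (gradient φ x₀) (hess φ x₀)) ∧
  (∀ x₀ ∈ s, ∀ φ : Euc n → ℝ, ContDiff ℝ 2 φ →
    IsLocalMin (fun x => u x - φ x) x₀ → G (gradient φ x₀) (hess φ x₀) ≤ f x₀)

/-- The operator `G(ξ, M) = (|ξ|-κ)₊^q F(M)`. -/
def mainG {n : ℕ} (κ q : ℝ) (F : Matrix (Fin n) (Fin n) ℝ → ℝ) :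
    Euc n → Matrix (Fin n) (Fin n) ℝ → ℝ :=
  fun ξ M => max (‖ξ‖ - κ) 0 ^ q * F M

/-- The set `Ω_u` of points of `s` that can be touched from above or below by a `C²`
function with slope larger than `κ`. -/
def omegaSet {n : ℕ} (κ : ℝ) (s : Set (Euc n)) (u : Euc n → ℝ) : Set (Euc n) :=
  {x ∈ s | ∃ φ : Euc n → ℝ, ContDiff ℝ 2 φ ∧
    (IsLocalMax (fun y => u y - φ y) x ∨ IsLocalMin (fun y => u y - φ y) x) ∧
    κ < ‖gradient φ x‖}

/-- Effective viscosity solution of `(|Du|-κ)₊^q F(D²u) = f` in `s`. -/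
def EffectiveSol {n : ℕ} (κ q : ℝ) (F : Matrix (Fin n) (Fin n) ℝ → ℝ)
    (f : Euc n → ℝ) (s : Set (Euc n)) (u : Euc n → ℝ) : Prop :=
  IsOpen (omegaSet κ s u) ∧ ViscSol (mainG κ q F) f (omegaSet κ s u) u

open Filter Topology

section SecondOrder

variable {E : Type*} [NormedAddCommGroup E] [InnerProductSpace ℝ E]

/-- `g` is touched from above at `z`, with slope `q`, by a paraboloid of opening `2C`. -/
def TouchAbove (g : E → ℝ) (z q : E) (r C : ℝ) : Prop :=
  ∀ x, ‖x - z‖ < r → g x ≤ g z + ⟪q, x - z⟫ + C * ‖x - z‖ ^ 2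

/-- `g` is touched from below at `z`, with slope `q`, by a paraboloid of opening `2C`. -/
def TouchBelow (g : E → ℝ) (z q : E) (r C : ℝ) : Prop :=
  ∀ x, ‖x - z‖ < r → g z + ⟪q, x - z⟫ - C * ‖x - z‖ ^ 2 ≤ g x

/-- `g` has the second order expansion with gradient `p` and Hessian `S` at `z`. -/
def Exp2 (g : E → ℝ) (z p : E)
    (S : E →L[ℝ] E) : Prop :=
  ∀ η > 0, ∃ r > 0, ∀ x, ‖x - z‖ < r →
    |g x - g z - ⟪p, x - z⟫ - (1 / 2) * ⟪S (x - z), x - z⟫| ≤ η * ‖x - z‖ ^ 2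

theorem TouchAbove.mono {g : E → ℝ} {z q : E} {r C r' C' : ℝ}
    (h : TouchAbove g z q r C) (hr : r' ≤ r) (hC : C ≤ C') : TouchAbove g z q r' C' := by
  intro x hx
  have := h x (hx.trans_le hr)
  nlinarith [sq_nonneg ‖x - z‖]

theorem TouchBelow.mono {g : E → ℝ} {z q : E} {r C r' C' : ℝ}
    (h : TouchBelow g z q r C) (hr : r' ≤ r) (hC : C ≤ C') : TouchBelow g z q r' C' := by
  intro x hx
  have := h x (hx.trans_le hr)
  nlinarith [sq_nonneg ‖x - z‖]

theorem slope_eq {g : E → ℝ} {z q q' : E} {r C r' C' : ℝ}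
    (hr : 0 < r) (hr' : 0 < r') (h : TouchAbove g z q r C) (h' : TouchBelow g z q' r' C') :
    q = q' := by
  by_contra hne
  have hd : 0 < ‖q' - q‖ := norm_pos_iff.2 (sub_ne_zero.2 (Ne.symm hne))
  set D := ‖q' - q‖ with hD
  have key : ∀ t : ℝ, 0 < t → t * D < min r r' → 1 ≤ (C + C') * t := by
    intro t ht hlt
    have hn : ‖(z + t • (q' - q)) - z‖ = t * D := by
      rw [add_sub_cancel_left, norm_smul, Real.norm_of_nonneg ht.le]
    have h1 := h (z + t • (q' - q)) (by rw [hn]; exact hlt.trans_le (min_le_left _ _))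
    have h2 := h' (z + t • (q' - q)) (by rw [hn]; exact hlt.trans_le (min_le_right _ _))
    rw [hn, add_sub_cancel_left, inner_smul_right] at h1 h2
    have h3 : ⟪q', q' - q⟫ - ⟪q, q' - q⟫ = D ^ 2 := by
      rw [← inner_sub_left, real_inner_self_eq_norm_sq]
    have h4 : t * D ^ 2 ≤ (C + C') * t * (t * D ^ 2) := by nlinarith
    have h5 : 0 < t * D ^ 2 := by positivity
    by_contra hlt'
    push Not at hlt'
    nlinarith
  set t := min ((min r r') / (2 * D)) (1 / (2 * (|C + C'| + 1))) with htdef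
  have hm : 0 < min r r' := lt_min hr hr'
  have ht : 0 < t := by positivity
  have h1 : t * D < min r r' := by
    calc t * D ≤ ((min r r') / (2 * D)) * D := by gcongr; exact min_le_left _ _
      _ = min r r' / 2 := by field_simp
      _ < _ := by linarith
  have h2 := key t ht h1
  have h3 : t ≤ 1 / (2 * (|C + C'| + 1)) := min_le_right _ _
  rw [le_div_iff₀ (by positivity)] at h3
  nlinarith [le_abs_self (C + C'), abs_nonneg (C + C')]

theorem slope_lipschitz {g : E → ℝ} {z₁ z₂ p₁ p₂ : E}
    {r C : ℝ} (hr : 0 < r) (hC : 0 ≤ C)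
    (ha₁ : TouchAbove g z₁ p₁ r C) (hb₁ : TouchBelow g z₁ p₁ r C)
    (ha₂ : TouchAbove g z₂ p₂ r C) (hd : ‖z₁ - z₂‖ < r / 2) :
    ‖p₁ - p₂‖ ≤ 6 * C * ‖z₁ - z₂‖ := by
  rcases eq_or_ne z₁ z₂ with rfl | hne
  · simp [slope_eq hr hr ha₂ hb₁]
  rcases eq_or_ne p₁ p₂ with rfl | hpne
  · simpa using by positivity
  have hd0 : 0 < ‖z₁ - z₂‖ := norm_pos_iff.2 (sub_ne_zero.2 hne)
  have hD : 0 < ‖p₁ - p₂‖ := norm_pos_iff.2 (sub_ne_zero.2 hpne)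
  set d := ‖z₁ - z₂‖ with hd_def
  set s : E := (d / ‖p₁ - p₂‖) • (p₁ - p₂) with hs
  have hsn : ‖s‖ = d := by
    rw [hs, norm_smul, Real.norm_of_nonneg (by positivity)]; field_simp
  have hx2 : ‖(z₂ + s) - z₂‖ = d := by rw [add_sub_cancel_left, hsn]
  have hx1 : ‖(z₂ + s) - z₁‖ ≤ 2 * d := by
    have : (z₂ + s) - z₁ = s - (z₁ - z₂) := by abel
    rw [this]
    refine (norm_sub_le _ _).trans ?_
    rw [hsn, ← hd_def]; linarith
  have e1 := ha₂ (z₂ + s) (by rw [hx2]; linarith)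
  have e2 := hb₁ (z₂ + s) (by linarith)
  have hz21 : ‖z₂ - z₁‖ = d := by rw [norm_sub_rev]
  have e3 := ha₁ z₂ (by rw [hz21]; linarith)
  rw [hz21] at e3
  rw [hx2, add_sub_cancel_left] at e1
  have e4 : ⟪p₁, (z₂ + s) - z₁⟫ = ⟪p₁, z₂ - z₁⟫ + ⟪p₁, s⟫ := by
    rw [← inner_add_right]; congr 1; abel
  have e5 : ⟪p₁, s⟫ - ⟪p₂, s⟫ = d * ‖p₁ - p₂‖ := by
    rw [← inner_sub_left, hs, inner_smul_right, real_inner_self_eq_norm_sq]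
    field_simp
  have e6 : C * ‖(z₂ + s) - z₁‖ ^ 2 ≤ C * (2 * d) ^ 2 := by gcongr
  have : d * ‖p₁ - p₂‖ ≤ d * (6 * C * d) := by nlinarith
  exact le_of_mul_le_mul_left this hd0

/-- Points of `K` form an asymptotically dense net around `z`. -/
def DenseAt (K : Set (E)) (z : E) : Prop :=
  ∀ δ > 0, ∃ r > 0, ∀ x, ‖x - z‖ < r → ∃ y ∈ K, ‖y - x‖ ≤ δ * ‖x - z‖

theorem quad_expansion_of_denseAt {g : E → ℝ}
    {K : Set (E)} {p : E → E}
    {z : E} {r C : ℝ}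
    {A : E →L[ℝ] E} (hr : 0 < r) (hC : 0 ≤ C)
    (ha : ∀ y ∈ K, TouchAbove g y (p y) r C) (hb : ∀ y ∈ K, TouchBelow g y (p y) r C)
    (hA : HasFDerivWithinAt p A K z) (hd : DenseAt K z) :
    Exp2 g z (p z) A := by
  intro η hη
  set H := 5 * C + 2 + 2 * ‖A‖ with hH
  have hH0 : 0 < H := by positivity
  obtain ⟨N, hN⟩ := exists_nat_gt (max 1 (H / η))
  have hN1 : (1 : ℝ) < N := (le_max_left _ _).trans_lt hN
  have hNH : H / N ≤ η := by
    have := (le_max_right 1 (H / η)).trans hN.le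
    rw [div_le_iff₀ hη] at this
    rw [div_le_iff₀ (by linarith)]; linarith
  have hN0 : (0 : ℝ) < N := by linarith
  obtain ⟨r₁, hr₁, hnet⟩ := hd (1 / N) (by positivity)
  have hlin := (hasFDerivWithinAt_iff_isLittleO.1 hA).def (show (0 : ℝ) < 1 / N by positivity)
  obtain ⟨r₂, hr₂, hlin⟩ := Metric.eventually_nhds_iff.1 (eventually_nhdsWithin_iff.1 hlin)
  refine ⟨min r₁ (min (r₂ / 2) (r / 4)), by positivity, fun x hx => ?_⟩
  have hxr₁ : ‖x - z‖ < r₁ := hx.trans_le (min_le_left _ _)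
  have hxr₂ : ‖x - z‖ < r₂ / 2 := hx.trans_le ((min_le_right _ _).trans (min_le_left _ _))
  have hxr : ‖x - z‖ < r / 4 := hx.trans_le ((min_le_right _ _).trans (min_le_right _ _))
  set d := x - z with hdd
  set ρ := ‖d‖ with hρ
  have hρ0 : 0 ≤ ρ := norm_nonneg _
  set X : ℕ → E := fun i => z + ((i : ℝ) / N) • d with hX
  have step : ∀ i : ℕ, i < N →
      |g (X (i + 1)) - g (X i) - ⟪p z, d⟫ / N - (i / N ^ 2) * ⟪A d, d⟫|
        ≤ (5 * C + 2 + ‖A‖) * ρ ^ 2 / N ^ 2 := by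
    intro i hi
    have hiN : (i : ℝ) / N ≤ 1 := by
      rw [div_le_one hN0]; exact_mod_cast hi.le
    have hi0 : (0 : ℝ) ≤ (i : ℝ) / N := by positivity
    have hXi : X i - z = ((i : ℝ) / N) • d := by simp [hX]
    have hXin : ‖X i - z‖ ≤ ρ := by
      rw [hXi, norm_smul, Real.norm_of_nonneg hi0]
      nlinarith
    obtain ⟨y, hyK, hy⟩ := hnet (X i) (hXin.trans_lt hxr₁)
    have hy1 : ‖y - X i‖ ≤ ρ / N := by
      refine hy.trans ?_
      rw [one_div, inv_mul_eq_div]; gcongr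
    have hρN : ρ / N ≤ ρ := div_le_self hρ0 hN1.le
    have hyz : ‖y - z‖ ≤ 2 * ρ := by
      have : y - z = (y - X i) + (X i - z) := by abel
      rw [this]; refine (norm_add_le _ _).trans ?_; linarith
    have hlin' := hlin (y := y) (by rw [dist_eq_norm]; linarith) hyK
    have hstep : X (i + 1) - X i = (1 / (N : ℝ)) • d := by
      simp only [hX, Nat.cast_add, Nat.cast_one]
      rw [add_sub_add_left_eq_sub, ← sub_smul]; congr 1; ring
    have hX1y : ‖X (i + 1) - y‖ ≤ 2 * (ρ / N) := by
      have : X (i + 1) - y = (X (i + 1) - X i) - (y - X i) := by abel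
      rw [this, hstep]; refine (norm_sub_le _ _).trans ?_
      rw [norm_smul, Real.norm_of_nonneg (by positivity)]
      have : 1 / (N : ℝ) * ‖d‖ = ρ / N := by rw [one_div, inv_mul_eq_div]
      linarith
    have hX0y : ‖X i - y‖ ≤ ρ / N := by rwa [norm_sub_rev]
    have a1 := ha y hyK (X (i + 1)) (by linarith)
    have b1 := hb y hyK (X (i + 1)) (by linarith)
    have a0 := ha y hyK (X i) (by linarith)
    have b0 := hb y hyK (X i) (by linarith)
    have s1 : C * ‖X (i + 1) - y‖ ^ 2 ≤ C * (2 * (ρ / N)) ^ 2 := by gcongr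
    have s0 : C * ‖X i - y‖ ^ 2 ≤ C * (ρ / N) ^ 2 := by gcongr
    have i1 : ⟪p y, X (i + 1) - y⟫ - ⟪p y, X i - y⟫ = ⟪p y, d⟫ / N := by
      rw [← inner_sub_right, sub_sub_sub_cancel_right, hstep, inner_smul_right]; ring
    have i2 : ⟪p y, d⟫ = ⟪p z, d⟫ + (i / N) * ⟪A d, d⟫ + ⟪A (y - X i), d⟫
        + ⟪p y - p z - A (y - z), d⟫ := by
      have : A (y - z) = A (y - X i) + ((i : ℝ) / N) • A d := by
        rw [← map_smul, ← hXi, ← map_add]; congr 1; abel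
      rw [this]
      simp only [inner_sub_left, inner_add_left, real_inner_smul_left]
      ring
    have i3 : |⟪A (y - X i), d⟫| ≤ ‖A‖ * (ρ / N) * ρ := by
      refine (abs_real_inner_le_norm _ _).trans ?_
      gcongr
      exact (A.le_opNorm _).trans (by gcongr)
    have i4 : |⟪p y - p z - A (y - z), d⟫| ≤ (1 / N * (2 * ρ)) * ρ := by
      refine (abs_real_inner_le_norm _ _).trans ?_
      gcongr
      exact hlin'.trans (by gcongr)
    rw [abs_le] at i3 i4 ⊢
    have e1 : (i / (N : ℝ) ^ 2) * ⟪A d, d⟫ = (i / N) * ⟪A d, d⟫ / N := by ring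
    have e2 : (5 * C + 2 + ‖A‖) * ρ ^ 2 / (N : ℝ) ^ 2
        = C * (2 * (ρ / N)) ^ 2 + C * (ρ / N) ^ 2
          + (‖A‖ * (ρ / N) * ρ) / N + ((1 / N * (2 * ρ)) * ρ) / N := by
      field_simp; ring
    have e3 : ⟪p y, d⟫ / N = ⟪p z, d⟫ / N + (i / N) * ⟪A d, d⟫ / N + ⟪A (y - X i), d⟫ / N
        + ⟪p y - p z - A (y - z), d⟫ / N := by rw [i2]; ring
    have i3l := div_le_div_of_nonneg_right i3.1 hN0.le
    have i3r := div_le_div_of_nonneg_right i3.2 hN0.le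
    have i4l := div_le_div_of_nonneg_right i4.1 hN0.le
    have i4r := div_le_div_of_nonneg_right i4.2 hN0.le
    rw [neg_div] at i3l i4l
    rw [e1, e2]
    constructor <;> linarith
  have sum : ∀ m : ℕ, m ≤ N →
      |g (X m) - g z - m * (⟪p z, d⟫ / N) - (m * (m - 1) / 2) / N ^ 2 * ⟪A d, d⟫|
        ≤ m * ((5 * C + 2 + ‖A‖) * ρ ^ 2 / N ^ 2) := by
    intro m
    induction m with
    | zero => intro _; simp [hX]
    | succ m ih =>
      intro hm
      have h1 := ih (by omega)
      have h2 := step m (by omega)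
      have h3 := (abs_add_le _ _).trans (add_le_add h1 h2)
      push_cast
      refine (le_of_eq ?_).trans (h3.trans (le_of_eq ?_))
      · congr 1; ring
      · ring
  have hfin := sum N le_rfl
  have hXN : X N = x := by
    simp only [hX]; rw [div_self hN0.ne', one_smul, hdd]; abel
  rw [hXN] at hfin
  have q1 : |⟪A d, d⟫| ≤ ‖A‖ * ρ ^ 2 := by
    refine (abs_real_inner_le_norm _ _).trans ?_
    rw [pow_two, ← mul_assoc]; gcongr; exact A.le_opNorm _
  have q2 : |1 / (2 * N) * ⟪A d, d⟫| ≤ ‖A‖ * ρ ^ 2 / N := by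
    rw [abs_mul, abs_of_nonneg (by positivity)]
    calc 1 / (2 * (N : ℝ)) * |⟪A d, d⟫| ≤ 1 / (2 * (N : ℝ)) * (‖A‖ * ρ ^ 2) := by gcongr
      _ = (‖A‖ * ρ ^ 2 / N) / 2 := by field_simp
      _ ≤ _ := by
        have : 0 ≤ ‖A‖ * ρ ^ 2 / N := by positivity
        linarith
  calc |g x - g z - ⟪p z, d⟫ - 1 / 2 * ⟪A d, d⟫|
      = |(g x - g z - N * (⟪p z, d⟫ / N) - (N * (N - 1) / 2) / N ^ 2 * ⟪A d, d⟫)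
          - 1 / (2 * N) * ⟪A d, d⟫| := by congr 1; field_simp; ring
    _ ≤ N * ((5 * C + 2 + ‖A‖) * ρ ^ 2 / N ^ 2) + ‖A‖ * ρ ^ 2 / N :=
        (abs_sub _ _).trans (add_le_add hfin q2)
    _ = H / N * ρ ^ 2 := by rw [hH]; field_simp; ring
    _ ≤ η * ρ ^ 2 := by gcongr

end SecondOrder

section AlmostEverywhere

variable {E : Type*} [NormedAddCommGroup E] [InnerProductSpace ℝ E]

/-- Symmetric endomorphisms. -/
def Symm (S : E →L[ℝ] E) : Prop := ∀ x y, ⟪S x, y⟫ = ⟪x, S y⟫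

theorem hasFDerivWithinAt_of_exp2 {g : E → ℝ} {K : Set E} {p : E → E} {z : E} {r C : ℝ}
    {S : E →L[ℝ] E} (hr : 0 < r) (hC : 0 ≤ C) (hS : Symm S)
    (hb : ∀ y ∈ K, TouchBelow g y (p y) r C) (hexp : Exp2 g z (p z) S) :
    HasFDerivWithinAt p S K z := by
  rw [hasFDerivWithinAt_iff_isLittleO, Asymptotics.isLittleO_iff]
  intro c hc
  set H := C + ‖S‖ + 5 with hH
  have hH0 : 0 < H := by positivity
  set s := min 1 (c / H) with hs
  have hs0 : 0 < s := by positivity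
  have hs1 : s ≤ 1 := min_le_left _ _
  have hsH : s * H ≤ c := by
    rw [← le_div_iff₀ hH0]; exact min_le_right _ _
  obtain ⟨r₁, hr₁, hx⟩ := hexp (s ^ 2) (by positivity)
  refine eventually_nhdsWithin_iff.2 (Metric.eventually_nhds_iff.2
    ⟨min (r₁ / 2) r, by positivity, fun y hy hyK => ?_⟩)
  rw [dist_eq_norm] at hy
  have hy1 : ‖y - z‖ < r₁ / 2 := hy.trans_le (min_le_left _ _)
  have hy2 : ‖y - z‖ < r := hy.trans_le (min_le_right _ _)
  set D := y - z with hD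
  set v := p y - p z - S D with hv
  rcases eq_or_ne v 0 with h0 | h0
  · rw [h0, norm_zero]; positivity
  have hvn : 0 < ‖v‖ := norm_pos_iff.2 h0
  rcases eq_or_ne D 0 with h1 | h1
  · exfalso
    have : y = z := sub_eq_zero.1 h1
    apply h0; rw [hv, h1, this]; simp
  have hρ : 0 < ‖D‖ := norm_pos_iff.2 h1
  set ρ := ‖D‖ with hρd
  set e := (s * ρ / ‖v‖) • v with he
  have hen : ‖e‖ = s * ρ := by
    rw [he, norm_smul, Real.norm_of_nonneg (by positivity)]; field_simp
  have hsρ : s * ρ ≤ ρ := by nlinarith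
  have hxz : y + e - z = D + e := by rw [hD]; abel
  have hxzn : ‖D + e‖ ≤ 2 * ρ := (norm_add_le _ _).trans (by rw [hen]; linarith)
  have b := hb y hyK (y + e) (by rw [add_sub_cancel_left, hen]; linarith)
  have x1 := (abs_le.1 (hx (y + e) (by rw [hxz]; linarith))).2
  have x2 := (abs_le.1 (hx y (by linarith))).1
  rw [add_sub_cancel_left, hen] at b
  rw [hxz] at x1
  rw [← hD] at x2
  have q1 : ⟪S (D + e), D + e⟫ = ⟪S D, D⟫ + 2 * ⟪S D, e⟫ + ⟪S e, e⟫ := by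
    rw [map_add, inner_add_left, inner_add_right, inner_add_right, hS e D,
      real_inner_comm e]
    have := real_inner_comm (S D) e
    linarith
  have q2 : ⟪S e, e⟫ ≤ ‖S‖ * (s * ρ) ^ 2 := by
    refine (real_inner_le_norm _ _).trans ?_
    rw [pow_two, ← mul_assoc, ← hen]; gcongr; exact S.le_opNorm _
  have q3 : ⟪v, e⟫ = s * ρ * ‖v‖ := by
    rw [he, inner_smul_right, real_inner_self_eq_norm_sq]; field_simp
  have q4 : ⟪v, e⟫ = ⟪p y, e⟫ - ⟪p z, e⟫ - ⟪S D, e⟫ := by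
    rw [hv, inner_sub_left, inner_sub_left]
  have q5 : s ^ 2 * ‖D + e‖ ^ 2 ≤ s ^ 2 * (2 * ρ) ^ 2 := by gcongr
  rw [inner_add_right] at x1
  have q6 : 0 ≤ ‖S‖ * (s * ρ) ^ 2 := by positivity
  have key : s * ρ * ‖v‖ ≤ s * ρ * (s * H * ρ) := by
    rw [hH]; nlinarith
  have := le_of_mul_le_mul_left key (by positivity)
  nlinarith

theorem exp2_symmetrize [CompleteSpace E] {g : E → ℝ} {z p : E} {A : E →L[ℝ] E}
    (h : Exp2 g z p A) : ∃ S : E →L[ℝ] E, Symm S ∧ Exp2 g z p S := by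
  refine ⟨(1 / 2 : ℝ) • (A + ContinuousLinearMap.adjoint A), fun x y => ?_, fun η hη => ?_⟩
  · simp only [_root_.smul_apply, _root_.add_apply,
      real_inner_smul_left, real_inner_smul_right, inner_add_left, inner_add_right,
      ContinuousLinearMap.adjoint_inner_left, ContinuousLinearMap.adjoint_inner_right]
    ring
  · obtain ⟨r, hr, hx⟩ := h η hη
    refine ⟨r, hr, fun x hxr => ?_⟩
    have : ⟪((1 / 2 : ℝ) • (A + ContinuousLinearMap.adjoint A)) (x - z), x - z⟫
        = ⟪A (x - z), x - z⟫ := by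
      simp only [_root_.smul_apply, _root_.add_apply,
        real_inner_smul_left, inner_add_left, ContinuousLinearMap.adjoint_inner_left]
      rw [real_inner_comm (A (x - z))]; ring
    rw [this]; exact hx x hxr

variable [FiniteDimensional ℝ E] [MeasurableSpace E] [BorelSpace E]
  (μ : Measure E) [μ.IsAddHaarMeasure]

open scoped Pointwise in
theorem denseAt_of_density {K : Set E} {z : E} (hz : z ∈ K)
    (h : Tendsto (fun r => μ (K ∩ closedBall z r) / μ (closedBall z r)) (𝓝[>] 0) (𝓝 1)) :
    DenseAt K z := by
  intro δ hδ
  obtain ⟨t, -, htf, htc⟩ := finite_cover_balls_of_compact (isCompact_closedBall (0 : E) 1)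
    (half_pos hδ)
  have hev : ∀ᶠ r : ℝ in 𝓝[>] 0, ∀ c ∈ t, (K ∩ ({z} + r • ball c (δ / 2))).Nonempty := by
    rw [htf.eventually_all]
    intro c _
    exact Measure.eventually_nonempty_inter_smul_of_density_one μ K z h _ measurableSet_ball
      (measure_ball_pos μ c (half_pos hδ)).ne'
  obtain ⟨r, hr, hx⟩ := mem_nhdsGT_iff_exists_Ioo_subset.1 hev
  refine ⟨r, hr, fun x hxr => ?_⟩
  rcases eq_or_ne x z with rfl | hne
  · exact ⟨x, hz, by simp⟩
  have hρ : 0 < ‖x - z‖ := norm_pos_iff.2 (sub_ne_zero.2 hne)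
  have hmem : (‖x - z‖⁻¹ • (x - z)) ∈ closedBall (0 : E) 1 := by
    rw [mem_closedBall_zero_iff, norm_smul, norm_inv, norm_norm, inv_mul_cancel₀ hρ.ne']
  obtain ⟨c, hc, hxc⟩ := mem_iUnion₂.1 (htc hmem)
  obtain ⟨y, hyK, hy⟩ := hx ⟨hρ, hxr⟩ c hc
  rw [singleton_add] at hy
  obtain ⟨_, ⟨w, hw, rfl⟩, rfl⟩ := hy
  refine ⟨_, hyK, ?_⟩
  have e1 : z + ‖x - z‖ • w - x = ‖x - z‖ • (w - ‖x - z‖⁻¹ • (x - z)) := by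
    rw [smul_sub, smul_smul, mul_inv_cancel₀ hρ.ne', one_smul]; abel
  change ‖z + ‖x - z‖ • w - x‖ ≤ _
  rw [e1, norm_smul, norm_norm, mul_comm]
  gcongr
  rw [← dist_eq_norm]
  rw [mem_ball] at hw hxc
  have := dist_triangle_right w (‖x - z‖⁻¹ • (x - z)) c
  linarith

/-- Points touched from both sides by paraboloids of fixed opening are almost all points of
second order differentiability. -/
theorem ae_exp2_of_touch {g : E → ℝ} {K : Set E} {p : E → E} {r C : ℝ} (hr : 0 < r)
    (hC : 0 ≤ C) (ha : ∀ y ∈ K, TouchAbove g y (p y) r C)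
    (hb : ∀ y ∈ K, TouchBelow g y (p y) r C) :
    ∀ᵐ z ∂μ, z ∈ K → ∃ S : E →L[ℝ] E, Symm S ∧ Exp2 g z (p z) S ∧
      HasFDerivWithinAt p S K z := by
  have hloc : ∀ c : E, ∀ᵐ z ∂μ, z ∈ K ∩ ball c (r / 4) → ∃ S : E →L[ℝ] E, Symm S ∧
      Exp2 g z (p z) S ∧ HasFDerivWithinAt p S K z := by
    intro c
    set K' := K ∩ ball c (r / 4)
    have hlip : LipschitzOnWith (Real.toNNReal (6 * C)) p K' := by
      refine LipschitzOnWith.of_dist_le_mul fun x hx y hy => ?_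
      rw [dist_eq_norm, dist_eq_norm, Real.coe_toNNReal _ (by positivity)]
      refine slope_lipschitz hr hC (ha x hx.1) (hb x hx.1) (ha y hy.1) ?_
      rw [← dist_eq_norm]
      have h1 := mem_ball.1 hx.2
      have h2 := mem_ball.1 hy.2
      have := dist_triangle_right x y c
      linarith
    have h1 := hlip.ae_differentiableWithinAt_of_mem (μ := μ)
    have h2 := ae_imp_of_ae_restrict (Besicovitch.ae_tendsto_measure_inter_div μ K')
    filter_upwards [h1, h2] with z hz1 hz2 hz
    have hA := (hz1 hz).hasFDerivWithinAt
    have hd := denseAt_of_density μ hz (hz2 hz)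
    obtain ⟨S, hS, hexp⟩ := exp2_symmetrize (quad_expansion_of_denseAt hr hC
      (fun y hy => ha y hy.1) (fun y hy => hb y hy.1) hA hd)
    exact ⟨S, hS, hexp, hasFDerivWithinAt_of_exp2 hr hC hS hb hexp⟩
  rw [ae_iff]
  refine measure_null_of_locally_null _ fun c _ => ?_
  refine ⟨_, inter_mem_nhdsWithin _ (ball_mem_nhds c (show (0 : ℝ) < r / 4 by positivity)), ?_⟩
  refine measure_mono_null ?_ (ae_iff.1 (hloc c))
  rintro z ⟨hz1, hz2⟩ h
  apply hz1
  intro hzK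
  exact h ⟨hzK, hz2⟩

end AlmostEverywhere

section Contact

variable {E : Type*} [NormedAddCommGroup E] [InnerProductSpace ℝ E]

/-- The points of `D'` where a paraboloid of opening `α` with vertex in `V` touches `G` from
below in `D`. -/
def contactSet (G : E → ℝ) (α : ℝ) (D D' V : Set E) : Set E :=
  {z ∈ D' | ∃ y ∈ V, ∀ x ∈ D, G z + α / 2 * ‖z - y‖ ^ 2 ≤ G x + α / 2 * ‖x - y‖ ^ 2}

theorem isCompact_contactSet {G : E → ℝ} {α : ℝ} {D D' V : Set E} (hG : Continuous G)
    (hD' : IsCompact D') (hV : IsCompact V) : IsCompact (contactSet G α D D' V) := by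
  have h : contactSet G α D D' V = Prod.fst '' ((D' ×ˢ V) ∩ {w : E × E | ∀ x ∈ D,
      G w.1 + α / 2 * ‖w.1 - w.2‖ ^ 2 ≤ G x + α / 2 * ‖x - w.2‖ ^ 2}) := by
    ext z
    constructor
    · rintro ⟨hz, y, hy, hx⟩
      exact ⟨(z, y), ⟨⟨hz, hy⟩, hx⟩, rfl⟩
    · rintro ⟨⟨z, y⟩, ⟨⟨hz, hy⟩, hx⟩, rfl⟩
      exact ⟨hz, y, hy, hx⟩
  rw [h]
  refine (IsCompact.inter_right (hD'.prod hV) ?_).image continuous_fst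
  simp only [ofPred_forall]
  refine isClosed_iInter fun x => isClosed_iInter fun _ => isClosed_le ?_ ?_ <;> fun_prop

theorem exists_contact_slope {G : E → ℝ} {α r C : ℝ} {D D' V : Set E} (hα : 0 < α) (hr : 0 < r)
    (hD : ∀ z ∈ D', ball z r ⊆ D) (hsemi : ∀ z ∈ D', ∃ q, TouchAbove G z q r C) :
    ∃ p : E → E, (∀ z ∈ contactSet G α D D' V, TouchAbove G z (p z) r (max C (α / 2)) ∧
        TouchBelow G z (p z) r (max C (α / 2)) ∧ z + α⁻¹ • p z ∈ V ∧
        ∀ x ∈ D, G z + α / 2 * ‖α⁻¹ • p z‖ ^ 2 ≤ G x + α / 2 * ‖x - (z + α⁻¹ • p z)‖ ^ 2) ∧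
      ∀ y ∈ V, ∀ z ∈ D', (∀ x ∈ D, G z + α / 2 * ‖z - y‖ ^ 2 ≤ G x + α / 2 * ‖x - y‖ ^ 2) →
        z + α⁻¹ • p z = y := by
  have hbelow : ∀ z ∈ D', ∀ y, (∀ x ∈ D, G z + α / 2 * ‖z - y‖ ^ 2 ≤ G x + α / 2 * ‖x - y‖ ^ 2) →
      TouchBelow G z (α • (y - z)) r (α / 2) := by
    intro z hz y hy x hx
    have h := hy x (hD z hz (by rwa [mem_ball, dist_eq_norm]))
    have e : ‖x - y‖ ^ 2 = ‖x - z‖ ^ 2 - 2 * ⟪y - z, x - z⟫ + ‖z - y‖ ^ 2 := by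
      have : x - y = (x - z) - (y - z) := by abel
      rw [this, norm_sub_sq_real, real_inner_comm, norm_sub_rev y z]
    rw [real_inner_smul_left]
    rw [e] at h
    nlinarith
  choose! p hp using hsemi
  have huniq : ∀ y ∈ V, ∀ z ∈ D',
      (∀ x ∈ D, G z + α / 2 * ‖z - y‖ ^ 2 ≤ G x + α / 2 * ‖x - y‖ ^ 2) →
      z + α⁻¹ • p z = y := by
    intro y _ z hz h
    rw [slope_eq hr hr (hp z hz) (hbelow z hz y h), smul_smul, inv_mul_cancel₀ hα.ne', one_smul]
    abel
  refine ⟨p, ?_, huniq⟩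
  rintro z ⟨hz, y, hy, h⟩
  have hs := slope_eq hr hr (hp z hz) (hbelow z hz y h)
  have hu := huniq y hy z hz h
  refine ⟨(hp z hz).mono le_rfl (le_max_left _ _), ?_, by rwa [hu], ?_⟩
  · have := (hbelow z hz y h).mono le_rfl (le_max_right C (α / 2))
    rwa [← hs] at this
  · intro x hx
    have h' := h x hx
    rw [hu]
    have : ‖α⁻¹ • p z‖ = ‖z - y‖ := by
      rw [← hu, norm_sub_rev, add_sub_cancel_left]
    rwa [this]

variable [FiniteDimensional ℝ E] [MeasurableSpace E] [BorelSpace E]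
  (μ : Measure E) [μ.IsAddHaarMeasure]

theorem LipschitzOnWith.addHaar_image_null {T : E → E} {s : Set E} {L : NNReal}
    (hT : LipschitzOnWith L T s) (hs : μ s = 0) : μ (T '' s) = 0 := by
  have h1 : μH[Module.finrank ℝ E] s = 0 := by
    have : (μH[Module.finrank ℝ E] : Measure E) ≪ μ :=
      Measure.absolutelyContinuous_isAddHaarMeasure _ _
    exact this hs
  have h2 := hT.hausdorffMeasure_image_le (d := Module.finrank ℝ E) (by positivity)
  rw [h1, mul_zero, nonpos_iff_eq_zero] at h2
  have : μ ≪ (μH[Module.finrank ℝ E] : Measure E) :=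
    Measure.absolutelyContinuous_isAddHaarMeasure _ _
  exact this h2

theorem addHaar_image_null_of_touch {g : E → ℝ} {K : Set E} {p : E → E} {r C : ℝ} (a : ℝ)
    (hr : 0 < r) (hC : 0 ≤ C) (ha : ∀ y ∈ K, TouchAbove g y (p y) r C)
    (hb : ∀ y ∈ K, TouchBelow g y (p y) r C) (hK : μ K = 0) :
    μ ((fun z => z + a • p z) '' K) = 0 := by
  obtain ⟨s, hs, hcov⟩ := TopologicalSpace.countable_cover_nhds
    (fun c : E => ball_mem_nhds c (show (0 : ℝ) < r / 4 by positivity))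
  have hsub : (fun z => z + a • p z) '' K ⊆
      ⋃ c ∈ s, (fun z => z + a • p z) '' (K ∩ ball c (r / 4)) := by
    rintro _ ⟨z, hz, rfl⟩
    have : z ∈ ⋃ c ∈ s, ball c (r / 4) := by rw [hcov]; trivial
    obtain ⟨c, hc, hzc⟩ := mem_iUnion₂.1 this
    exact mem_iUnion₂.2 ⟨c, hc, z, ⟨hz, hzc⟩, rfl⟩
  refine measure_mono_null hsub ((measure_biUnion_null_iff hs).2 fun c _ => ?_)
  refine LipschitzOnWith.addHaar_image_null (L := Real.toNNReal (1 + |a| * (6 * C))) μ ?_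
    (measure_mono_null inter_subset_left hK)
  refine LipschitzOnWith.of_dist_le_mul fun x hx y hy => ?_
  rw [dist_eq_norm, dist_eq_norm, Real.coe_toNNReal _ (by positivity)]
  have h := slope_lipschitz hr hC (ha x hx.1) (hb x hx.1) (ha y hy.1) (by
    rw [← dist_eq_norm]
    have h1 := mem_ball.1 hx.2
    have h2 := mem_ball.1 hy.2
    have := dist_triangle_right x y c
    linarith)
  have e : x + a • p x - (y + a • p y) = (x - y) + a • (p x - p y) := by
    rw [smul_sub]; abel
  rw [e]
  refine (norm_add_le _ _).trans ?_
  rw [norm_smul, Real.norm_eq_abs]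
  have := mul_le_mul_of_nonneg_left h (abs_nonneg a)
  linarith

theorem abs_det_le_opNorm_pow (A : E →L[ℝ] E) :
    ENNReal.ofReal |A.det| ≤ ENNReal.ofReal (‖A‖ ^ Module.finrank ℝ E) := by
  have h := Measure.addHaar_image_continuousLinearMap (Measure.addHaar : Measure E) A (closedBall 0 1)
  have h2 : A '' closedBall 0 1 ⊆ closedBall 0 ‖A‖ := by
    rintro _ ⟨x, hx, rfl⟩
    rw [mem_closedBall_zero_iff] at hx ⊢
    exact (A.le_opNorm x).trans (mul_le_of_le_one_right (norm_nonneg _) hx)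
  have h3 := measure_mono (μ := (Measure.addHaar : Measure E)) h2
  rw [h, Measure.addHaar_closedBall _ 0 (norm_nonneg A), Measure.addHaar_closedBall _ 0 zero_le_one,
    one_pow, ENNReal.ofReal_one, one_mul] at h3
  exact (ENNReal.mul_le_mul_iff_left (measure_ball_pos _ 0 one_pos).ne'
    measure_ball_lt_top.ne).1 h3

/-- The contact set is not null when the set of vertices is not. -/
theorem exists_mem_contactSet {G : E → ℝ} {α r C : ℝ} {D D' V : Set E} (hα : 0 < α) (hr : 0 < r)
    (hC : 0 ≤ C) (hD : ∀ z ∈ D', ball z r ⊆ D) (hsemi : ∀ z ∈ D', ∃ q, TouchAbove G z q r C)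
    (hmin : ∀ y ∈ V, ∃ z ∈ D', ∀ x ∈ D, G z + α / 2 * ‖z - y‖ ^ 2 ≤ G x + α / 2 * ‖x - y‖ ^ 2)
    (hV : μ V ≠ 0) {P : E → Prop} (hP : ∀ᵐ z ∂μ, z ∈ contactSet G α D D' V → P z) :
    ∃ z ∈ contactSet G α D D' V, P z := by
  by_contra! hno
  obtain ⟨p, hp, huniq⟩ := exists_contact_slope (V := V) hα hr hD hsemi
  have hnull : μ (contactSet G α D D' V) = 0 := by
    refine measure_mono_null (fun z hz => ?_) (ae_iff.1 hP)
    exact fun h => hno z hz (h hz)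
  have hC' : 0 ≤ max C (α / 2) := hC.trans (le_max_left _ _)
  have := addHaar_image_null_of_touch μ α⁻¹ hr hC' (fun y hy => (hp y hy).1)
    (fun y hy => (hp y hy).2.1) hnull
  refine hV (measure_mono_null (fun y hy => ?_) this)
  obtain ⟨z, hz, h⟩ := hmin y hy
  exact ⟨z, ⟨hz, y, hy, h⟩, huniq y hy z hz h⟩

/-- Measure estimate for the contact set. -/
theorem measure_le_contactSet {G : E → ℝ} {α r C M : ℝ} {D D' V : Set E} (hα : 0 < α)
    (hr : 0 < r) (hC : 0 ≤ C) (hM : 0 ≤ M) (hG : Continuous G) (hD' : IsCompact D')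
    (hVc : IsCompact V)
    (hD : ∀ z ∈ D', ball z r ⊆ D) (hsemi : ∀ z ∈ D', ∃ q, TouchAbove G z q r C)
    (hmin : ∀ y ∈ V, ∃ z ∈ D', ∀ x ∈ D, G z + α / 2 * ‖z - y‖ ^ 2 ≤ G x + α / 2 * ‖x - y‖ ^ 2)
    (hS : ∀ᵐ z ∂μ, z ∈ contactSet G α D D' V → ∀ p S, Symm S → Exp2 G z p S → ‖S‖ ≤ M * α) :
    μ V ≤ ENNReal.ofReal ((1 + M) ^ Module.finrank ℝ E) * μ (contactSet G α D D' V) := by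
  obtain ⟨p, hp, huniq⟩ := exists_contact_slope (V := V) hα hr hD hsemi
  set K := contactSet G α D D' V with hK
  have hC' : 0 ≤ max C (α / 2) := hC.trans (le_max_left _ _)
  have hKm : MeasurableSet K := (isCompact_contactSet hG hD' hVc).measurableSet
  have hae := ae_exp2_of_touch μ hr hC' (fun y hy => (hp y hy).1) (fun y hy => (hp y hy).2.1)
  have hae2 : ∀ᵐ z ∂μ, z ∈ K → ∃ S : E →L[ℝ] E, HasFDerivWithinAt p S K z ∧ ‖S‖ ≤ M * α := by
    filter_upwards [hae, hS] with z h1 h2 hz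
    obtain ⟨S, hS, he, hd⟩ := h1 hz
    exact ⟨S, hd, h2 hz _ S hS he⟩
  set N := toMeasurable μ {z | ¬ (z ∈ K → ∃ S : E →L[ℝ] E, HasFDerivWithinAt p S K z ∧
    ‖S‖ ≤ M * α)} with hN
  have hN0 : μ N = 0 := by rw [hN, measure_toMeasurable]; exact ae_iff.1 hae2
  have hgood : ∀ z ∈ K \ N, ∃ S : E →L[ℝ] E, HasFDerivWithinAt p S K z ∧ ‖S‖ ≤ M * α := by
    intro z hz
    by_contra h
    exact hz.2 (subset_toMeasurable μ _ fun h' => h (h' hz.1))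
  choose! S hSd hSn using hgood
  set T : E → E := fun z => z + α⁻¹ • p z with hT
  have hTd : ∀ z ∈ K \ N, HasFDerivWithinAt T (ContinuousLinearMap.id ℝ E + α⁻¹ • S z)
      (K \ N) z := fun z hz =>
    (hasFDerivWithinAt_id z _).add (((hSd z hz).mono sdiff_subset).const_smul α⁻¹)
  have h1 := addHaar_image_le_lintegral_abs_det_fderiv μ
    (hKm.diff (measurableSet_toMeasurable _ _)) hTd
  have hdet : ∀ z ∈ K \ N, ENNReal.ofReal |(ContinuousLinearMap.id ℝ E + α⁻¹ • S z).det| ≤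
      ENNReal.ofReal ((1 + M) ^ Module.finrank ℝ E) := by
    intro z hz
    refine (abs_det_le_opNorm_pow _).trans (ENNReal.ofReal_le_ofReal ?_)
    gcongr
    refine (norm_add_le _ _).trans (add_le_add ContinuousLinearMap.norm_id_le ?_)
    rw [norm_smul, norm_inv, Real.norm_of_nonneg hα.le, inv_mul_le_iff₀ hα, mul_comm]
    exact hSn z hz
  have h2 : μ (T '' (K \ N)) ≤ ENNReal.ofReal ((1 + M) ^ Module.finrank ℝ E) * μ K := by
    refine h1.trans ((setLIntegral_mono' (hKm.diff (measurableSet_toMeasurable _ _)) hdet).trans ?_)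
    rw [setLIntegral_const]
    gcongr
    exact sdiff_subset
  have h3 : μ (T '' (K ∩ N)) = 0 := addHaar_image_null_of_touch μ α⁻¹ hr hC'
    (fun y hy => (hp y hy.1).1) (fun y hy => (hp y hy.1).2.1)
    (measure_mono_null inter_subset_right hN0)
  calc μ V ≤ μ (T '' (K \ N) ∪ T '' (K ∩ N)) := by
        refine measure_mono fun y hy => ?_
        obtain ⟨z, hz, h⟩ := hmin y hy
        rw [← image_union, sdiff_union_inter]
        exact ⟨z, ⟨hz, y, hy, h⟩, huniq y hy z hz h⟩
    _ ≤ _ := measure_union_le _ _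
    _ ≤ _ := by rw [h3, add_zero]; exact h2

end Contact

section Structure

variable {E : Type*} [NormedAddCommGroup E] [InnerProductSpace ℝ E]

theorem Exp2.second_difference {g : E → ℝ} {z p : E} {S : E →L[ℝ] E} (h : Exp2 g z p S) (ξ : E)
    {η : ℝ} (hη : 0 < η) : ∃ t₀ > 0, ∀ t, 0 < t → t < t₀ →
      |g (z + t • ξ) + g (z - t • ξ) - 2 * g z - t ^ 2 * ⟪S ξ, ξ⟫| ≤ η * t ^ 2 := by
  obtain ⟨r, hr, hx⟩ := h (η / (2 * (‖ξ‖ ^ 2 + 1))) (by positivity)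
  refine ⟨r / (‖ξ‖ + 1), by positivity, fun t ht htr => ?_⟩
  have htn : ‖t • ξ‖ < r := by
    rw [norm_smul, Real.norm_of_nonneg ht.le]
    rw [lt_div_iff₀ (by positivity)] at htr
    nlinarith [norm_nonneg ξ]
  have h1 := hx (z + t • ξ) (by rwa [add_sub_cancel_left])
  have h2 := hx (z - t • ξ) (by rwa [sub_sub_cancel_left, norm_neg])
  rw [add_sub_cancel_left] at h1
  rw [sub_sub_cancel_left, norm_neg] at h2
  rw [norm_smul, Real.norm_of_nonneg ht.le] at h1 h2
  simp only [map_neg, map_smul, inner_neg_left, inner_neg_right, real_inner_smul_left,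
    real_inner_smul_right] at h1 h2
  have h3 : η / (2 * (‖ξ‖ ^ 2 + 1)) * (t * ‖ξ‖) ^ 2 ≤ η / 2 * t ^ 2 := by
    have : η / (2 * (‖ξ‖ ^ 2 + 1)) * (t * ‖ξ‖) ^ 2 =
        η / 2 * t ^ 2 * (‖ξ‖ ^ 2 / (‖ξ‖ ^ 2 + 1)) := by field_simp
    rw [this]
    refine mul_le_of_le_one_right (by positivity) ?_
    rw [div_le_one (by positivity)]; linarith
  rw [abs_le] at h1 h2 ⊢
  constructor <;> nlinarith

theorem le_quad_of_second_difference {g : E → ℝ} {z p : E} {S : E →L[ℝ] E} (h : Exp2 g z p S)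
    {ξ : E} {k t₁ : ℝ} (ht₁ : 0 < t₁)
    (hk : ∀ t, 0 < t → t < t₁ → t ^ 2 * k ≤ g (z + t • ξ) + g (z - t • ξ) - 2 * g z) :
    k ≤ ⟪S ξ, ξ⟫ := by
  refine le_of_forall_pos_le_add fun η hη => ?_
  obtain ⟨t₀, ht₀, ht⟩ := h.second_difference ξ hη
  have hm : 0 < min t₀ t₁ := lt_min ht₀ ht₁
  have h1 := (abs_le.1 (ht (min t₀ t₁ / 2) (by positivity)
    (by linarith [min_le_left t₀ t₁]))).2
  have h2 := hk (min t₀ t₁ / 2) (by positivity) (by linarith [min_le_right t₀ t₁])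
  have h3 : 0 < (min t₀ t₁ / 2) ^ 2 := by positivity
  refine le_of_mul_le_mul_left ?_ h3
  nlinarith

theorem Exp2.neg {g : E → ℝ} {z p : E} {S : E →L[ℝ] E} (h : Exp2 g z p S) :
    Exp2 (fun x => -g x) z (-p) (-S) := by
  intro η hη
  obtain ⟨r, hr, hx⟩ := h η hη
  refine ⟨r, hr, fun x hxr => ?_⟩
  rw [← abs_neg]
  refine (le_of_eq ?_).trans (hx x hxr)
  congr 1
  simp only [_root_.neg_apply, inner_neg_left]
  ring

theorem Exp2.add {g₁ g₂ : E → ℝ} {z p₁ p₂ : E} {S₁ S₂ : E →L[ℝ] E} (h₁ : Exp2 g₁ z p₁ S₁)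
    (h₂ : Exp2 g₂ z p₂ S₂) : Exp2 (fun x => g₁ x + g₂ x) z (p₁ + p₂) (S₁ + S₂) := by
  intro η hη
  obtain ⟨r₁, hr₁, hx₁⟩ := h₁ (η / 2) (by positivity)
  obtain ⟨r₂, hr₂, hx₂⟩ := h₂ (η / 2) (by positivity)
  refine ⟨min r₁ r₂, by positivity, fun x hxr => ?_⟩
  have e₁ := hx₁ x (hxr.trans_le (min_le_left _ _))
  have e₂ := hx₂ x (hxr.trans_le (min_le_right _ _))
  simp only [_root_.add_apply, inner_add_left]
  rw [abs_le] at *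
  constructor <;> nlinarith

theorem Exp2.comp_add {g : E → ℝ} {z k p : E} {S : E →L[ℝ] E}
    (h : Exp2 (fun x => g (x + k)) z p S) : Exp2 g (z + k) p S := by
  intro η hη
  obtain ⟨r, hr, hx⟩ := h η hη
  refine ⟨r, hr, fun x hxr => ?_⟩
  have e : x - k - z = x - (z + k) := by abel
  have := hx (x - k) (by rwa [e])
  simpa only [e, sub_add_cancel] using this

/-- Consequence of `(λ,Λ)`-ellipticity used throughout. -/
def Ell (lam c : ℝ) (G : (E →L[ℝ] E) → ℝ) : Prop :=
  ∀ X Y : E →L[ℝ] E, Symm X → Symm Y → ∀ m B : ℝ, ∀ e : E, 0 ≤ m → ‖e‖ = 1 →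
    (∀ ξ, ⟪(X - Y) ξ, ξ⟫ ≤ m * ‖ξ‖ ^ 2) → ⟪(X - Y) e, e⟫ ≤ -B → G X - G Y ≤ c * m - lam * B

/-- The operator solved by `-v` when `v` solves `G`. -/
def dualOp (G : (E →L[ℝ] E) → ℝ) : (E →L[ℝ] E) → ℝ := fun S => -G (-S)

/-- `G(D²v) ≥ -ε` in `U`, tested with quadratic polynomials of slope at most `L`. -/
def SubP (G : (E →L[ℝ] E) → ℝ) (ε L : ℝ) (U : Set E) (v : E → ℝ) : Prop :=
  ∀ x₀ ∈ U, ∀ p : E, ∀ X : E →L[ℝ] E, Symm X → ‖p‖ ≤ L →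
    (∃ r > 0, ∀ x, ‖x - x₀‖ < r →
      v x ≤ v x₀ + ⟪p, x - x₀⟫ + 1 / 2 * ⟪X (x - x₀), x - x₀⟫) → -ε ≤ G X

theorem Symm.add_smul_id {X : E →L[ℝ] E} (hX : Symm X) (η : ℝ) :
    Symm (X + η • ContinuousLinearMap.id ℝ E) := by
  intro x y
  simp only [_root_.add_apply, _root_.smul_apply, ContinuousLinearMap.id_apply, inner_add_left,
    inner_add_right, real_inner_smul_left, real_inner_smul_right, hX x y]

theorem Symm.neg {X : E →L[ℝ] E} (hX : Symm X) : Symm (-X) := by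
  intro x y
  simp only [_root_.neg_apply, inner_neg_left, inner_neg_right, hX x y]

theorem SubP.of_exp2 {G : (E →L[ℝ] E) → ℝ} {ε L : ℝ} {U : Set E} {v : E → ℝ}
    (h : SubP G ε L U v) {z p : E} {X : E →L[ℝ] E} (hX : Symm X) (hz : z ∈ U) (hp : ‖p‖ ≤ L)
    (hexp : Exp2 v z p X) {η : ℝ} (hη : 0 < η) :
    -ε ≤ G (X + η • ContinuousLinearMap.id ℝ E) := by
  obtain ⟨r, hr, hx⟩ := hexp (η / 2) (by positivity)
  refine h z hz p _ (hX.add_smul_id η) hp ⟨r, hr, fun x hxr => ?_⟩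
  have := (abs_le.1 (hx x hxr)).2
  simp only [_root_.add_apply, _root_.smul_apply, ContinuousLinearMap.id_apply, inner_add_left,
    real_inner_smul_left, real_inner_self_eq_norm_sq]
  linarith

/-- A subsolution and a supersolution with second order expansions cannot be ordered too
strictly. -/
theorem Ell.compare {lam c : ℝ} {G : (E →L[ℝ] E) → ℝ} (hG : Ell lam c G)
    {ε L : ℝ} {U U' : Set E} {a b : E → ℝ} (ha : SubP G ε L U a)
    (hb : SubP (dualOp G) ε L U' fun x => -b x) {z z' p p' : E} {X Y : E →L[ℝ] E}
    (hX : Symm X) (hY : Symm Y) (hz : z ∈ U) (hz' : z' ∈ U') (hp : ‖p‖ ≤ L) (hp' : ‖p'‖ ≤ L)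
    (hax : Exp2 a z p X) (hby : Exp2 b z' p' Y) {m B : ℝ} {e : E} (hm : 0 ≤ m) (he : ‖e‖ = 1)
    (h1 : ∀ ξ, ⟪(X - Y) ξ, ξ⟫ ≤ m * ‖ξ‖ ^ 2) (h2 : ⟪(X - Y) e, e⟫ ≤ -B) :
    lam * B ≤ c * m + 2 * ε := by
  have key : ∀ η > 0, lam * B ≤ c * m + 2 * ε + (2 * c + 2 * lam) * η := by
    intro η hη
    have a1 := ha.of_exp2 hX hz hp hax hη
    have b1 := hb.of_exp2 hY.neg hz' (by rwa [norm_neg]) hby.neg hη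
    rw [dualOp] at b1
    have hd : X + η • ContinuousLinearMap.id ℝ E
        - -(-Y + η • ContinuousLinearMap.id ℝ E)
        = (X - Y) + (2 * η) • ContinuousLinearMap.id ℝ E := by
      rw [two_mul, add_smul]; abel
    have hq : ∀ ξ, ⟪((X - Y) + (2 * η) • ContinuousLinearMap.id ℝ E) ξ, ξ⟫
        = ⟪(X - Y) ξ, ξ⟫ + 2 * η * ‖ξ‖ ^ 2 := by
      intro ξ
      simp only [_root_.add_apply, _root_.smul_apply, ContinuousLinearMap.id_apply,
        inner_add_left, real_inner_smul_left, real_inner_self_eq_norm_sq]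
    have := hG _ _ (hX.add_smul_id η) (hY.neg.add_smul_id η).neg (m + 2 * η) (B - 2 * η) e
      (by positivity) he
      (fun ξ => by rw [hd, hq]; nlinarith [h1 ξ]) (by rw [hd, hq, he]; linarith)
    linarith
  by_contra hlt
  push Not at hlt
  set D := lam * B - (c * m + 2 * ε) with hD
  have hD0 : 0 < D := by rw [hD]; linarith
  have := key (D / (2 * (|2 * c + 2 * lam| + 1))) (by positivity)
  have h3 : (2 * c + 2 * lam) * (D / (2 * (|2 * c + 2 * lam| + 1))) ≤ D / 2 := by
    have : (2 * c + 2 * lam) * (D / (2 * (|2 * c + 2 * lam| + 1)))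
      = D / 2 * ((2 * c + 2 * lam) / (|2 * c + 2 * lam| + 1)) := by field_simp
    rw [this]
    refine mul_le_of_le_one_right (by positivity) ?_
    rw [div_le_one (by positivity)]
    linarith [le_abs_self (2 * c + 2 * lam)]
  linarith

theorem Ell.dual {lam c : ℝ} {G : (E →L[ℝ] E) → ℝ} (hG : Ell lam c G) :
    Ell lam c (dualOp G) := by
  intro X Y hX hY m B e hm he h1 h2
  have hd : -Y - -X = X - Y := by abel
  have := hG (-Y) (-X) hY.neg hX.neg m B e hm he (by rwa [hd]) (by rwa [hd])
  simp only [dualOp]; linarith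

/-- The slope of a touching polynomial is controlled by the Lipschitz constant. -/
theorem SubP.of_lipschitz {G : (E →L[ℝ] E) → ℝ} {ε K : ℝ} {R : ℝ} {v : E → ℝ}
    (h : SubP G ε K (ball 0 R) v) (hK : 0 ≤ K)
    (hv : ∀ x ∈ ball (0 : E) R, ∀ y ∈ ball (0 : E) R, |v x - v y| ≤ K * ‖x - y‖) (L : ℝ) :
    SubP G ε L (ball 0 R) v := by
  rintro x₀ hx₀ p X hX - ⟨r, hr, hx⟩
  refine h x₀ hx₀ p X hX ?_ ⟨r, hr, hx⟩
  rcases eq_or_ne p 0 with rfl | hp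
  · simpa using hK
  have hp0 : 0 < ‖p‖ := norm_pos_iff.2 hp
  refine le_of_forall_pos_le_add fun η hη => ?_
  obtain ⟨r', hr', hball⟩ := Metric.isOpen_iff.1 isOpen_ball x₀ hx₀
  set t := min (min r r' / 2) (η / (‖X‖ + 1)) with ht
  have hm : 0 < min r r' := lt_min hr hr'
  have ht0 : 0 < t := by positivity
  have ht1 : t ≤ min r r' / 2 := min_le_left _ _
  have ht2 : t * ‖X‖ ≤ η := by
    have : t ≤ η / (‖X‖ + 1) := min_le_right _ _
    rw [le_div_iff₀ (by positivity)] at this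
    nlinarith
  set w := (t / ‖p‖) • p with hw
  have hwn : ‖w‖ = t := by
    rw [hw, norm_smul, Real.norm_of_nonneg (by positivity)]; field_simp
  have hmem : x₀ - w ∈ ball (0 : E) R := by
    apply hball
    rw [mem_ball, dist_eq_norm, sub_sub_cancel_left, norm_neg, hwn]
    linarith [min_le_right r r']
  have h1 := hx (x₀ - w) (by
    rw [sub_sub_cancel_left, norm_neg, hwn]; linarith [min_le_left r r'])
  have h2 := (abs_le.1 (hv _ hmem _ hx₀)).1
  rw [sub_sub_cancel_left] at h1 h2
  rw [norm_neg, hwn] at h2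
  rw [inner_neg_right, map_neg, inner_neg_neg] at h1
  have h3 : ⟪p, w⟫ = t * ‖p‖ := by
    rw [hw, inner_smul_right, real_inner_self_eq_norm_sq]; field_simp
  have h4 : ⟪X w, w⟫ ≤ ‖X‖ * t * t := by
    refine (real_inner_le_norm _ _).trans ?_
    rw [hwn]; gcongr; rw [← hwn]; exact X.le_opNorm w
  have h5 : t * ‖p‖ ≤ t * (K + η) := by nlinarith
  exact le_of_mul_le_mul_left h5 ht0

end Structure

section Regularization

variable {E : Type*} [NormedAddCommGroup E] [InnerProductSpace ℝ E] [FiniteDimensional ℝ E]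

/-- Approximation from above by semiconvex functions preserving the subsolution property. -/
theorem exists_supConvolution {v : E → ℝ} {R ρ σ : ℝ} (hv : ContinuousOn v (ball 0 R))
    (hρ0 : 0 ≤ ρ) (hρ : ρ < R) (hσ : 0 < σ) :
    ∃ a : E → ℝ, Continuous a ∧ (∀ x ∈ closedBall (0 : E) ρ, v x ≤ a x ∧ a x ≤ v x + σ) ∧
      (∃ C, 0 ≤ C ∧ ∀ x, ∃ q, ∀ x', a x + ⟪q, x' - x⟫ - C * ‖x' - x‖ ^ 2 ≤ a x') ∧
      ∀ G ε L, SubP G ε L (ball 0 R) v → SubP G ε L (closedBall 0 ρ) a := by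
  set ρ₁ := (R + ρ) / 2 with hρ₁
  have hρρ₁ : ρ < ρ₁ := by rw [hρ₁]; linarith
  have hsub : closedBall (0 : E) ρ₁ ⊆ ball 0 R :=
    closedBall_subset_ball (by rw [hρ₁]; linarith)
  have hvc : ContinuousOn v (closedBall (0 : E) ρ₁) := hv.mono hsub
  have hcomp : IsCompact (closedBall (0 : E) ρ₁) := isCompact_closedBall _ _
  obtain ⟨B, hB⟩ := hcomp.exists_bound_of_continuousOn hvc
  have hB0 : 0 ≤ B := (norm_nonneg _).trans (hB 0 (mem_closedBall_self (by linarith)))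
  obtain ⟨δ, hδ, huc⟩ := Metric.uniformContinuousOn_iff_le.1
    (hcomp.uniformContinuousOn_of_continuous hvc) σ hσ
  set d := min δ ((ρ₁ - ρ) / 2) with hd
  have hd0 : 0 < d := lt_min hδ (by linarith)
  set N := (2 * B + 1) / d ^ 2 with hN
  have hN0 : 0 < N := by positivity
  set f : E → closedBall (0 : E) ρ₁ → ℝ := fun x y => v y - N * ‖x - y‖ ^ 2 with hf
  have hvr : Continuous fun y : closedBall (0 : E) ρ₁ => v y :=
    continuousOn_iff_continuous_domRestrict.1 hvc
  have : CompactSpace (closedBall (0 : E) ρ₁) := isCompact_iff_compactSpace.1 hcomp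
  have : Nonempty (closedBall (0 : E) ρ₁) := ⟨⟨0, mem_closedBall_self (by linarith)⟩⟩
  have hfc : Continuous ↿f := by
    simp only [hf, Function.HasUncurry.uncurry, id]
    exact (hvr.comp continuous_snd).sub (continuous_const.mul
      ((continuous_fst.sub (continuous_subtype_val.comp continuous_snd)).norm.pow 2))
  have hfx : ∀ x, Continuous (f x) := fun x => hfc.comp (by fun_prop : Continuous fun y => (x, y))
  set a : E → ℝ := fun x => sSup (f x '' univ) with ha
  have hbdd : ∀ x, BddAbove (f x '' univ) := fun x => (isCompact_univ.image (hfx x)).bddAbove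
  have hle : ∀ x y, f x y ≤ a x := fun x y => le_csSup (hbdd x) ⟨y, trivial, rfl⟩
  have hatt : ∀ x, ∃ y, a x = f x y := by
    intro x
    obtain ⟨y, -, hy, -⟩ := isCompact_univ.exists_sSup_image_eq_and_ge univ_nonempty
      (hfx x).continuousOn
    exact ⟨y, hy⟩
  have hnear : ∀ x ∈ closedBall (0 : E) ρ, ∀ y : closedBall (0 : E) ρ₁, a x = f x y →
      ‖x - y‖ ≤ d := by
    intro x hx y hy
    have hx₁ : x ∈ closedBall (0 : E) ρ₁ := closedBall_subset_closedBall hρρ₁.le hx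
    have h1 := hle x ⟨x, hx₁⟩
    rw [hy] at h1
    simp only [hf, sub_self, norm_zero] at h1
    have h2 := abs_le.1 (hB x hx₁)
    have h3 := abs_le.1 (hB y y.2)
    by_contra hlt
    push Not at hlt
    have h4 : d ^ 2 < ‖x - y‖ ^ 2 := by gcongr
    have h5 : 2 * B + 1 < N * ‖x - y‖ ^ 2 := by
      calc 2 * B + 1 = N * d ^ 2 := by rw [hN]; field_simp
        _ < _ := by gcongr
    nlinarith
  refine ⟨a, isCompact_univ.continuous_sSup hfc, fun x hx => ?_, ⟨N, hN0.le, fun x => ?_⟩, ?_⟩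
  · have hx₁ : x ∈ closedBall (0 : E) ρ₁ := closedBall_subset_closedBall hρρ₁.le hx
    refine ⟨?_, ?_⟩
    · have := hle x ⟨x, hx₁⟩
      simpa [hf] using this
    · obtain ⟨y, hy⟩ := hatt x
      have h1 := hnear x hx y hy
      have h2 := huc y y.2 x hx₁ (by
        rw [dist_eq_norm, norm_sub_rev]; exact h1.trans (min_le_left _ _))
      rw [Real.dist_eq] at h2
      have h3 := (abs_le.1 h2).2
      rw [hy]
      simp only [hf]
      have : 0 ≤ N * ‖x - y‖ ^ 2 := by positivity
      linarith
  · obtain ⟨y, hy⟩ := hatt x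
    refine ⟨(-2 * N) • (x - y), fun x' => ?_⟩
    have h1 := hle x' y
    rw [hy]
    refine le_trans (le_of_eq ?_) h1
    simp only [hf]
    have : x' - y = (x' - x) + (x - y) := by abel
    rw [this, norm_add_sq_real, real_inner_smul_left, real_inner_comm (x - (y : E))]
    ring
  · rintro G ε L hsubP x₀ hx₀ p X hX hp ⟨r, hr, hx⟩
    obtain ⟨y, hy⟩ := hatt x₀
    have h1 := hnear x₀ hx₀ y hy
    have hyn : ‖(y : E)‖ < ρ₁ := by
      have e : (y : E) = x₀ - (x₀ - y) := by abel
      rw [e]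
      refine (norm_sub_le _ _).trans_lt ?_
      have : d ≤ (ρ₁ - ρ) / 2 := min_le_right _ _
      have := mem_closedBall_zero_iff.1 hx₀
      linarith
    refine hsubP y (hsub y.2) p X hX hp ⟨min r (ρ₁ - ‖(y : E)‖), lt_min hr (by linarith),
      fun x hxy => ?_⟩
    have hx1 : ‖x - y‖ < r := hxy.trans_le (min_le_left _ _)
    have hx2 : ‖x - y‖ < ρ₁ - ‖(y : E)‖ := hxy.trans_le (min_le_right _ _)
    have hxm : x ∈ closedBall (0 : E) ρ₁ := by
      rw [mem_closedBall_zero_iff]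
      have e : x = (x - y) + y := by abel
      rw [e]
      refine (norm_add_le _ _).trans ?_
      linarith
    have h2 := hx (x₀ + (x - y)) (by rwa [add_sub_cancel_left])
    rw [add_sub_cancel_left] at h2
    have h3 := hle (x₀ + (x - y)) ⟨x, hxm⟩
    rw [hy] at h2
    simp only [hf] at h2 h3
    have e : x₀ + (x - y) - x = x₀ - y := by abel
    rw [e] at h3
    linarith

end Regularization

section Doubling

theorem Exp2.comp_isometry {E E' : Type*} [NormedAddCommGroup E] [InnerProductSpace ℝ E]
    [NormedAddCommGroup E'] [InnerProductSpace ℝ E'] [CompleteSpace E] [CompleteSpace E']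
    {H : E → ℝ} {z P : E} {S : E →L[ℝ] E} (h : Exp2 H z P S) (hS : Symm S) {T : E' →L[ℝ] E}
    (hT : ∀ v, ‖T v‖ = ‖v‖) (x : E') :
    ∃ p X, Symm X ∧ ‖p‖ ≤ ‖P‖ ∧ Exp2 (fun x' => H (z + T (x' - x))) x p X := by
  refine ⟨ContinuousLinearMap.adjoint T P,
    (ContinuousLinearMap.adjoint T).comp (S.comp T), fun v w => ?_, ?_, fun η hη => ?_⟩
  · simp only [ContinuousLinearMap.comp_apply, ContinuousLinearMap.adjoint_inner_left,
      ContinuousLinearMap.adjoint_inner_right]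
    exact hS _ _
  · refine (ContinuousLinearMap.le_opNorm _ _).trans (mul_le_of_le_one_left (norm_nonneg _) ?_)
    rw [LinearIsometryEquiv.norm_map]
    exact T.opNorm_le_bound zero_le_one fun v => by rw [hT, one_mul]
  · obtain ⟨r, hr, hx⟩ := h η hη
    refine ⟨r, hr, fun x' hx' => ?_⟩
    have := hx (z + T (x' - x)) (by rwa [add_sub_cancel_left, hT])
    rw [add_sub_cancel_left, hT] at this
    simpa only [sub_self, map_zero, add_zero, ContinuousLinearMap.comp_apply,
      ContinuousLinearMap.adjoint_inner_left] using this

variable {E : Type*} [NormedAddCommGroup E] [InnerProductSpace ℝ E]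

theorem exp2_const_add {g : E → ℝ} {z p : E} {S : E →L[ℝ] E} {c : ℝ}
    (h : Exp2 (fun x => c + g x) z p S) : Exp2 g z p S := by
  intro η hη
  obtain ⟨r, hr, hx⟩ := h η hη
  refine ⟨r, hr, fun x hxr => ?_⟩
  simpa only [add_sub_add_left_eq_sub] using hx x hxr

variable [FiniteDimensional ℝ E] [MeasurableSpace E] [BorelSpace E]

/-- Touching the doubled function `a(x) - b(y)` from above by `φ` at a point where both `a` and
`b` are twice differentiable. -/
theorem exists_doubled_contact {a b : E → ℝ} (ha : Continuous a) (hb : Continuous b) {C : ℝ}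
    (hC : 0 ≤ C) (haC : ∀ x, ∃ q, ∀ x', a x + ⟪q, x' - x⟫ - C * ‖x' - x‖ ^ 2 ≤ a x')
    (hbC : ∀ x, ∃ q, ∀ x', -b x + ⟪q, x' - x⟫ - C * ‖x' - x‖ ^ 2 ≤ -b x')
    {φ : WithLp 2 (E × E) → ℝ} (hφc : Continuous φ) {D D' : Set (WithLp 2 (E × E))} {r α L Cφ : ℝ}
    (hr : 0 < r) (hα : 0 < α) (hCφ : 0 ≤ Cφ) (hDc : IsCompact D) (hD'D : D' ⊆ D)
    (hD : ∀ z ∈ D', ball z r ⊆ D)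
    (hφ : ∀ z ∈ D', ∃ s, ‖s‖ ≤ L ∧ TouchAbove φ z s r Cφ)
    {z₀ : WithLp 2 (E × E)} (hz₀ : z₀ ∈ D) (hDz₀ : D ⊆ closedBall z₀ 1)
    (hmin : ∀ z ∈ D, φ z - (a z.fst - b z.snd) ≤ φ z₀ - (a z₀.fst - b z₀.snd) + α → z ∈ D') :
    ∃ z ∈ D', ∃ p p' X Y, Symm X ∧ Symm Y ∧ ‖p‖ ≤ L + 2 * α ∧ ‖p'‖ ≤ L + 2 * α ∧
      Exp2 a z.fst p X ∧ Exp2 b z.snd p' Y ∧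
      ∀ ξ ζ k t₀, 0 < t₀ → (∀ t, 0 < t → t < t₀ → φ (z + t • WithLp.toLp 2 (ξ, ζ)) +
          φ (z - t • WithLp.toLp 2 (ξ, ζ)) - 2 * φ z ≤ t ^ 2 * k) →
        ⟪X ξ, ξ⟫ - ⟪Y ζ, ζ⟫ ≤ k + α * (‖ξ‖ ^ 2 + ‖ζ‖ ^ 2) := by
  set H : WithLp 2 (E × E) → ℝ := fun z => a z.fst - b z.snd with hH
  have hHc : Continuous H := by simp only [hH]; fun_prop
  set G : WithLp 2 (E × E) → ℝ := fun z => φ z - H z with hG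
  have hGc : Continuous G := hφc.sub hHc
  have hHbelow : ∀ z, ∃ q, ∀ r, TouchBelow H z q r C := by
    intro z
    obtain ⟨q₁, hq₁⟩ := haC z.fst
    obtain ⟨q₂, hq₂⟩ := hbC z.snd
    refine ⟨WithLp.toLp 2 (q₁, q₂), fun r z' _ => ?_⟩
    have h1 := hq₁ z'.fst
    have h2 := hq₂ z'.snd
    rw [WithLp.prod_inner_apply, WithLp.prod_norm_sq_eq_of_L2]
    simp only [hH, WithLp.sub_fst, WithLp.sub_snd] at *
    change a z.fst - b z.snd + (⟪q₁, z'.fst - z.fst⟫ + ⟪q₂, z'.snd - z.snd⟫) - _ ≤ _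
    linarith
  have hsemi : ∀ z ∈ D', ∃ q, TouchAbove G z q r (Cφ + C) := by
    intro z hz
    obtain ⟨s, -, hs⟩ := hφ z hz
    obtain ⟨q, hq⟩ := hHbelow z
    refine ⟨s - q, fun z' hz' => ?_⟩
    have h1 := hs z' hz'
    have h2 := hq r z' hz'
    rw [inner_sub_left]
    simp only [hG]
    linarith
  have hminz : ∀ y ∈ closedBall z₀ 1, ∃ z ∈ D', ∀ x ∈ D,
      G z + α / 2 * ‖z - y‖ ^ 2 ≤ G x + α / 2 * ‖x - y‖ ^ 2 := by
    intro y hy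
    obtain ⟨z, hzD, hz⟩ := hDc.exists_isMinOn ⟨z₀, hz₀⟩
      (f := fun x => G x + α / 2 * ‖x - y‖ ^ 2) (by fun_prop)
    refine ⟨z, hmin z hzD ?_, fun x hx => hz hx⟩
    have h1 : G z + α / 2 * ‖z - y‖ ^ 2 ≤ G z₀ + α / 2 * ‖z₀ - y‖ ^ 2 := hz hz₀
    have h2 : ‖z₀ - y‖ ≤ 1 := by rw [← dist_eq_norm, dist_comm]; exact hy
    have h3 : ‖z₀ - y‖ ^ 2 ≤ 1 := by nlinarith [norm_nonneg (z₀ - y)]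
    have h4 : 0 ≤ α / 2 * ‖z - y‖ ^ 2 := by positivity
    have : G z ≤ G z₀ + α := by nlinarith
    simpa only [hG, hH] using this
  have htouch : ∀ z ∈ contactSet G α D D' (closedBall z₀ 1), ∃ P, ‖P‖ ≤ L + 2 * α ∧
      TouchAbove H z P r (max C (Cφ + α / 2)) ∧ TouchBelow H z P r (max C (Cφ + α / 2)) := by
    rintro z ⟨hz, y, hy, h⟩
    obtain ⟨s, hsL, hs⟩ := hφ z hz
    obtain ⟨q, hq⟩ := hHbelow z
    have hup : TouchAbove H z (s + α • (z - y)) r (Cφ + α / 2) := by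
      intro x hx
      have h1 := h x (hD z hz (by rwa [mem_ball, dist_eq_norm]))
      have h2 := hs x hx
      have e : ‖x - y‖ ^ 2 = ‖x - z‖ ^ 2 + 2 * ⟪z - y, x - z⟫ + ‖z - y‖ ^ 2 := by
        have : x - y = (x - z) + (z - y) := by abel
        rw [this, norm_add_sq_real, real_inner_comm]
      rw [e] at h1
      rw [inner_add_left, real_inner_smul_left]
      simp only [hG] at h1
      linarith
    have heq := slope_eq hr hr hup (hq r)
    refine ⟨s + α • (z - y), ?_, hup.mono le_rfl (le_max_right _ _), ?_⟩
    · refine (norm_add_le _ _).trans (add_le_add hsL ?_)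
      rw [norm_smul, Real.norm_of_nonneg hα.le, mul_comm]
      gcongr
      rw [← dist_eq_norm]
      have h1 := mem_closedBall.1 (hDz₀ (hD'D hz))
      have h2 := mem_closedBall.1 hy
      linarith [dist_triangle_right z y z₀]
    · rw [heq]; exact (hq r).mono le_rfl (le_max_left _ _)
  choose! P hPL hPa hPb using htouch
  have hae := ae_exp2_of_touch (Measure.addHaar : Measure (WithLp 2 (E × E))) hr
    (hC.trans (le_max_left _ _)) hPa hPb
  obtain ⟨z, hz, S, hS, hexp, -⟩ := exists_mem_contactSet
    (Measure.addHaar : Measure (WithLp 2 (E × E))) hα hr (add_nonneg hCφ hC) hD hsemi hminz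
    (measure_closedBall_pos _ _ one_pos).ne' hae
  set T₁ : E →L[ℝ] WithLp 2 (E × E) :=
    (WithLp.prodContinuousLinearEquiv 2 ℝ E E).symm.toContinuousLinearMap.comp
      (ContinuousLinearMap.inl ℝ E E) with hT₁
  set T₂ : E →L[ℝ] WithLp 2 (E × E) :=
    (WithLp.prodContinuousLinearEquiv 2 ℝ E E).symm.toContinuousLinearMap.comp
      (ContinuousLinearMap.inr ℝ E E) with hT₂
  have hT₁v : ∀ v, T₁ v = WithLp.toLp 2 (v, 0) := fun v => rfl
  have hT₂v : ∀ v, T₂ v = WithLp.toLp 2 (0, v) := fun v => rfl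
  have hT₁n : ∀ v, ‖T₁ v‖ = ‖v‖ := fun v => by
    rw [hT₁v, WithLp.prod_norm_eq_of_L2]; simp
  have hT₂n : ∀ v, ‖T₂ v‖ = ‖v‖ := fun v => by
    rw [hT₂v, WithLp.prod_norm_eq_of_L2]; simp
  obtain ⟨p, X, hX, hp, hXe⟩ := hexp.comp_isometry hS hT₁n z.fst
  obtain ⟨p', Y, hY, hp', hYe⟩ := hexp.comp_isometry hS hT₂n z.snd
  have hXa : Exp2 a z.fst p X := by
    refine exp2_const_add (c := -b z.snd) ?_
    convert hXe using 2 with x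
    change -b z.snd + a x = a (z.fst + (x - z.fst)) - b (z.snd + 0)
    rw [add_sub_cancel, add_zero]
    ring
  have hYb : Exp2 b z.snd (-p') (-Y) := by
    have : Exp2 (fun x => -b x) z.snd p' Y := by
      refine exp2_const_add (c := a z.fst) ?_
      convert hYe using 2 with x
      change a z.fst + -b x = a (z.fst + 0) - b (z.snd + (x - z.snd))
      rw [add_sub_cancel, add_zero]
      ring
    simpa using this.neg
  refine ⟨z, hz.1, p, -p', X, -Y, hX, hY.neg, hp.trans (hPL z hz),
    by rw [norm_neg]; exact hp'.trans (hPL z hz), hXa, hYb, fun ξ ζ k t₀ ht₀ hk => ?_⟩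
  refine le_of_forall_pos_le_add fun η hη => ?_
  obtain ⟨t₁', ht₁', h1'⟩ := hXa.second_difference ξ (half_pos hη)
  obtain ⟨t₁, ht₁, ht₁₀, h1⟩ : ∃ t₁ > 0, t₁ ≤ t₀ ∧ ∀ t, 0 < t → t < t₁ →
      |a (z.fst + t • ξ) + a (z.fst - t • ξ) - 2 * a z.fst - t ^ 2 * ⟪X ξ, ξ⟫| ≤ η / 2 * t ^ 2 :=
    ⟨min t₁' t₀, lt_min ht₁' ht₀, min_le_right _ _,
      fun t h h' => h1' t h (h'.trans_le (min_le_left _ _))⟩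
  obtain ⟨t₂, ht₂, h2⟩ := hYb.second_difference ζ (half_pos hη)
  obtain ⟨hzD', y, hy, hcont⟩ := hz
  set h : WithLp 2 (E × E) := WithLp.toLp 2 (ξ, ζ) with hh
  have hhn : ‖h‖ ^ 2 = ‖ξ‖ ^ 2 + ‖ζ‖ ^ 2 :=
    WithLp.prod_norm_sq_eq_of_L2 _
  set t := min (min t₁ t₂) (r / (‖h‖ + 1)) / 2 with ht
  have hm : 0 < min (min t₁ t₂) (r / (‖h‖ + 1)) := by positivity
  have ht0 : 0 < t := by positivity
  have l1 : t < t₁ := by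
    linarith [min_le_left (min t₁ t₂) (r / (‖h‖ + 1)), min_le_left t₁ t₂]
  have l2 : t < t₂ := by
    linarith [min_le_left (min t₁ t₂) (r / (‖h‖ + 1)), min_le_right t₁ t₂]
  have l3 : ‖t • h‖ < r := by
    have : t < r / (‖h‖ + 1) := by linarith [min_le_right (min t₁ t₂) (r / (‖h‖ + 1))]
    rw [lt_div_iff₀ (by positivity)] at this
    rw [norm_smul, Real.norm_of_nonneg ht0.le]
    nlinarith [norm_nonneg h]
  have d1 := (abs_le.1 (h1 t ht0 l1)).1
  have d2 := (abs_le.1 (h2 t ht0 l2)).2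
  have c1 := hcont (z + t • h) (hD z hzD' (by
    rwa [mem_ball, dist_eq_norm, add_sub_cancel_left]))
  have c2 := hcont (z - t • h) (hD z hzD' (by
    rwa [mem_ball, dist_eq_norm, sub_sub_cancel_left, norm_neg]))
  have e1 : ‖z + t • h - y‖ ^ 2 + ‖z - t • h - y‖ ^ 2 = 2 * ‖z - y‖ ^ 2 + 2 * t ^ 2 * ‖h‖ ^ 2 := by
    have a1 : z + t • h - y = (z - y) + t • h := by abel
    have a2 : z - t • h - y = (z - y) - t • h := by abel
    rw [a1, a2, norm_add_sq_real, norm_sub_sq_real (z - y) (t • h), norm_smul, mul_pow,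
      Real.norm_eq_abs, sq_abs]
    ring
  have hk' := hk t ht0 (l1.trans_le ht₁₀)
  have hfs : ∀ s : ℝ, (z + s • h).fst = z.fst + s • ξ ∧ (z + s • h).snd = z.snd + s • ζ :=
    fun s => ⟨rfl, rfl⟩
  have hfs' : ∀ s : ℝ, (z - s • h).fst = z.fst - s • ξ ∧ (z - s • h).snd = z.snd - s • ζ :=
    fun s => ⟨rfl, rfl⟩
  simp only [hG, hH, (hfs t).1, (hfs t).2, (hfs' t).1, (hfs' t).2] at c1 c2
  rw [hhn] at e1
  refine le_of_mul_le_mul_left ?_ (show (0 : ℝ) < t ^ 2 by positivity)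
  nlinarith

end Doubling

section Lipschitz

variable {E : Type*} [NormedAddCommGroup E] [InnerProductSpace ℝ E]

theorem norm_add_le_quad {d h : E} (hd : d ≠ 0) :
    ‖d + h‖ ≤ ‖d‖ + ⟪d, h⟫ / ‖d‖ + ‖h‖ ^ 2 / (2 * ‖d‖) := by
  have hd0 : 0 < ‖d‖ := norm_pos_iff.2 hd
  have h1 := norm_add_sq_real d h
  have h2 : ‖d‖ + ⟪d, h⟫ / ‖d‖ + ‖h‖ ^ 2 / (2 * ‖d‖) = (‖d + h‖ ^ 2 + ‖d‖ ^ 2) / (2 * ‖d‖) := by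
    rw [h1]; field_simp; ring
  rw [h2, le_div_iff₀ (by positivity)]
  nlinarith [sq_nonneg (‖d + h‖ - ‖d‖)]

/-- The difference map on the doubled space. -/
def diffCLM (E : Type*) [NormedAddCommGroup E] [InnerProductSpace ℝ E] :
    WithLp 2 (E × E) →L[ℝ] E :=
  (ContinuousLinearMap.fst ℝ E E - ContinuousLinearMap.snd ℝ E E).comp
    (WithLp.prodContinuousLinearEquiv 2 ℝ E E).toContinuousLinearMap

theorem diffCLM_apply (z : WithLp 2 (E × E)) : diffCLM E z = z.fst - z.snd := rfl

theorem norm_fst_le' (z : WithLp 2 (E × E)) : ‖z.fst‖ ≤ ‖z‖ := by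
  refine abs_le_of_sq_le_sq' ?_ (norm_nonneg _) |>.2
  rw [WithLp.prod_norm_sq_eq_of_L2]; nlinarith [sq_nonneg ‖z.snd‖]

theorem norm_snd_le' (z : WithLp 2 (E × E)) : ‖z.snd‖ ≤ ‖z‖ := by
  refine abs_le_of_sq_le_sq' ?_ (norm_nonneg _) |>.2
  rw [WithLp.prod_norm_sq_eq_of_L2]; nlinarith [sq_nonneg ‖z.fst‖]

theorem norm_diffCLM_le (z : WithLp 2 (E × E)) : ‖diffCLM E z‖ ≤ 2 * ‖z‖ := by
  rw [diffCLM_apply]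
  refine (norm_sub_le _ _).trans ?_
  linarith [norm_fst_le' z, norm_snd_le' z]

/-- The penalization in the doubling argument. -/
def penalty (K M : ℝ) (c z : WithLp 2 (E × E)) : ℝ :=
  K * ‖diffCLM E z‖ - K / 2 * ‖diffCLM E z‖ ^ 2 + M * ‖z - c‖ ^ 2

theorem exists_touchAbove_penalty [CompleteSpace E] {K M r R : ℝ} (hK : 0 ≤ K) (hM : 0 ≤ M)
    (hr : 0 < r)
    {c z : WithLp 2 (E × E)} (hz : r ≤ ‖diffCLM E z‖) (hz1 : ‖diffCLM E z‖ ≤ 1)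
    (hzc : ‖z - c‖ ≤ R) :
    ∃ s, ‖s‖ ≤ 2 * K + 2 * M * R ∧ ∀ r', TouchAbove (penalty K M c) z s r' (2 * K / r + M) := by
  set d := diffCLM E z with hd
  have hd0 : 0 < ‖d‖ := hr.trans_le hz
  have hd1 : d ≠ 0 := norm_pos_iff.1 hd0
  refine ⟨(K * (1 / ‖d‖ - 1)) • ContinuousLinearMap.adjoint (diffCLM E) d + (2 * M) • (z - c),
    ?_, fun r' z' _ => ?_⟩
  · refine (norm_add_le _ _).trans (add_le_add ?_ ?_)
    · rw [norm_smul, Real.norm_of_nonneg]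
      · have h1 : ‖ContinuousLinearMap.adjoint (diffCLM E) d‖ ≤ 2 * ‖d‖ := by
          refine (ContinuousLinearMap.le_opNorm _ _).trans ?_
          gcongr
          rw [LinearIsometryEquiv.norm_map]
          exact ContinuousLinearMap.opNorm_le_bound _ zero_le_two norm_diffCLM_le
        have h2 : 0 ≤ K * (1 / ‖d‖ - 1) := mul_nonneg hK (by
          rw [sub_nonneg, le_div_iff₀ hd0]; linarith)
        calc K * (1 / ‖d‖ - 1) * ‖ContinuousLinearMap.adjoint (diffCLM E) d‖
            ≤ K * (1 / ‖d‖ - 1) * (2 * ‖d‖) := by gcongr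
          _ = 2 * K * (1 - ‖d‖) := by field_simp
          _ ≤ 2 * K * 1 := by gcongr; linarith
          _ = _ := by ring
      · exact mul_nonneg hK (by rw [sub_nonneg, le_div_iff₀ hd0]; linarith)
    · rw [norm_smul, Real.norm_of_nonneg (by positivity)]; gcongr
  · set h := z' - z with hh
    have e1 : diffCLM E z' = d + diffCLM E h := by rw [hd, ← map_add, hh]; congr 1; abel
    have e2 : z' - c = (z - c) + h := by rw [hh]; abel
    have h1 := norm_add_le_quad (h := diffCLM E h) hd1
    have h2 := norm_add_sq_real d (diffCLM E h)
    have h3 := norm_add_sq_real (z - c) h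
    have h4 : ‖diffCLM E h‖ ^ 2 ≤ 4 * ‖h‖ ^ 2 := by
      have := norm_diffCLM_le h
      nlinarith [norm_nonneg (diffCLM E h)]
    have h5 : ‖diffCLM E h‖ ^ 2 / (2 * ‖d‖) ≤ 2 * ‖h‖ ^ 2 / r := by
      rw [div_le_div_iff₀ (by positivity) hr]
      nlinarith [sq_nonneg ‖h‖, sq_nonneg ‖diffCLM E h‖]
    rw [inner_add_left, real_inner_smul_left, real_inner_smul_left,
      ContinuousLinearMap.adjoint_inner_left]
    simp only [penalty]
    rw [e1, e2, h2, h3, ← hd]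
    have h6 := mul_le_mul_of_nonneg_left (h1.trans (add_le_add_right h5 _)) hK
    have h7 : 0 ≤ K / 2 * ‖diffCLM E h‖ ^ 2 := by positivity
    have h8 : K * (1 / ‖d‖ - 1) * ⟪d, diffCLM E h⟫
        = K * (⟪d, diffCLM E h⟫ / ‖d‖) - K * ⟪d, diffCLM E h⟫ := by ring
    have h9 : (2 * K / r + M) * ‖h‖ ^ 2 = K * (2 * ‖h‖ ^ 2 / r) + M * ‖h‖ ^ 2 := by ring
    rw [h8, h9]
    linarith

theorem penalty_second_difference_diag {K M : ℝ} (c z : WithLp 2 (E × E)) (ξ : E) (t : ℝ) :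
    penalty K M c (z + t • WithLp.toLp 2 (ξ, ξ)) + penalty K M c (z - t • WithLp.toLp 2 (ξ, ξ))
      - 2 * penalty K M c z = t ^ 2 * (4 * M * ‖ξ‖ ^ 2) := by
  set h : WithLp 2 (E × E) := WithLp.toLp 2 (ξ, ξ) with hh
  have h0 : diffCLM E h = 0 := by rw [diffCLM_apply]; exact sub_self ξ
  have hn : ‖h‖ ^ 2 = ‖ξ‖ ^ 2 + ‖ξ‖ ^ 2 := WithLp.prod_norm_sq_eq_of_L2 _
  have a1 : z + t • h - c = (z - c) + t • h := by abel
  have a2 : z - t • h - c = (z - c) - t • h := by abel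
  simp only [penalty, map_add, map_sub, map_smul, h0, smul_zero, add_zero, sub_zero]
  rw [a1, a2, norm_add_sq_real, norm_sub_sq_real (z - c) (t • h), norm_smul, mul_pow,
      Real.norm_eq_abs, sq_abs, hn]
  ring

theorem penalty_second_difference_antidiag {K M : ℝ} (c z : WithLp 2 (E × E)) {e : E}
    (he : ‖e‖ = 1) (hd : diffCLM E z = ‖diffCLM E z‖ • e) {t : ℝ} (ht : 0 < t)
    (htd : t < ‖diffCLM E z‖ / 2) :
    penalty K M c (z + t • WithLp.toLp 2 (e, -e)) + penalty K M c (z - t • WithLp.toLp 2 (e, -e))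
      - 2 * penalty K M c z = t ^ 2 * (4 * M - 4 * K) := by
  set h : WithLp 2 (E × E) := WithLp.toLp 2 (e, -e) with hh
  have h0 : diffCLM E h = (2 : ℝ) • e := by
    rw [diffCLM_apply, two_smul]; exact sub_neg_eq_add e e
  have hn : ‖h‖ ^ 2 = ‖e‖ ^ 2 + ‖-e‖ ^ 2 := WithLp.prod_norm_sq_eq_of_L2 _
  rw [norm_neg, he] at hn
  have a1 : z + t • h - c = (z - c) + t • h := by abel
  have a2 : z - t • h - c = (z - c) - t • h := by abel
  set s := ‖diffCLM E z‖ with hs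
  have d1 : ‖diffCLM E z + t • (2 : ℝ) • e‖ = s + 2 * t := by
    rw [hd, smul_smul, ← add_smul, norm_smul, he, mul_one, Real.norm_of_nonneg] <;> linarith
  have d2 : ‖diffCLM E z - t • (2 : ℝ) • e‖ = s - 2 * t := by
    rw [hd, smul_smul, ← sub_smul, norm_smul, he, mul_one, Real.norm_of_nonneg] <;> linarith
  simp only [penalty, map_add, map_sub, map_smul, h0]
  rw [d1, d2, a1, a2, norm_add_sq_real, norm_sub_sq_real (z - c) (t • h), norm_smul, mul_pow,
      Real.norm_eq_abs, sq_abs, hn]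
  ring

variable [FiniteDimensional ℝ E] [MeasurableSpace E] [BorelSpace E]

/-- Interior Lipschitz estimate, one-sided form. -/
theorem lipschitz_one_sided {lam c K : ℝ} (hlam : 0 < lam) (hc : 0 ≤ c)
    (hK0 : 0 ≤ K) (hK : 258 * c + 2 < lam * (4 * K - 258)) {G : (E →L[ℝ] E) → ℝ} (hG : Ell lam c G)
    {v : E → ℝ} (hv : ContinuousOn v (ball 0 1)) (hv1 : ∀ x ∈ ball (0 : E) 1, |v x| ≤ 1)
    (hsub : SubP G 1 (2 * K + 66) (ball 0 1) v)
    (hsup : SubP (dualOp G) 1 (2 * K + 66) (ball 0 1) fun x => -v x)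
    {x₀ x₁ : E} (hx₀ : x₀ ∈ ball (0 : E) (1 / 8)) (hx₁ : x₁ ∈ ball (0 : E) (1 / 8)) :
    v x₁ - v x₀ ≤ K * ‖x₁ - x₀‖ - K / 2 * ‖x₁ - x₀‖ ^ 2 + 64 * ‖x₁ - x₀‖ ^ 2 := by
  by_contra hlt
  push Not at hlt
  set Θ := v x₁ - v x₀ - (K * ‖x₁ - x₀‖ - K / 2 * ‖x₁ - x₀‖ ^ 2 + 64 * ‖x₁ - x₀‖ ^ 2) with hΘ
  have hΘ0 : 0 < Θ := by rw [hΘ]; linarith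
  set σ := min (1 / 4) (Θ / 8) with hσ
  have hσ0 : 0 < σ := by positivity
  have hσ1 : σ ≤ 1 / 4 := min_le_left _ _
  have hσ2 : σ ≤ Θ / 8 := min_le_right _ _
  obtain ⟨a, hac, hav, ⟨C₁, hC₁, haC⟩, hasub⟩ := exists_supConvolution hv
    (show (0 : ℝ) ≤ 1 / 2 by norm_num) (by norm_num) hσ0
  obtain ⟨b', hbc, hbv, ⟨C₂, hC₂, hbC⟩, hbsub⟩ := exists_supConvolution hv.neg
    (show (0 : ℝ) ≤ 1 / 2 by norm_num) (by norm_num) hσ0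
  have hasub := hasub G 1 _ hsub
  have hbsub := hbsub (dualOp G) 1 _ hsup
  set C := max C₁ C₂
  set b : E → ℝ := fun x => -b' x with hb
  have hbneg : (fun x => -b x) = b' := by funext x; simp [hb]
  set c₀ : WithLp 2 (E × E) := WithLp.toLp 2 (x₀, x₀) with hc₀
  set z₀ : WithLp 2 (E × E) := WithLp.toLp 2 (x₁, x₀) with hz₀
  have hdc : diffCLM E c₀ = 0 := by rw [diffCLM_apply]; exact sub_self x₀
  set φ := penalty K 64 c₀ with hφ
  have hφc : Continuous φ := by
    rw [hφ]; unfold penalty; fun_prop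
  set w : WithLp 2 (E × E) → ℝ := fun z => a z.fst - b z.snd - φ z with hw
  have hwc : Continuous w := by simp only [hw, hb]; fun_prop
  have hdz : ∀ z, ‖diffCLM E z‖ ≤ 2 * ‖z - c₀‖ := by
    intro z
    have := norm_diffCLM_le (z - c₀)
    rwa [map_sub, hdc, sub_zero] at this
  have hball : ∀ z ∈ closedBall c₀ (1 / 4 : ℝ), z.fst ∈ closedBall (0 : E) (1 / 2) ∧
      z.snd ∈ closedBall (0 : E) (1 / 2) := by
    intro z hz
    rw [mem_closedBall, dist_eq_norm] at hz
    have hx := mem_ball_zero_iff.1 hx₀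
    have h1 : ‖z.fst - x₀‖ ≤ 1 / 4 := (norm_fst_le' (z - c₀)).trans hz
    have h2 : ‖z.snd - x₀‖ ≤ 1 / 4 := (norm_snd_le' (z - c₀)).trans hz
    rw [mem_closedBall_zero_iff, mem_closedBall_zero_iff]
    constructor
    · have := norm_add_le (z.fst - x₀) x₀
      rw [sub_add_cancel] at this; linarith
    · have := norm_add_le (z.snd - x₀) x₀
      rw [sub_add_cancel] at this; linarith
  have hin : closedBall (0 : E) (1 / 2) ⊆ ball 0 1 := closedBall_subset_ball (by norm_num)
  have hwv : ∀ z ∈ closedBall c₀ (1 / 4 : ℝ), w z ≤ v z.fst - v z.snd + 2 * σ - φ z := by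
    intro z hz
    have h1 := (hav _ (hball z hz).1).2
    have h2 := (hbv _ (hball z hz).2).2
    simp only [hw, hb]; simp only [Pi.neg_apply] at h2; linarith
  have hφlow : ∀ z ∈ closedBall c₀ (1 / 4 : ℝ), 64 * ‖z - c₀‖ ^ 2 ≤ φ z := by
    intro z hz
    have h1 := hdz z
    rw [mem_closedBall, dist_eq_norm] at hz
    have h2 : 0 ≤ K * ‖diffCLM E z‖ * (1 - ‖diffCLM E z‖ / 2) :=
      mul_nonneg (mul_nonneg hK0 (norm_nonneg _)) (by linarith)
    rw [hφ]; simp only [penalty]; linarith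
  set D := closedBall c₀ (1 / 4 : ℝ) with hD
  set D' := D ∩ {z | Θ / 2 ≤ w z} with hD'
  have hDc : IsCompact D := isCompact_closedBall _ _
  have hD'c : IsCompact D' := hDc.inter_right (isClosed_le continuous_const hwc)
  set O := ball c₀ (1 / 4 : ℝ) ∩ {z | diffCLM E z ≠ 0} with hO
  have hOo : IsOpen O := isOpen_ball.inter
    (isOpen_ne_fun (diffCLM E).continuous continuous_const)
  have hD'O : D' ⊆ O := by
    rintro z ⟨hz, hzw⟩
    have h1 := hwv z hz
    have h2 := hφlow z hz
    have hzw : Θ / 2 ≤ w z := hzw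
    refine ⟨?_, fun h0 => ?_⟩
    · by_contra hnot
      rw [mem_ball, dist_eq_norm, not_lt] at hnot
      have h3 : (1 / 4 : ℝ) ^ 2 ≤ ‖z - c₀‖ ^ 2 := by gcongr
      have h4 := (abs_le.1 (hv1 _ (hin (hball z hz).1))).2
      have h5 := (abs_le.1 (hv1 _ (hin (hball z hz).2))).1
      linarith
    · have h3 : z.fst = z.snd := sub_eq_zero.1 h0
      rw [h3] at h1
      have : 0 ≤ 64 * ‖z - c₀‖ ^ 2 := by positivity
      linarith
  obtain ⟨r, hr, hrO⟩ := hD'c.exists_thickening_subset_open hOo hD'O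
  have hballO : ∀ z ∈ D', ball z r ⊆ O := fun z hz =>
    (ball_subset_thickening hz r).trans hrO
  have hrd : ∀ z ∈ D', r ≤ ‖diffCLM E z‖ := by
    intro z hz
    by_contra hnot
    push Not at hnot
    have hmem : WithLp.toLp 2 (z.snd, z.snd) ∈ ball z r := by
      rw [mem_ball, dist_eq_norm]
      refine lt_of_le_of_lt ?_ hnot
      refine abs_le_of_sq_le_sq' ?_ (norm_nonneg _) |>.2
      rw [WithLp.prod_norm_sq_eq_of_L2, diffCLM_apply]
      change ‖z.snd - z.fst‖ ^ 2 + ‖z.snd - z.snd‖ ^ 2 ≤ _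
      rw [sub_self, norm_zero, norm_sub_rev]; simp
    exact (hballO z hz hmem).2 (sub_self z.snd)
  have hz₀c : ‖z₀ - c₀‖ = ‖x₁ - x₀‖ := by
    have : ‖z₀ - c₀‖ ^ 2 = ‖x₁ - x₀‖ ^ 2 := by
      rw [WithLp.prod_norm_sq_eq_of_L2]
      change ‖x₁ - x₀‖ ^ 2 + ‖x₀ - x₀‖ ^ 2 = _
      rw [sub_self]; simp
    exact (sq_eq_sq₀ (norm_nonneg _) (norm_nonneg _)).1 this
  have hx10 : ‖x₁ - x₀‖ ≤ 1 / 4 := by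
    have h1 := mem_ball_zero_iff.1 hx₀
    have h2 := mem_ball_zero_iff.1 hx₁
    exact (norm_sub_le _ _).trans (by linarith)
  have hz₀D : z₀ ∈ D := by rw [hD, mem_closedBall, dist_eq_norm, hz₀c]; exact hx10
  have hz₀w : Θ ≤ w z₀ := by
    have h1 := (hav _ (hball z₀ hz₀D).1).1
    have h2 := (hbv _ (hball z₀ hz₀D).2).1
    have h3 : φ z₀ = K * ‖x₁ - x₀‖ - K / 2 * ‖x₁ - x₀‖ ^ 2 + 64 * ‖x₁ - x₀‖ ^ 2 := by
      rw [hφ, penalty, hz₀c]; rfl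
    have h4 : w z₀ = a x₁ + b' x₀ - φ z₀ := by simp only [hw, hb, sub_neg_eq_add]; rfl
    have h1 : v x₁ ≤ a x₁ := h1
    have h2 : -v x₀ ≤ b' x₀ := h2
    rw [h4, h3, hΘ]; linarith
  set α := min 1 (Θ / 2) with hα
  have hα0 : 0 < α := by positivity
  have hα1 : α ≤ 1 := min_le_left _ _
  have hα2 : α ≤ Θ / 2 := min_le_right _ _
  obtain ⟨z, hz, p, p', X, Y, hX, hY, hp, hp', hXe, hYe, hcmp⟩ := exists_doubled_contact
    (a := a) (b := b) (C := C) (φ := φ) (D := D) (D' := D') (r := r) (α := α)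
    (L := 2 * K + 2 * 64 * (1 / 4)) (Cφ := 2 * K / r + 64) (z₀ := z₀)
    hac hbc.neg (hC₁.trans (le_max_left _ _))
    (fun x => by
      obtain ⟨q, hq⟩ := haC x
      refine ⟨q, fun x' => le_trans ?_ (hq x')⟩
      have : C₁ * ‖x' - x‖ ^ 2 ≤ C * ‖x' - x‖ ^ 2 := by gcongr; exact le_max_left _ _
      linarith)
    (fun x => by
      obtain ⟨q, hq⟩ := hbC x
      refine ⟨q, fun x' => ?_⟩
      have : C₂ * ‖x' - x‖ ^ 2 ≤ C * ‖x' - x‖ ^ 2 := by gcongr; exact le_max_right _ _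
      simp only [hb, neg_neg]
      linarith [hq x'])
    hφc hr hα0 (by positivity) hDc inter_subset_left
    (fun z hz => (hballO z hz).trans (inter_subset_left.trans ball_subset_closedBall))
    (fun z hz => by
      have h1 : ‖z - c₀‖ ≤ 1 / 4 := by rw [← dist_eq_norm]; exact hz.1
      obtain ⟨s, hs, hst⟩ := exists_touchAbove_penalty (c := c₀) hK0 (show (0 : ℝ) ≤ 64 by norm_num)
        hr (hrd z hz) (by linarith [hdz z]) h1
      exact ⟨s, hs, hst r⟩)
    hz₀D (fun z hz => by
      rw [mem_closedBall]
      have h1 := mem_closedBall.1 hz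
      have h2 := mem_closedBall.1 hz₀D
      linarith [dist_triangle_right z z₀ c₀])
    (fun z hz h => ⟨hz, by
      have : w z₀ - α ≤ w z := by simp only [hw]; linarith
      change Θ / 2 ≤ w z
      linarith⟩)
  have hd0 : 0 < ‖diffCLM E z‖ := hr.trans_le (hrd z hz)
  set e := ‖diffCLM E z‖⁻¹ • diffCLM E z with he
  have hen : ‖e‖ = 1 := by
    rw [he, norm_smul, norm_inv, norm_norm, inv_mul_cancel₀ hd0.ne']
  have hde : diffCLM E z = ‖diffCLM E z‖ • e := by
    rw [he, smul_smul, mul_inv_cancel₀ hd0.ne', one_smul]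
  have hbsub' : SubP (dualOp G) 1 (2 * K + 66) (closedBall 0 (1 / 2)) fun x => -b x := by
    rw [hbneg]; exact hbsub
  have hfinal := hG.compare hasub hbsub' hX hY (hball z hz.1).1 (hball z hz.1).2
    (by linarith) (by linarith) hXe hYe (m := 256 + 2 * α) (B := 4 * K - 256 - 2 * α)
    (by positivity) hen
    (fun ξ => by
      have := hcmp ξ ξ (4 * 64 * ‖ξ‖ ^ 2) 1 one_pos fun t _ _ =>
        (penalty_second_difference_diag c₀ z ξ t).le
      rw [_root_.sub_apply, inner_sub_left]
      linarith)
    (by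
      have := hcmp e (-e) (4 * 64 - 4 * K) (‖diffCLM E z‖ / 2) (by positivity) fun t ht ht' =>
        (penalty_second_difference_antidiag c₀ z hen hde ht ht').le
      rw [map_neg, inner_neg_neg, norm_neg, hen] at this
      rw [_root_.sub_apply, inner_sub_left]
      linarith)
  have hα1' : α ≤ 1 := by linarith
  have h₁ := mul_le_mul_of_nonneg_left hα1' hlam.le
  have h₂ := mul_le_mul_of_nonneg_left hα1' hc
  nlinarith

/-- Lipschitz estimate. -/
theorem lipschitz_estimate {lam c K : ℝ} (hlam : 0 < lam) (hc : 0 ≤ c)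
    (hK0 : 0 ≤ K) (hK : 258 * c + 2 < lam * (4 * K - 258)) {G : (E →L[ℝ] E) → ℝ} (hG : Ell lam c G)
    {v : E → ℝ} (hv : ContinuousOn v (ball 0 1)) (hv1 : ∀ x ∈ ball (0 : E) 1, |v x| ≤ 1)
    (hsub : SubP G 1 (2 * K + 66) (ball 0 1) v)
    (hsup : SubP (dualOp G) 1 (2 * K + 66) (ball 0 1) fun x => -v x)
    {x y : E} (hx : x ∈ ball (0 : E) (1 / 8)) (hy : y ∈ ball (0 : E) (1 / 8)) :
    |v x - v y| ≤ (K + 16) * ‖x - y‖ := by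
  have key : ∀ {x y : E}, x ∈ ball (0 : E) (1 / 8) → y ∈ ball (0 : E) (1 / 8) →
      v x - v y ≤ (K + 16) * ‖x - y‖ := by
    intro x y hx hy
    have h := lipschitz_one_sided hlam hc hK0 hK hG hv hv1 hsub hsup hy hx
    have hd : ‖x - y‖ ≤ 1 / 4 := by
      rw [mem_ball_zero_iff] at hx hy
      linarith [norm_sub_le x y]
    nlinarith [norm_nonneg (x - y), mul_nonneg hK0 (sq_nonneg ‖x - y‖)]
  rw [abs_le]
  constructor
  · have := key hy hx
    rw [norm_sub_rev] at this
    linarith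
  · exact key hx hy

end Lipschitz

section Supersolutions

variable {E : Type*} [NormedAddCommGroup E] [InnerProductSpace ℝ E]

/-- The second difference of `g` at `z` in direction `ξ` is at least `k` to second order. -/
def SecondDiffGE (g : E → ℝ) (z ξ : E) (k : ℝ) : Prop :=
  ∃ t₁ > 0, ∀ t, 0 < t → t < t₁ → t ^ 2 * k ≤ g (z + t • ξ) + g (z - t • ξ) - 2 * g z

theorem TouchBelow.secondDiffGE {g : E → ℝ} {z q : E} {r C : ℝ} (hr : 0 < r)
    (h : TouchBelow g z q r C) (ξ : E) : SecondDiffGE g z ξ (-(2 * C) * ‖ξ‖ ^ 2) := by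
  refine ⟨r / (‖ξ‖ + 1), by positivity, fun t ht ht' => ?_⟩
  have htn : t * ‖ξ‖ < r := by
    rw [lt_div_iff₀ (by positivity)] at ht'
    nlinarith [norm_nonneg ξ]
  have h1 := h (z + t • ξ) (by
    rw [add_sub_cancel_left, norm_smul, Real.norm_of_nonneg ht.le]; exact htn)
  have h2 := h (z - t • ξ) (by
    rw [sub_sub_cancel_left, norm_neg, norm_smul, Real.norm_of_nonneg ht.le]; exact htn)
  rw [add_sub_cancel_left, norm_smul, Real.norm_of_nonneg ht.le] at h1
  rw [sub_sub_cancel_left, norm_neg, norm_smul, Real.norm_of_nonneg ht.le, inner_neg_right] at h2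
  nlinarith

theorem exists_touchBelow_of_mem_contactSet {g : E → ℝ} {α r : ℝ} {D D' V : Set E}
    (hD : ∀ z ∈ D', ball z r ⊆ D) {z : E} (hz : z ∈ contactSet g α D D' V) :
    ∃ q, TouchBelow g z q r (α / 2) := by
  obtain ⟨hz, y, hy, hzy⟩ := hz
  refine ⟨α • (y - z), fun x hx => ?_⟩
  have h1 := hzy x (hD z hz (by rwa [mem_ball, dist_eq_norm]))
  have h2 : ‖x - y‖ ^ 2 = ‖x - z‖ ^ 2 - 2 * ⟪y - z, x - z⟫ + ‖z - y‖ ^ 2 := by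
    rw [show x - y = (x - z) - (y - z) by abel, norm_sub_sq_real, real_inner_comm,
      norm_sub_rev y z]
  rw [real_inner_smul_left]
  rw [h2] at h1
  linarith

variable [FiniteDimensional ℝ E] [MeasurableSpace E] [BorelSpace E]
variable (μ : Measure E) [μ.IsAddHaarMeasure]

/-- A semiconcave almost everywhere supersolution of the minimal operator on `U`. -/
structure RegSuper (lam c ε : ℝ) (U : Set E) (g : E → ℝ) : Prop where
  continuous : Continuous g
  semiconcave : ∃ C, 0 ≤ C ∧ ∀ z, ∃ q, ∀ x, g x ≤ g z + ⟪q, x - z⟫ + C * ‖x - z‖ ^ 2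
  ae_super : ∀ r > 0, ∀ C, 0 ≤ C → ∀ᵐ z ∂μ, z ∈ U → (∃ q, TouchBelow g z q r C) →
    ∀ m B : ℝ, ∀ e : E, 0 ≤ m → ‖e‖ = 1 → (∀ ξ, SecondDiffGE g z ξ (-m * ‖ξ‖ ^ 2)) →
      SecondDiffGE g z e B → lam * B ≤ c * m + ε

/-- A uniform limit on `U` of semiconcave almost everywhere supersolutions. -/
def Super (lam c ε : ℝ) (U : Set E) (W : E → ℝ) : Prop :=
  ∀ σ > 0, ∃ g, RegSuper μ lam c ε U g ∧ ∀ x ∈ U, |g x - W x| ≤ σ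

omit [MeasurableSpace E] [BorelSpace E] [FiniteDimensional ℝ E] in
theorem TouchBelow.of_add {f g : E → ℝ} {z q p : E} {r C D : ℝ}
    (h : TouchBelow (fun x => f x + g x) z q r C)
    (hg : ∀ x, g x ≤ g z + ⟪p, x - z⟫ + D * ‖x - z‖ ^ 2) :
    TouchBelow f z (q - p) r (C + D) := by
  intro x hx
  have h1 := h x hx
  have h2 := hg x
  rw [inner_sub_left]
  simp only at h1
  linarith

theorem ae_exp2_of_semiconcave {f : E → ℝ} {K : Set E} {r C D : ℝ} (hr : 0 < r) (hC : 0 ≤ C)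
    (hD : 0 ≤ D) (ha : ∀ z, ∃ q, ∀ x, f x ≤ f z + ⟪q, x - z⟫ + D * ‖x - z‖ ^ 2)
    (hb : ∀ z ∈ K, ∃ q, TouchBelow f z q r C) :
    ∀ᵐ z ∂μ, z ∈ K → ∃ p S, Symm S ∧ Exp2 f z p S := by
  choose q hq using ha
  have hA : ∀ z, TouchAbove f z (q z) r (max C D) := fun z x _ =>
    (hq z x).trans (by gcongr; exact le_max_right _ _)
  have hB : ∀ z ∈ K, TouchBelow f z (q z) r (max C D) := by
    intro z hz
    obtain ⟨q', hq'⟩ := hb z hz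
    have h' : TouchBelow f z q' r (max C D) := hq'.mono le_rfl (le_max_left _ _)
    rwa [slope_eq hr hr (hA z) h']
  filter_upwards [ae_exp2_of_touch μ hr (le_max_of_le_left hC) (fun z _ => hA z) hB] with z hz hzK
  obtain ⟨S, hS, hS', -⟩ := hz hzK
  exact ⟨_, S, hS, hS'⟩

/-- Differences of translates of a solution are supersolutions. -/
theorem super_of_sub_translates {lam c ε R ρ : ℝ} {G : (E →L[ℝ] E) → ℝ} (hG : Ell lam c G)
    {v : E → ℝ} (hv : ContinuousOn v (ball 0 R)) (hρ0 : 0 ≤ ρ) (hρ : ρ < R)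
    (hsub : ∀ L, SubP G ε L (ball 0 R) v)
    (hsup : ∀ L, SubP (dualOp G) ε L (ball 0 R) fun x => -v x) {U : Set E} {k l : E}
    (hk : ∀ x ∈ U, x + k ∈ closedBall (0 : E) ρ) (hl : ∀ x ∈ U, x + l ∈ closedBall (0 : E) ρ)
    (c₀ : ℝ) : Super μ lam c (2 * ε) U fun x => c₀ + v (x + k) - v (x + l) := by
  intro σ hσ
  obtain ⟨a, hac, hav, ⟨C₁, hC₁, haC⟩, hasub⟩ := exists_supConvolution hv hρ0 hρ (half_pos hσ)
  obtain ⟨b, hbc, hbv, ⟨C₂, hC₂, hbC⟩, hbsub⟩ := exists_supConvolution hv.neg hρ0 hρ (half_pos hσ)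
  set A : E → ℝ := fun x => -a (x + l) with hA
  set B : E → ℝ := fun x => -b (x + k) with hB
  have hAs : ∀ z, ∃ q, ∀ x, A x ≤ A z + ⟪q, x - z⟫ + C₁ * ‖x - z‖ ^ 2 := by
    intro z
    obtain ⟨q, hq⟩ := haC (z + l)
    refine ⟨-q, fun x => ?_⟩
    have := hq (x + l)
    rw [add_sub_add_right_eq_sub] at this
    simp only [hA, inner_neg_left]
    linarith
  have hBs : ∀ z, ∃ q, ∀ x, B x ≤ B z + ⟪q, x - z⟫ + C₂ * ‖x - z‖ ^ 2 := by
    intro z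
    obtain ⟨q, hq⟩ := hbC (z + k)
    refine ⟨-q, fun x => ?_⟩
    have := hq (x + k)
    rw [add_sub_add_right_eq_sub] at this
    simp only [hB, inner_neg_left]
    linarith
  refine ⟨fun x => c₀ + (A x + B x), ⟨by fun_prop, ⟨C₁ + C₂, by positivity, fun z => ?_⟩, ?_⟩, ?_⟩
  · obtain ⟨q, hq⟩ := hAs z
    obtain ⟨q', hq'⟩ := hBs z
    refine ⟨q + q', fun x => ?_⟩
    rw [inner_add_left]
    linarith [hq x, hq' x]
  · intro r hr C hC
    set K : Set E := {z | z ∈ U ∧ ∃ q, TouchBelow (fun x => c₀ + (A x + B x)) z q r C} with hK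
    have hK0 : ∀ z ∈ K, ∃ q, TouchBelow (fun x => A x + B x) z q r C := by
      rintro z ⟨-, q, hq⟩
      refine ⟨q, fun x hx => ?_⟩
      have := hq x hx
      simp only at this ⊢
      linarith
    have h1 := ae_exp2_of_semiconcave μ (f := A) (K := K) hr (by positivity : 0 ≤ C + C₂) hC₁ hAs
      (fun z hz => by
        obtain ⟨q, hq⟩ := hK0 z hz
        obtain ⟨p, hp⟩ := hBs z
        exact ⟨_, hq.of_add hp⟩)
    have h2 := ae_exp2_of_semiconcave μ (f := B) (K := K) hr (by positivity : 0 ≤ C + C₁) hC₂ hBs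
      (fun z hz => by
        obtain ⟨q, hq⟩ := hK0 z hz
        obtain ⟨p, hp⟩ := hAs z
        refine ⟨_, TouchBelow.of_add (g := A) (f := B) (q := q) (C := C) (fun x hx => ?_) hp⟩
        have := hq x hx
        simp only at this ⊢
        linarith)
    filter_upwards [h1, h2] with z hz1 hz2 hzU hzT m β e hm he hξ hβ
    obtain ⟨p, X, hX, hXe⟩ := hz1 ⟨hzU, hzT⟩
    obtain ⟨p', Y, hY, hYe⟩ := hz2 ⟨hzU, hzT⟩
    have hsum := hXe.add hYe
    have hlow : ∀ ξ κ, SecondDiffGE (fun x => c₀ + (A x + B x)) z ξ κ → κ ≤ ⟪(X + Y) ξ, ξ⟫ := by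
      rintro ξ κ ⟨t₁, ht₁, ht⟩
      refine le_quad_of_second_difference hsum ht₁ fun t h h' => ?_
      have := ht t h h'
      simp only at this ⊢
      linarith
    have hXa : Exp2 a (z + l) (-p) (-X) := by
      have := hXe.neg
      simp only [hA, neg_neg] at this
      exact this.comp_add
    have hYb : Exp2 (fun x => -b x) (z + k) p' Y :=
      Exp2.comp_add (g := fun x => -b x) hYe
    have hd : ∀ ξ, ⟪(-X - Y) ξ, ξ⟫ = -⟪(X + Y) ξ, ξ⟫ := by
      intro ξ
      rw [← inner_neg_left, ← _root_.neg_apply, neg_add, sub_eq_add_neg]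
    have := hG.compare (L := max ‖p‖ ‖p'‖) (hasub G ε _ (hsub _))
      (b := fun x => -b x) (by simpa only [neg_neg] using hbsub (dualOp G) ε _ (hsup _))
      hX.neg hY (hl z hzU) (hk z hzU) (by rw [norm_neg]; exact le_max_left _ _) (le_max_right _ _)
      hXa hYb (B := β) hm he (fun ξ => by rw [hd]; linarith [hlow _ _ (hξ ξ)])
      (by rw [hd]; linarith [hlow _ _ hβ])
    exact this
  · intro x hx
    have h1 := hav _ (hl x hx)
    have h2 := hbv _ (hk x hx)
    rw [abs_le]
    simp only [hA, hB]
    simp only [Pi.neg_apply] at h2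
    constructor <;> linarith

omit [FiniteDimensional ℝ E] [MeasurableSpace E] [BorelSpace E] in
theorem opNorm_le_of_quad {S : E →L[ℝ] E} (hS : Symm S) {M : ℝ} (hM : 0 < M)
    (h : ∀ ξ, |⟪S ξ, ξ⟫| ≤ M * ‖ξ‖ ^ 2) : ‖S‖ ≤ M := by
  refine S.opNorm_le_bound hM.le fun x => ?_
  have hp : ∀ y, 4 * ⟪S x, y⟫ ≤ 2 * M * (‖x‖ ^ 2 + ‖y‖ ^ 2) := by
    intro y
    have h1 := (abs_le.1 (h (x + y))).2
    have h2 := (abs_le.1 (h (x - y))).1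
    have h3 := parallelogram_law_with_norm ℝ x y
    simp only [map_add, map_sub, inner_add_left, inner_add_right, inner_sub_left,
      inner_sub_right] at h1 h2
    have h4 : ⟪S y, x⟫ = ⟪S x, y⟫ := by rw [hS y x, real_inner_comm]
    nlinarith
  have h5 := hp (M⁻¹ • S x)
  rw [inner_smul_right, real_inner_self_eq_norm_sq, norm_smul, norm_inv,
    Real.norm_of_nonneg hM.le] at h5
  refine le_of_sq_le_sq ?_ (by positivity) |>.trans_eq rfl
  have h6 : 2 * (M⁻¹ * ‖S x‖ ^ 2) ≤ 2 * M * ‖x‖ ^ 2 := by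
    have : 2 * M * (M⁻¹ * ‖S x‖) ^ 2 = 2 * (M⁻¹ * ‖S x‖ ^ 2) := by field_simp
    nlinarith
  have h7 : M * (2 * (M⁻¹ * ‖S x‖ ^ 2)) = 2 * ‖S x‖ ^ 2 := by field_simp
  nlinarith

/-- If a nonnegative supersolution is small at the centre of a ball, it is comparably small on a
set of comparable measure. -/
theorem Super.measure_estimate {lam c ε : ℝ} (hlam : 0 < lam) (hc : 0 ≤ c) {U : Set E} {W : E → ℝ}
    (hW : Super μ lam c ε U W) {x₀ : E} {r τ : ℝ} (hr : 0 < r) (hτ : 0 < τ)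
    (hU : closedBall x₀ r ⊆ U) (h0 : ∀ x ∈ closedBall x₀ r, 0 ≤ W x) (hx₀ : W x₀ ≤ τ)
    (hε : ε ≤ τ / r ^ 2) :
    μ (closedBall x₀ (r / 4)) ≤ ENNReal.ofReal ((1 + (1 + (c + 1) / lam)) ^ Module.finrank ℝ E) *
      μ {x ∈ closedBall x₀ (3 * r / 4) | W x ≤ 3 * τ} := by
  obtain ⟨g, hg, hgW⟩ := hW (τ / 4) (by positivity)
  obtain ⟨C, hC, hsemi⟩ := hg.semiconcave
  set α := 32 * τ / r ^ 2 with hα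
  have hα0 : 0 < α := by positivity
  have hαr : α * r ^ 2 = 32 * τ := by rw [hα]; field_simp
  have hsub : closedBall x₀ (3 * r / 4) ⊆ closedBall x₀ r := closedBall_subset_closedBall (by linarith)
  have hD : ∀ z ∈ closedBall x₀ (3 * r / 4), ball z (r / 4) ⊆ closedBall x₀ r := by
    intro z hz x hx
    rw [mem_closedBall] at hz ⊢
    rw [mem_ball] at hx
    linarith [dist_triangle x z x₀]
  have hlow : ∀ x ∈ closedBall x₀ r, -(τ / 4) ≤ g x := fun x hx => by
    linarith [h0 x hx, (abs_le.1 (hgW x (hU hx))).1]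
  have hx₀D : x₀ ∈ closedBall x₀ r := mem_closedBall_self hr.le
  have hup : g x₀ ≤ τ + τ / 4 := by linarith [(abs_le.1 (hgW x₀ (hU hx₀D))).2]
  have hy4 : ∀ y ∈ closedBall x₀ (r / 4), ‖x₀ - y‖ ^ 2 ≤ r ^ 2 / 16 := by
    intro y hy
    have : ‖x₀ - y‖ ≤ r / 4 := by rwa [mem_closedBall, dist_comm, dist_eq_norm] at hy
    nlinarith [norm_nonneg (x₀ - y)]
  have hmin : ∀ y ∈ closedBall x₀ (r / 4), ∃ z ∈ closedBall x₀ (3 * r / 4),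
      ∀ x ∈ closedBall x₀ r, g z + α / 2 * ‖z - y‖ ^ 2 ≤ g x + α / 2 * ‖x - y‖ ^ 2 := by
    intro y hy
    obtain ⟨z, hz, hzm⟩ := (isCompact_closedBall x₀ r).exists_isMinOn ⟨x₀, hx₀D⟩
      (f := fun x => g x + α / 2 * ‖x - y‖ ^ 2)
      (by have := hg.continuous; fun_prop)
    refine ⟨z, ?_, fun x hx => hzm hx⟩
    by_contra hz'
    rw [mem_closedBall, not_le, dist_eq_norm] at hz'
    have h1 : g z + α / 2 * ‖z - y‖ ^ 2 ≤ g x₀ + α / 2 * ‖x₀ - y‖ ^ 2 := hzm hx₀D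
    have h2 : r / 2 < ‖z - y‖ := by
      have h3 := norm_sub_le_norm_sub_add_norm_sub z y x₀
      have : ‖y - x₀‖ ≤ r / 4 := by rwa [mem_closedBall, dist_eq_norm] at hy
      linarith
    have h3 := mul_le_mul_of_nonneg_left (hy4 y hy) hα0.le
    have h4 : r ^ 2 / 4 ≤ ‖z - y‖ ^ 2 := by nlinarith
    have h5 := mul_le_mul_of_nonneg_left h4 hα0.le
    linarith [hlow z hz]
  have hmain := measure_le_contactSet μ (G := g) (α := α) (r := r / 4) (C := C)
    (M := 1 + (c + 1) / lam) (D := closedBall x₀ r) (D' := closedBall x₀ (3 * r / 4))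
    (V := closedBall x₀ (r / 4)) hα0 (by positivity) hC (by positivity) hg.continuous
    (isCompact_closedBall _ _) (isCompact_closedBall _ _) hD
    (fun z _ => (hsemi z).imp fun q hq x _ => hq x) hmin ?_
  · refine hmain.trans ?_
    gcongr
    rintro z ⟨hz, y, hy, hzy⟩
    refine ⟨hz, ?_⟩
    have h1 := hzy x₀ hx₀D
    have h3 := mul_le_mul_of_nonneg_left (hy4 y hy) hα0.le
    have h4 := (abs_le.1 (hgW z (hU (hsub hz)))).1
    have h5 : 0 ≤ α / 2 * ‖z - y‖ ^ 2 := by positivity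
    linarith
  · filter_upwards [hg.ae_super (r / 4) (by positivity) (α / 2) (by positivity)] with z hz hzK p S
      hS hSe
    obtain ⟨q, hq⟩ := exists_touchBelow_of_mem_contactSet hD hzK
    have hz' := hz (hU (hsub hzK.1)) ⟨q, hq⟩
    have hsd : ∀ ξ, SecondDiffGE g z ξ (-α * ‖ξ‖ ^ 2) := by
      intro ξ
      have := hq.secondDiffGE (by positivity) ξ
      rwa [mul_div_cancel₀ α two_ne_zero] at this
    have hneg : ∀ ξ, -α * ‖ξ‖ ^ 2 ≤ ⟪S ξ, ξ⟫ := fun ξ => by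
      obtain ⟨t₁, ht₁, ht⟩ := hsd ξ
      exact le_quad_of_second_difference hSe ht₁ ht
    have hunit : ∀ e : E, ‖e‖ = 1 → ⟪S e, e⟫ ≤ (c + 1) / lam * α := by
      intro e he
      refine le_of_forall_pos_le_add fun η hη => ?_
      obtain ⟨t₀, ht₀, ht⟩ := hSe.second_difference e hη
      have := hz' α (⟪S e, e⟫ - η) e hα0.le he hsd ⟨t₀, ht₀, fun t h h' => by
        have := (abs_le.1 (ht t h h')).1
        linarith⟩
      have hεα : ε ≤ α := hε.trans (by
        rw [hα]; gcongr; linarith)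
      have h3 : ⟪S e, e⟫ - η ≤ (c + 1) * α / lam := by
        rw [le_div_iff₀ hlam]; linarith
      rw [div_mul_eq_mul_div]
      linarith
    have hMM : (c + 1) / lam * α ≤ (1 + (c + 1) / lam) * α := by nlinarith
    refine opNorm_le_of_quad hS (by positivity) fun ξ => ?_
    rw [abs_le]
    have hcl : 0 ≤ (c + 1) / lam * α * ‖ξ‖ ^ 2 := by positivity
    have hcα : 0 ≤ α * ‖ξ‖ ^ 2 := by positivity
    constructor
    · nlinarith [hneg ξ]
    · rcases eq_or_ne ξ 0 with rfl | hξ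
      · simp
      have hn : 0 < ‖ξ‖ := norm_pos_iff.2 hξ
      have h1 := hunit (‖ξ‖⁻¹ • ξ) (by rw [norm_smul, norm_inv, norm_norm, inv_mul_cancel₀ hn.ne'])
      rw [map_smul, real_inner_smul_left, inner_smul_right] at h1
      have h2 : ⟪S ξ, ξ⟫ = ‖ξ‖ ^ 2 * (‖ξ‖⁻¹ * (‖ξ‖⁻¹ * ⟪S ξ, ξ⟫)) := by field_simp
      rw [h2]
      nlinarith [mul_le_mul_of_nonneg_left h1 (sq_nonneg ‖ξ‖)]

end Supersolutions

section Barrier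

variable {E : Type*} [NormedAddCommGroup E] [InnerProductSpace ℝ E]

/-- Radial barrier. -/
def gauss (a : ℝ) (y x : E) : ℝ := Real.exp (-(a * ‖x - y‖ ^ 2))

theorem gauss_pos (a : ℝ) (y x : E) : 0 < gauss a y x := Real.exp_pos _

theorem gauss_ge_tangent {a : ℝ} (y z x : E) :
    gauss a y z + ⟪(-(2 * a * gauss a y z)) • (z - y), x - z⟫ - a * gauss a y z * ‖x - z‖ ^ 2 ≤
      gauss a y x := by
  have h2 : ‖x - y‖ ^ 2 = ‖z - y‖ ^ 2 + 2 * ⟪z - y, x - z⟫ + ‖x - z‖ ^ 2 := by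
    rw [show x - y = (z - y) + (x - z) by abel, norm_add_sq_real]
  have h3 : gauss a y x
      = gauss a y z * Real.exp (-(a * (2 * ⟪z - y, x - z⟫ + ‖x - z‖ ^ 2))) := by
    rw [gauss, gauss, ← Real.exp_add, h2]; ring_nf
  have h4 := Real.add_one_le_exp (-(a * (2 * ⟪z - y, x - z⟫ + ‖x - z‖ ^ 2)))
  have h5 := mul_le_mul_of_nonneg_left h4 (gauss_pos a y z).le
  rw [real_inner_smul_left, h3]
  linarith

theorem two_add_sq_le_exp_add_exp (s : ℝ) : 2 + s ^ 2 ≤ Real.exp s + Real.exp (-s) := by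
  have h : |s / 2| ≤ |Real.sinh (s / 2)| := by
    rcases le_total 0 (s / 2) with h | h
    · rw [abs_of_nonneg h]
      exact (Real.self_le_sinh_iff.2 h).trans (le_abs_self _)
    · rw [abs_of_nonpos h]
      exact (neg_le_neg (Real.sinh_le_self_iff.2 h)).trans (neg_le_abs _)
  have h2 := sq_le_sq.2 h
  have h3 : Real.exp s + Real.exp (-s) = 2 * Real.cosh s := by rw [Real.cosh_eq]; ring
  have h4 : Real.cosh s = 1 + 2 * Real.sinh (s / 2) ^ 2 := by
    rw [← mul_div_cancel₀ s two_ne_zero, Real.cosh_two_mul, Real.cosh_sq,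
      mul_div_cancel₀ s two_ne_zero]
    ring
  rw [h3, h4]
  linarith

theorem gauss_second_difference (a : ℝ) (y z ξ : E) (t : ℝ) :
    gauss a y z * ((1 - a * t ^ 2 * ‖ξ‖ ^ 2) * (2 + (2 * a * t * ⟪z - y, ξ⟫) ^ 2) - 2) ≤
      gauss a y (z + t • ξ) + gauss a y (z - t • ξ) - 2 * gauss a y z := by
  have h1 : ∀ s : ℝ, gauss a y (z + s • ξ) = gauss a y z *
      (Real.exp (-(a * s ^ 2 * ‖ξ‖ ^ 2)) * Real.exp (-(2 * a * s * ⟪z - y, ξ⟫))) := by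
    intro s
    rw [gauss, gauss, ← Real.exp_add, ← Real.exp_add,
      show z + s • ξ - y = (z - y) + s • ξ by abel, norm_add_sq_real, inner_smul_right, norm_smul,
      mul_pow, Real.norm_eq_abs, sq_abs]
    ring_nf
  have h2 := h1 t
  have h3 := h1 (-t)
  rw [neg_smul, ← sub_eq_add_neg] at h3
  rw [h2, h3]
  have h4 := two_add_sq_le_exp_add_exp (2 * a * t * ⟪z - y, ξ⟫)
  have h5 := Real.add_one_le_exp (-(a * t ^ 2 * ‖ξ‖ ^ 2))
  have h6 : (1 - a * t ^ 2 * ‖ξ‖ ^ 2) * (2 + (2 * a * t * ⟪z - y, ξ⟫) ^ 2) ≤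
      Real.exp (-(a * t ^ 2 * ‖ξ‖ ^ 2)) *
        (Real.exp (2 * a * t * ⟪z - y, ξ⟫) + Real.exp (-(2 * a * t * ⟪z - y, ξ⟫))) := by
    calc _ ≤ Real.exp (-(a * t ^ 2 * ‖ξ‖ ^ 2)) * (2 + (2 * a * t * ⟪z - y, ξ⟫) ^ 2) := by
          gcongr; linarith
      _ ≤ _ := by gcongr
  have h7 := mul_le_mul_of_nonneg_left h6 (gauss_pos a y z).le
  rw [neg_sq]
  have e1 : -(2 * a * -t * ⟪z - y, ξ⟫) = 2 * a * t * ⟪z - y, ξ⟫ := by ring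
  rw [e1]
  linarith

theorem continuous_gauss (a : ℝ) (y : E) : Continuous (gauss a y) := by
  unfold gauss; fun_prop

theorem gauss_le_one {a : ℝ} (ha : 0 ≤ a) (y x : E) : gauss a y x ≤ 1 := by
  rw [gauss, Real.exp_le_one_iff]
  have : 0 ≤ a * ‖x - y‖ ^ 2 := by positivity
  linarith

theorem SecondDiffGE.of_sub_gauss {g : E → ℝ} {y z ξ : E} {a α τ b : ℝ} (hτ : 0 ≤ τ)
    (h : SecondDiffGE (fun x => g x - τ * (gauss a y x - b)) z ξ (-α * ‖ξ‖ ^ 2)) :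
    SecondDiffGE g z ξ (-(2 * a * τ * gauss a y z + α) * ‖ξ‖ ^ 2) := by
  obtain ⟨t₁, ht₁, ht⟩ := h
  refine ⟨t₁, ht₁, fun t h h' => ?_⟩
  have e1 := ht t h h'
  have e2 := gauss_ge_tangent (a := a) y z (z + t • ξ)
  have e3 := gauss_ge_tangent (a := a) y z (z - t • ξ)
  rw [add_sub_cancel_left, norm_smul, Real.norm_of_nonneg h.le] at e2
  rw [sub_sub_cancel_left, norm_neg, norm_smul, Real.norm_of_nonneg h.le, inner_neg_right] at e3
  have e4 := mul_le_mul_of_nonneg_left (add_le_add e2 e3) hτ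
  simp only at e1
  linarith

theorem SecondDiffGE.of_sub_gauss_radial {g : E → ℝ} {y z e : E} {a α τ b d s : ℝ} (hτ : 0 ≤ τ)
    (ha : 0 ≤ a) (hs : 0 < s) (he : ‖e‖ = 1) (hd : ⟪z - y, e⟫ = d)
    (h : SecondDiffGE (fun x => g x - τ * (gauss a y x - b)) z e (-α)) :
    SecondDiffGE g z e (τ * gauss a y z * (4 * a ^ 2 * d ^ 2 - 2 * a - s) - α) := by
  obtain ⟨t₁, ht₁, ht⟩ := h
  have hP : 0 ≤ 4 * a ^ 3 * d ^ 2 := by positivity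
  refine ⟨min t₁ (min 1 (s / (1 + 4 * a ^ 3 * d ^ 2))), by positivity, fun t h h' => ?_⟩
  have e1 := ht t h (h'.trans_le (min_le_left _ _))
  have e2 := gauss_second_difference a y z e t
  have h2 := h'.trans_le (min_le_right _ _)
  have ht1 := h2.trans_le (min_le_left _ _)
  have e3 := h2.trans_le (min_le_right _ _)
  rw [lt_div_iff₀ (by positivity)] at e3
  rw [he, hd] at e2
  have e4 := mul_le_mul_of_nonneg_left e2 hτ
  simp only at e1
  have e5 : t ^ 2 * (4 * a ^ 3 * d ^ 2) ≤ s := by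
    have : t ^ 2 ≤ t := by nlinarith
    have := mul_le_mul_of_nonneg_right this hP
    linarith
  have e6 := mul_le_mul_of_nonneg_left e5
    (mul_nonneg (mul_nonneg hτ (gauss_pos a y z).le) (sq_nonneg t))
  have e7 : τ * (gauss a y z * ((1 - a * t ^ 2 * 1 ^ 2) * (2 + (2 * a * t * d) ^ 2) - 2)) =
      t ^ 2 * (τ * gauss a y z * (4 * a ^ 2 * d ^ 2 - 2 * a)) -
      τ * gauss a y z * t ^ 2 * (t ^ 2 * (4 * a ^ 3 * d ^ 2)) := by ring
  rw [e7] at e4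
  have e8 : t ^ 2 * (τ * gauss a y z * (4 * a ^ 2 * d ^ 2 - 2 * a - s) - α) =
    t ^ 2 * (τ * gauss a y z * (4 * a ^ 2 * d ^ 2 - 2 * a)) - τ * gauss a y z * t ^ 2 * s
      + t ^ 2 * (-α) := by ring
  rw [e8]
  linarith

/-- The gradient and opening of the paraboloid below `τ • gauss`. -/
theorem gauss_touch {a τ : ℝ} (ha : 0 ≤ a) (hτ : 0 ≤ τ) (y z x : E) :
    τ * gauss a y z + ⟪τ • ((-(2 * a * gauss a y z)) • (z - y)), x - z⟫
      - τ * a * ‖x - z‖ ^ 2 ≤ τ * gauss a y x := by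
  have e2 := mul_le_mul_of_nonneg_left (gauss_ge_tangent (a := a) y z x) hτ
  have e3 : gauss a y z * (τ * a * ‖x - z‖ ^ 2) ≤ τ * a * ‖x - z‖ ^ 2 :=
    mul_le_of_le_one_left (by positivity) (gauss_le_one ha y z)
  rw [real_inner_smul_left _ _ τ]
  linarith

theorem barrier_arith {lam c ε k b r τ a d γ ω : ℝ} (hlam : 0 < lam) (hc : 0 ≤ c) (hk : 0 < k)
    (hkc : 1 ≤ lam * (k ^ 2 - 2 * k - 1) - 2 * c * k) (hb0 : 0 < b) (hr : 0 < r) (hτ : 0 < τ)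
    (hd : r / 2 ≤ d) (har : a * r ^ 2 = k) (hγb : b ≤ γ) (hω : (c + lam) * ω ≤ b / 4)
    (hε : ε ≤ b / 2 * τ / r ^ 2)
    (h : lam * (τ * γ * (4 * a ^ 2 * d ^ 2 - 2 * a - 1 / r ^ 2) - ω * (τ / r ^ 2)) ≤
      c * (2 * a * τ * γ + ω * (τ / r ^ 2)) + ε) : False := by
  have ha : a = k / r ^ 2 := by rw [← har]; field_simp
  have hγ : 0 < γ := hb0.trans_le hγb
  have e1 : k ^ 2 / r ^ 2 ≤ 4 * a ^ 2 * d ^ 2 := by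
    have := mul_le_mul_of_nonneg_left (pow_le_pow_left₀ (by positivity) hd 2)
      (by positivity : 0 ≤ 4 * a ^ 2)
    refine le_trans (le_of_eq ?_) this
    rw [ha]; field_simp; norm_num
  have e2 : τ * γ * (k ^ 2 / r ^ 2 - 2 * a - 1 / r ^ 2) ≤
      τ * γ * (4 * a ^ 2 * d ^ 2 - 2 * a - 1 / r ^ 2) := by gcongr
  have e3 := mul_le_mul_of_nonneg_left e2 hlam.le
  have e4 : τ * γ * (k ^ 2 / r ^ 2 - 2 * a - 1 / r ^ 2)
      = τ * γ / r ^ 2 * (k ^ 2 - 2 * k - 1) := by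
    rw [ha]; field_simp
  have e5 : 2 * a * τ * γ = τ * γ / r ^ 2 * (2 * k) := by rw [ha]; field_simp
  have e6 : τ * γ / r ^ 2 * 1 ≤ τ * γ / r ^ 2 * (lam * (k ^ 2 - 2 * k - 1) - 2 * c * k) := by
    gcongr
  have e7 : (c + lam) * ω * (τ / r ^ 2) ≤ b / 4 * (τ / r ^ 2) := by gcongr
  have e8 : b * (τ / r ^ 2) ≤ τ * γ / r ^ 2 := by
    rw [mul_div_assoc', mul_comm b]; gcongr
  have e9 : ε ≤ b / 2 * (τ / r ^ 2) := by rw [mul_div_assoc']; exact hε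
  have e10 : 0 < b * (τ / r ^ 2) := by positivity
  rw [e5] at h
  rw [e4] at e3
  linarith

variable [FiniteDimensional ℝ E] [MeasurableSpace E] [BorelSpace E]
variable (μ : Measure E) [μ.IsAddHaarMeasure]

set_option maxHeartbeats 1000000 in
/-- Lower bound for supersolutions in a ball around a smaller ball where they are large. -/
theorem Super.barrier {lam c ε k θ b : ℝ} (hlam : 0 < lam) (hc : 0 ≤ c) (hk : 0 < k)
    (hkc : 1 ≤ lam * (k ^ 2 - 2 * k - 1) - 2 * c * k) (hb : b = Real.exp (-(64 * k)))
    (hθ : θ = (Real.exp (-(25 * k)) - b) / 2) {U : Set E} {W : E → ℝ}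
    (hW : Super μ lam c ε U W) {y : E} {r τ : ℝ} (hr : 0 < r) (hτ : 0 < τ)
    (hU : closedBall y (8 * r) ⊆ U) (h0 : ∀ x ∈ closedBall y (8 * r), 0 ≤ W x)
    (h1 : ∀ x ∈ closedBall y (r / 2), τ ≤ W x) (hε : ε ≤ b / 2 * τ / r ^ 2) {x₁ : E}
    (hx₁ : x₁ ∈ closedBall y (5 * r)) : θ * τ ≤ W x₁ := by
  by_contra hlt
  push Not at hlt
  have hb0 : 0 < b := hb ▸ Real.exp_pos _
  have hθ0 : 0 < θ := by
    have : Real.exp (-(64 * k)) < Real.exp (-(25 * k)) := Real.exp_lt_exp.2 (by linarith)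
    rw [hθ, hb]; linarith
  set a := k / r ^ 2 with ha
  have ha0 : 0 < a := by positivity
  have har : a * r ^ 2 = k := by rw [ha]; field_simp
  obtain ⟨g, hg, hgW⟩ := hW (θ * τ / 4) (by positivity)
  obtain ⟨C, hC, hsemi⟩ := hg.semiconcave
  set ω := min (θ / 162) (b / (4 * (c + lam))) with hω
  have hω0 : 0 < ω := by positivity
  have hω1 : ω ≤ θ / 162 := min_le_left _ _
  have hω2 : (c + lam) * ω ≤ b / 4 := by
    have := min_le_right (θ / 162) (b / (4 * (c + lam)))
    rw [← hω, le_div_iff₀ (by positivity)] at this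
    linarith
  set α := ω * (τ / r ^ 2) with hα
  have hα0 : 0 < α := by positivity
  have hαr : α * r ^ 2 = ω * τ := by rw [hα]; field_simp
  set G : E → ℝ := fun x => g x - τ * (gauss a y x - b) with hG
  have hGc : Continuous G := by
    have := hg.continuous
    have := continuous_gauss a y
    fun_prop
  have hGsemi : ∀ z, ∃ q, ∀ x, G x ≤ G z + ⟪q, x - z⟫ + (C + τ * a) * ‖x - z‖ ^ 2 := by
    intro z
    obtain ⟨q, hq⟩ := hsemi z
    refine ⟨q - τ • ((-(2 * a * gauss a y z)) • (z - y)), fun x => ?_⟩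
    have e1 := hq x
    have e2 := gauss_touch ha0.le hτ.le y z x
    rw [inner_sub_left]
    simp only [hG]
    linarith
  set D' : Set E := {z | z ∈ closedBall y (8 * r) ∧ G z ≤ -(θ * τ / 2)} with hD'
  have hD'c : IsCompact D' :=
    (isCompact_closedBall y (8 * r)).inter_right (isClosed_le hGc continuous_const)
  have hglow : ∀ x ∈ closedBall y (8 * r), -(θ * τ / 4) ≤ g x := fun x hx => by
    linarith [h0 x hx, (abs_le.1 (hgW x (hU hx))).1]
  have hD'b : D' ⊆ ball y (8 * r) := by
    rintro z ⟨hz, hzG⟩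
    by_contra hzn
    rw [mem_ball, not_lt, dist_eq_norm] at hzn
    have e1 : gauss a y z ≤ b := by
      rw [gauss, hb, Real.exp_le_exp, ← har]
      nlinarith [mul_le_mul_of_nonneg_left (pow_le_pow_left₀ (by positivity) hzn 2) ha0.le]
    have e2 := hglow z hz
    simp only [hG] at hzG
    nlinarith
  obtain ⟨δ, hδ, hδD⟩ := hD'c.exists_thickening_subset_open isOpen_ball hD'b
  have hD : ∀ z ∈ D', ball z δ ⊆ closedBall y (8 * r) := fun z hz =>
    (ball_subset_thickening hz δ).trans (hδD.trans ball_subset_closedBall)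
  have hx₁8 : x₁ ∈ closedBall y (8 * r) := closedBall_subset_closedBall (by linarith) hx₁
  have hG1 : G x₁ ≤ -(θ * τ) + θ * τ / 4 := by
    have e1 : 2 * θ ≤ gauss a y x₁ - b := by
      have : Real.exp (-(25 * k)) ≤ gauss a y x₁ := by
        rw [mem_closedBall, dist_eq_norm] at hx₁
        rw [gauss, Real.exp_le_exp, ← har]
        nlinarith [mul_le_mul_of_nonneg_left (pow_le_pow_left₀ (norm_nonneg _) hx₁ 2) ha0.le]
      rw [hθ]; linarith
    have e2 := mul_le_mul_of_nonneg_left e1 hτ.le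
    have e3 := (abs_le.1 (hgW x₁ (hU hx₁8))).2
    simp only [hG]
    linarith
  have hmin : ∀ v ∈ closedBall y r, ∃ z ∈ D', ∀ x ∈ closedBall y (8 * r),
      G z + α / 2 * ‖z - v‖ ^ 2 ≤ G x + α / 2 * ‖x - v‖ ^ 2 := by
    intro v hv
    obtain ⟨z, hz, hzm⟩ := (isCompact_closedBall y (8 * r)).exists_isMinOn ⟨x₁, hx₁8⟩
      (f := fun x => G x + α / 2 * ‖x - v‖ ^ 2) (by fun_prop)
    refine ⟨z, ⟨hz, ?_⟩, fun x hx => hzm hx⟩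
    have e1 : G z + α / 2 * ‖z - v‖ ^ 2 ≤ G x₁ + α / 2 * ‖x₁ - v‖ ^ 2 := hzm hx₁8
    have e2 : ‖x₁ - v‖ ≤ 9 * r := by
      rw [mem_closedBall, dist_eq_norm] at hv hx₁8
      have := norm_sub_le_norm_sub_add_norm_sub x₁ y v
      rw [norm_sub_rev y v] at this
      linarith
    have e3 := mul_le_mul_of_nonneg_left (pow_le_pow_left₀ (norm_nonneg _) e2 2) hα0.le
    have e4 : 0 ≤ α / 2 * ‖z - v‖ ^ 2 := by positivity
    have e5 : ω * τ ≤ θ / 162 * τ := by gcongr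
    nlinarith
  have hVpos : μ (closedBall y r) ≠ 0 := (measure_closedBall_pos μ y hr).ne'
  obtain ⟨z, hz, hzP⟩ := exists_mem_contactSet μ (G := G) (α := α) (r := δ) (C := C + τ * a)
    (D := closedBall y (8 * r)) (D' := D') (V := closedBall y r) hα0 hδ (by positivity) hD
    (fun z _ => (hGsemi z).imp fun q hq x _ => hq x) hmin hVpos
    ((hg.ae_super δ hδ (α / 2 + τ * a) (by positivity)).mono fun z h _ => h)
  obtain ⟨q, hq⟩ := exists_touchBelow_of_mem_contactSet hD hz
  have hz8 := hz.1.1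
  have hzG := hz.1.2
  have hzb : ‖z - y‖ < 8 * r := by
    have := hD'b hz.1
    rwa [mem_ball, dist_eq_norm] at this
  set γ := gauss a y z with hγ
  have hγ0 : 0 < γ := gauss_pos _ _ _
  have hγ1 : γ ≤ 1 := gauss_le_one ha0.le _ _
  have hγb : b ≤ γ := by
    rw [hγ, gauss, hb, Real.exp_le_exp, ← har]
    nlinarith [mul_le_mul_of_nonneg_left (pow_le_pow_left₀ (norm_nonneg _) hzb.le 2) ha0.le]
  have hd : r / 2 < ‖z - y‖ := by
    by_contra hd
    push Not at hd
    have e1 := h1 z (by rwa [mem_closedBall, dist_eq_norm])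
    have e2 := (abs_le.1 (hgW z (hU hz8))).1
    have e3 : τ * (γ - b) ≤ τ * 1 := mul_le_mul_of_nonneg_left (by linarith) hτ.le
    simp only [hG] at hzG
    nlinarith
  have hsd := fun ξ => hq.secondDiffGE hδ ξ
  rw [mul_div_cancel₀ α two_ne_zero] at hsd
  have hqg : TouchBelow g z (q + τ • ((-(2 * a * γ)) • (z - y))) δ (α / 2 + τ * a) := by
    intro x hx
    have e1 := hq x hx
    have e2 := gauss_touch ha0.le hτ.le y z x
    rw [inner_add_left]
    simp only [hG] at e1
    rw [← hγ] at e1 e2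
    linarith
  set d := ‖z - y‖ with hdd
  have hd0 : 0 < d := by linarith
  set e := d⁻¹ • (z - y) with he
  have hen : ‖e‖ = 1 := by
    rw [he, norm_smul, norm_inv, Real.norm_of_nonneg hd0.le, ← hdd, inv_mul_cancel₀ hd0.ne']
  have hei : ⟪z - y, e⟫ = d := by
    rw [he, inner_smul_right, real_inner_self_eq_norm_sq, ← hdd]; field_simp
  have hfin := hzP (hU hz8) ⟨_, hqg⟩ (2 * a * τ * γ + α)
    (τ * γ * (4 * a ^ 2 * d ^ 2 - 2 * a - 1 / r ^ 2) - α) e (by positivity) hen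
    (fun ξ => (hsd ξ).of_sub_gauss hτ.le)
    (SecondDiffGE.of_sub_gauss_radial (b := b) hτ.le ha0.le (by positivity) hen hei (by
      have := hsd e
      rwa [hen, one_pow, mul_one] at this))
  exact barrier_arith hlam hc hk hkc hb0 hr hτ hd.le har hγb hω2 hε hfin

end Barrier

section Covering

variable {E : Type*} [NormedAddCommGroup E] [InnerProductSpace ℝ E]
variable [FiniteDimensional ℝ E] [MeasurableSpace E] [BorelSpace E]
variable (μ : Measure E) [μ.IsAddHaarMeasure]

/-- A set that has positive density in the balls of `Q ∖ A` near `A` has positive density in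
`Q ∖ A`. -/
theorem measure_closedBall_diff_le {s : ℝ} (hs : 0 < s) {A T : Set E} (hA : IsCompact A)
    (hAn : A.Nonempty) (hAQ : A ⊆ closedBall 0 s) (hT : MeasurableSet T) {N : ENNReal}
    (h : ∀ y r, 0 < r → r ≤ s / 2 → closedBall y r ⊆ closedBall 0 s →
      (A ∩ closedBall y (5 * r)).Nonempty → μ (closedBall y r) ≤ N * μ (closedBall y r ∩ T)) :
    μ (closedBall 0 s \ A) ≤
      ENNReal.ofReal (5 ^ Module.finrank ℝ E) * N * μ ((closedBall 0 s \ A) ∩ T) := by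
  set B := closedBall (0 : E) s \ A with hB
  set ρ : E → ℝ := fun x => infDist x A / 4 with hρ
  set c : E → E := fun x => (1 - infDist x A / (4 * s)) • x with hc
  have hρle : ∀ x ∈ B, ρ x ≤ s / 2 := by
    intro x hx
    obtain ⟨a, ha⟩ := hAn
    have h1 := infDist_le_dist_of_mem (x := x) ha
    have h2 := mem_closedBall.1 (hAQ ha)
    have h3 := mem_closedBall.1 hx.1
    have := dist_triangle_right x a 0
    simp only [hρ]; linarith
  have hρpos : ∀ x ∈ B, 0 < ρ x := by
    intro x hx
    have : 0 < infDist x A := (hA.isClosed.notMem_iff_infDist_pos hAn).1 hx.2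
    simp only [hρ]; linarith
  have hcx : ∀ x ∈ B, dist x (c x) ≤ ρ x := by
    intro x hx
    have h0 := hρpos x hx
    have h3 := mem_closedBall_zero_iff.1 hx.1
    rw [dist_eq_norm, show x - c x = (infDist x A / (4 * s)) • x by
      simp only [hc]; rw [sub_smul, one_smul]; abel, norm_smul,
      Real.norm_of_nonneg (by have := infDist_nonneg (x := x) (s := A); positivity)]
    have : infDist x A / (4 * s) * ‖x‖ ≤ infDist x A / (4 * s) * s :=
      mul_le_mul_of_nonneg_left h3 (by have := infDist_nonneg (x := x) (s := A); positivity)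
    refine this.trans (le_of_eq ?_)
    simp only [hρ]; field_simp
  have hcQ : ∀ x ∈ B, closedBall (c x) (ρ x) ⊆ closedBall 0 s := by
    intro x hx
    have h0 := hρle x hx
    have h3 := mem_closedBall_zero_iff.1 hx.1
    have h4 : infDist x A / (4 * s) ≤ 1 := by
      rw [div_le_one (by positivity)]; simp only [hρ] at h0; linarith
    refine closedBall_subset_closedBall' ?_
    rw [dist_zero_right]
    simp only [hc]
    rw [norm_smul, Real.norm_of_nonneg (by linarith)]
    have : (1 - infDist x A / (4 * s)) * ‖x‖ ≤ (1 - infDist x A / (4 * s)) * s :=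
      mul_le_mul_of_nonneg_left h3 (by linarith)
    have e : (1 - infDist x A / (4 * s)) * s = s - ρ x := by
      simp only [hρ]; field_simp
    linarith
  have hcA : ∀ x ∈ B, Disjoint (closedBall (c x) (ρ x)) A := by
    intro x hx
    rw [Set.disjoint_left]
    intro z hz hzA
    have h1 := infDist_le_dist_of_mem (x := x) hzA
    have h2 := dist_triangle x (c x) z
    have h3 := mem_closedBall'.1 hz
    have h4 := hcx x hx
    have h5 := hρpos x hx
    simp only [hρ] at *
    linarith
  have hcB : ∀ x ∈ B, closedBall (c x) (ρ x) ⊆ B := fun x hx z hz =>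
    ⟨hcQ x hx hz, fun hzA => Set.disjoint_left.1 (hcA x hx) hz hzA⟩
  have hnear : ∀ x ∈ B, (A ∩ closedBall (c x) (5 * ρ x)).Nonempty := by
    intro x hx
    obtain ⟨a, ha, had⟩ := hA.exists_infDist_eq_dist hAn x
    refine ⟨a, ha, ?_⟩
    rw [mem_closedBall']
    have h4 := hcx x hx
    have h2 := dist_triangle_left (c x) a x
    simp only [hρ] at *
    linarith
  obtain ⟨u, huB, hdisj, hcov⟩ := Vitali.exists_disjoint_subfamily_covering_enlargement_closedBall
    B c ρ (s / 2) hρle 5 (by norm_num)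
  have hcount : u.Countable := hdisj.countable_of_nonempty_interior fun x hx =>
    ⟨c x, ball_subset_interior_closedBall (mem_ball_self (hρpos x (huB hx)))⟩
  have : Countable u := hcount
  calc μ B ≤ μ (⋃ x ∈ u, closedBall (c x) (5 * ρ x)) := by
        refine measure_mono fun x hx => ?_
        obtain ⟨b, hb, hsub⟩ := hcov x hx
        exact mem_biUnion hb (hsub (mem_closedBall.2 (hcx x hx)))
    _ ≤ ∑' x : u, μ (closedBall (c x) (5 * ρ x)) := measure_biUnion_le μ hcount _
    _ ≤ ∑' x : u, ENNReal.ofReal (5 ^ Module.finrank ℝ E) * N *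
          μ (closedBall (c x) (ρ x) ∩ T) := by
        refine ENNReal.tsum_le_tsum fun x => ?_
        have hx := huB x.2
        have h1 := h (c x) (ρ x) (hρpos x hx) (hρle x hx) (hcQ x hx) (hnear x hx)
        have h2 : μ (closedBall (c x) (5 * ρ x)) =
            ENNReal.ofReal (5 ^ Module.finrank ℝ E) * μ (closedBall (c x) (ρ x)) := by
          rw [Measure.addHaar_closedBall_mul μ _ (by norm_num) (hρpos x hx).le,
            Measure.addHaar_closedBall_center μ (c x)]
        rw [h2, mul_assoc]
        gcongr
    _ = ENNReal.ofReal (5 ^ Module.finrank ℝ E) * N *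
          ∑' x : u, μ (closedBall (c x) (ρ x) ∩ T) := ENNReal.tsum_mul_left
    _ = ENNReal.ofReal (5 ^ Module.finrank ℝ E) * N *
          μ (⋃ x ∈ u, closedBall (c x) (ρ x) ∩ T) := by
        rw [measure_biUnion hcount (hdisj.mono fun x => inter_subset_left)
          fun x _ => measurableSet_closedBall.inter hT]
    _ ≤ ENNReal.ofReal (5 ^ Module.finrank ℝ E) * N * μ (B ∩ T) := by
        gcongr
        exact iUnion₂_subset fun x hx => inter_subset_inter_left _ (hcB x (huB hx))

/-- Growth lemma. -/
theorem Super.exists_growth {lam c : ℝ} (hlam : 0 < lam) (hc : 0 ≤ c) :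
    ∃ Γ ≥ (1 : ℝ), ∃ N > (0 : ℝ), ∃ ε₀ > (0 : ℝ), ∀ (ε : ℝ) (U : Set E) (W : E → ℝ),
      Super μ lam c ε U W → ∀ (y : E) (r τ : ℝ), 0 < r → 0 < τ → closedBall y (8 * r) ⊆ U →
      (∀ x ∈ closedBall y (8 * r), 0 ≤ W x) → ε ≤ ε₀ * τ / r ^ 2 →
      ∀ z ∈ closedBall y (5 * r), W z ≤ τ →
        μ (closedBall y r) ≤ ENNReal.ofReal N * μ {x ∈ closedBall y r | W x ≤ Γ * τ} := by
  obtain ⟨k, hk, hkc⟩ : ∃ k > 0, 1 ≤ lam * (k ^ 2 - 2 * k - 1) - 2 * c * k := by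
    refine ⟨4 + 2 * c / lam + 1 / lam, by positivity, ?_⟩
    set p := 2 * c / lam with hp
    set w := 1 / lam with hw
    have hp0 : 0 ≤ p := by positivity
    have hw0 : 0 ≤ w := by positivity
    have h1 : 2 * c = lam * p := by rw [hp]; field_simp
    have h2 : 1 = lam * w := by rw [hw]; field_simp
    calc (1 : ℝ) = lam * w := h2
      _ ≤ lam * ((4 + p + w) ^ 2 - 2 * (4 + p + w) - 1 - p * (4 + p + w)) := by
        gcongr; nlinarith [mul_nonneg hp0 hw0]
      _ = _ := by rw [h1]; ring
  set b := Real.exp (-(64 * k)) with hb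
  set θ := (Real.exp (-(25 * k)) - b) / 2 with hθ
  have hb0 : 0 < b := Real.exp_pos _
  have hb1 : b ≤ 1 := by rw [hb, Real.exp_le_one_iff]; linarith
  have hθ0 : 0 < θ := by
    have : Real.exp (-(64 * k)) < Real.exp (-(25 * k)) := Real.exp_lt_exp.2 (by linarith)
    rw [hθ, hb]; linarith
  have hθ1 : θ ≤ 1 := by
    have : Real.exp (-(25 * k)) ≤ 1 := by rw [Real.exp_le_one_iff]; linarith
    rw [hθ]; linarith
  refine ⟨6 / θ, ?_, 8 ^ Module.finrank ℝ E * (1 + (1 + (c + 1) / lam)) ^ Module.finrank ℝ E,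
    by positivity, b / θ, by positivity, ?_⟩
  · rw [ge_iff_le, le_div_iff₀ hθ0]; linarith
  intro ε U W hW y r τ hr hτ hU h0 hε z hz hzτ
  have hx₀ : ∃ x₀ ∈ closedBall y (r / 2), W x₀ < 2 * τ / θ := by
    by_contra! hno
    have := hW.barrier μ hlam hc hk hkc hb hθ hr (by positivity : 0 < 2 * τ / θ) hU h0 hno
      (hε.trans_eq (by field_simp)) hz
    rw [mul_div_cancel₀ _ hθ0.ne'] at this
    linarith
  obtain ⟨x₀, hx₀, hWx₀⟩ := hx₀
  have hx₀' := mem_closedBall.1 hx₀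
  have hsub : closedBall x₀ (r / 2) ⊆ closedBall y (8 * r) :=
    closedBall_subset_closedBall' (by linarith)
  have hme := hW.measure_estimate μ hlam hc (half_pos hr) (by positivity : 0 < 2 * τ / θ)
    (hsub.trans hU) (fun x hx => h0 x (hsub hx)) hWx₀.le (hε.trans (by
      rw [div_le_div_iff₀ (by positivity) (by positivity)]
      have : b / θ * τ ≤ 1 / θ * τ := by gcongr
      have e : 2 * τ / θ = 2 * (1 / θ * τ) := by ring
      have e0 : 0 ≤ 1 / θ * τ := by positivity
      rw [e]
      nlinarith [sq_nonneg r, mul_nonneg e0 (sq_nonneg r)]))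
  have hvol : μ (closedBall y r) =
      ENNReal.ofReal (8 ^ Module.finrank ℝ E) * μ (closedBall x₀ (r / 2 / 4)) := by
    rw [show r = 8 * (r / 2 / 4) by ring, Measure.addHaar_closedBall_mul μ _ (by norm_num)
      (by positivity), Measure.addHaar_closedBall_center μ x₀]
    ring_nf
  rw [hvol, ENNReal.ofReal_mul (by positivity), mul_assoc]
  refine mul_le_mul_right (hme.trans (mul_le_mul_right (measure_mono ?_) _)) _
  rintro x ⟨hx, hxW⟩
  refine ⟨closedBall_subset_closedBall' (by linarith) hx, hxW.trans (le_of_eq (by ring))⟩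

/-- Nonnegative supersolutions that are small somewhere are bounded on most of the ball. -/
theorem Super.exists_decay {lam c : ℝ} (hlam : 0 < lam) (hc : 0 ≤ c) :
    ∃ Γ ≥ (1 : ℝ), ∃ ε₀ > (0 : ℝ), ∀ (ε : ℝ) (s : ℝ) (W : E → ℝ), 0 < s → s ≤ 1 →
      Super μ lam c ε (closedBall 0 (5 * s)) W → ContinuousOn W (closedBall 0 (5 * s)) →
      (∀ x ∈ closedBall (0 : E) (5 * s), 0 ≤ W x) → ∀ τ : ℝ, 0 < τ → ε ≤ ε₀ * τ →
      (∃ z ∈ closedBall (0 : E) s, W z ≤ τ) →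
        μ.real {x ∈ closedBall (0 : E) s | Γ * τ < W x} < 1 / 2 * μ.real (closedBall (0 : E) s) := by
  obtain ⟨Γ, hΓ, N, hN, ε₀, hε₀, hgrow⟩ := Super.exists_growth μ hlam hc
  set P := 5 ^ Module.finrank ℝ E * N with hP
  have hP0 : 0 < P := by positivity
  set η := 1 - 1 / (P + 1) with hη
  have hη0 : 0 ≤ η := by
    rw [hη, sub_nonneg, div_le_one (by positivity)]; linarith
  have hη1 : η < 1 := by
    rw [hη]; linarith [show 0 < 1 / (P + 1) by positivity]
  obtain ⟨j, hj⟩ := exists_pow_lt_of_lt_one (by norm_num : (0 : ℝ) < 1 / 2) hη1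
  refine ⟨Γ ^ j, one_le_pow₀ hΓ, ε₀, hε₀, ?_⟩
  intro ε s W hs hs1 hW hWc h0 τ hτ hε hz
  have hQ5 : closedBall (0 : E) s ⊆ closedBall 0 (5 * s) :=
    closedBall_subset_closedBall (by linarith)
  have hcompact : ∀ t, IsCompact {x ∈ closedBall (0 : E) s | W x ≤ t} := fun t =>
    (isCompact_closedBall 0 s).of_isClosed_subset
      ((hWc.mono hQ5).preimage_isClosed_of_isClosed isClosed_closedBall isClosed_Iic)
      (sep_subset _ _)
  have hfin : μ (closedBall (0 : E) s) ≠ ⊤ := (isCompact_closedBall _ _).measure_lt_top.ne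
  have hdiff : ∀ t, {x ∈ closedBall (0 : E) s | t < W x} =
      closedBall 0 s \ {x ∈ closedBall (0 : E) s | W x ≤ t} := by
    intro t
    ext x
    simp only [Set.mem_sdiff, mem_ofPred_eq, not_and, not_le]
    exact ⟨fun h => ⟨h.1, fun _ => h.2⟩, fun h => ⟨h.1, h.2 h.1⟩⟩
  have hstep : ∀ t, τ ≤ t → μ.real {x ∈ closedBall (0 : E) s | Γ * t < W x} ≤
      η * μ.real {x ∈ closedBall (0 : E) s | t < W x} := by
    intro t ht
    have ht0 : 0 < t := hτ.trans_le ht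
    obtain ⟨z, hzQ, hzW⟩ := hz
    have hmain := measure_closedBall_diff_le μ hs (hcompact t) ⟨z, hzQ, hzW.trans ht⟩
      (sep_subset _ _) (hcompact (Γ * t)).measurableSet (N := ENNReal.ofReal N)
      (by
        intro y r hr hrs hyQ hnear
        obtain ⟨w, hw, hwy⟩ := hnear
        have hy : y ∈ closedBall (0 : E) s := hyQ (mem_closedBall_self hr.le)
        have hsub : closedBall y (8 * r) ⊆ closedBall 0 (5 * s) :=
          closedBall_subset_closedBall' (by rw [mem_closedBall] at hy; linarith)
        refine (hgrow ε _ W hW y r t hr ht0 hsub (fun x hx => h0 x (hsub hx)) ?_ w hwy hw.2).trans ?_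
        · rw [le_div_iff₀ (by positivity)]
          have h1 : ε₀ * τ ≤ ε₀ * t := by gcongr
          have h2 : r ^ 2 ≤ 1 := by nlinarith
          have h3 : 0 ≤ ε₀ * t := by positivity
          rcases le_total ε 0 with h | h
          · nlinarith [sq_nonneg r]
          · nlinarith [sq_nonneg r]
        · refine mul_le_mul_right (measure_mono ?_) _
          rintro x ⟨hx, hxW⟩
          exact ⟨hx, hyQ hx, hxW⟩)
    rw [← hdiff, ← ENNReal.ofReal_mul (by positivity), ← hP] at hmain
    have hBfin : μ {x ∈ closedBall (0 : E) s | t < W x} ≠ ⊤ :=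
      ((measure_mono (sep_subset _ _)).trans_lt hfin.lt_top).ne
    have hsplit := measureReal_inter_add_sdiff (μ := μ) (s := {x ∈ closedBall (0 : E) s | t < W x})
      (hcompact (Γ * t)).measurableSet hBfin
    have hreal := ENNReal.toReal_mono (by
      refine ENNReal.mul_ne_top ENNReal.ofReal_ne_top ?_
      exact ((measure_mono inter_subset_left).trans_lt hBfin.lt_top).ne) hmain
    rw [ENNReal.toReal_mul, ENNReal.toReal_ofReal hP0.le] at hreal
    have hsub : {x ∈ closedBall (0 : E) s | t < W x} \ {x ∈ closedBall (0 : E) s | W x ≤ Γ * t} =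
        {x ∈ closedBall (0 : E) s | Γ * t < W x} := by
      ext x
      simp only [Set.mem_sdiff, mem_ofPred_eq, not_and, not_le]
      constructor
      · exact fun h => ⟨h.1.1, h.2 h.1.1⟩
      · exact fun h => ⟨⟨h.1, lt_of_le_of_lt (by nlinarith) h.2⟩, fun _ => h.2⟩
    rw [hsub] at hsplit
    have h1 : μ.real {x ∈ closedBall (0 : E) s | t < W x} ≤
        P * μ.real ({x ∈ closedBall (0 : E) s | t < W x} ∩
          {x ∈ closedBall (0 : E) s | W x ≤ Γ * t}) := hreal
    set β := μ.real {x ∈ closedBall (0 : E) s | t < W x}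
    set β' := μ.real ({x ∈ closedBall (0 : E) s | t < W x} ∩
          {x ∈ closedBall (0 : E) s | W x ≤ Γ * t})
    have hβ' : 0 ≤ β' := measureReal_nonneg
    have h2 : 1 / (P + 1) * β ≤ β' := by
      rw [div_mul_eq_mul_div, one_mul, div_le_iff₀ (by positivity)]
      nlinarith
    rw [hη]
    linarith
  have hiter : ∀ i : ℕ, μ.real {x ∈ closedBall (0 : E) s | Γ ^ i * τ < W x} ≤
      η ^ i * μ.real (closedBall (0 : E) s) := by
    intro i
    induction i with
    | zero =>
      simp only [pow_zero, one_mul]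
      exact measureReal_mono (sep_subset _ _) hfin
    | succ i ih =>
      have h1 := hstep (Γ ^ i * τ) (le_mul_of_one_le_left hτ.le (one_le_pow₀ hΓ))
      rw [← mul_assoc, ← pow_succ'] at h1
      exact (h1.trans (mul_le_mul_of_nonneg_left ih hη0)).trans_eq (by ring)
  refine (hiter j).trans_lt ?_
  have : 0 < μ.real (closedBall (0 : E) s) :=
    ENNReal.toReal_pos (measure_closedBall_pos μ 0 hs).ne' hfin
  exact mul_lt_mul_of_pos_right hj this

end Covering

section Flatness

variable {E : Type*} [NormedAddCommGroup E] [InnerProductSpace ℝ E]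
variable [FiniteDimensional ℝ E] [MeasurableSpace E] [BorelSpace E]
variable (μ : Measure E) [μ.IsAddHaarMeasure]

/-- Both `W` and `-W`, up to constants, are supersolutions. -/
def Super.TwoSided (lam c ε : ℝ) (U : Set E) (W : E → ℝ) : Prop :=
  ∀ a, Super μ lam c ε U (fun x => a + W x) ∧ Super μ lam c ε U (fun x => a - W x)

theorem Super.exists_osc_step {lam c : ℝ} (hlam : 0 < lam) (hc : 0 ≤ c) :
    ∃ η ∈ Ioo (0 : ℝ) 1, ∃ ε₀ > (0 : ℝ), ∀ (ε s : ℝ) (W : E → ℝ) (m O : ℝ), 0 < s → s ≤ 1 → 0 < O →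
      ε ≤ ε₀ * O → ContinuousOn W (closedBall 0 (5 * s)) →
      Super.TwoSided μ lam c ε (closedBall 0 (5 * s)) W →
      (∀ x ∈ closedBall (0 : E) (5 * s), W x ∈ Icc m (m + O)) →
      ∃ m', ∀ x ∈ closedBall (0 : E) s, W x ∈ Icc m' (m' + η * O) := by
  obtain ⟨Γ, hΓ, ε₀, hε₀, hdec⟩ := Super.exists_decay μ hlam hc
  have hΓ0 : 0 < Γ := by linarith
  refine ⟨1 - 1 / (4 * Γ), ⟨?_, ?_⟩, ε₀ / (4 * Γ), by positivity, ?_⟩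
  · rw [sub_pos, div_lt_one (by positivity)]; linarith
  · linarith [show 0 < 1 / (4 * Γ) by positivity]
  intro ε s W m O hs hs1 hO hε hWc hW hosc
  have hQ5 : closedBall (0 : E) s ⊆ closedBall 0 (5 * s) :=
    closedBall_subset_closedBall (by linarith)
  set τ := O / (4 * Γ) with hτ
  have hτ0 : 0 < τ := by positivity
  have hΓτ : Γ * τ = O / 4 := by rw [hτ]; field_simp
  have hηO : (1 - 1 / (4 * Γ)) * O = O - τ := by rw [hτ]; ring
  have hε' : ε ≤ ε₀ * τ := hε.trans_eq (by rw [hτ]; ring)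
  rw [hηO]
  by_cases h1 : ∃ z ∈ closedBall (0 : E) s, -m + W z ≤ τ
  swap
  · push Not at h1
    refine ⟨m + τ, fun x hx => ⟨by linarith [h1 x hx], by linarith [(hosc x (hQ5 hx)).2]⟩⟩
  by_cases h2 : ∃ z ∈ closedBall (0 : E) s, m + O - W z ≤ τ
  swap
  · push Not at h2
    refine ⟨m, fun x hx => ⟨(hosc x (hQ5 hx)).1, by linarith [h2 x hx]⟩⟩
  exfalso
  have m1 := hdec ε s _ hs hs1 (hW (-m)).1 (continuousOn_const.add hWc)
    (fun x hx => by linarith [(hosc x hx).1]) τ hτ0 hε' h1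
  have m2 := hdec ε s _ hs hs1 (hW (m + O)).2 (continuousOn_const.sub hWc)
    (fun x hx => by linarith [(hosc x hx).2]) τ hτ0 hε' h2
  have hfin : μ (closedBall (0 : E) s) ≠ ⊤ := (isCompact_closedBall _ _).measure_lt_top.ne
  have hcov : closedBall (0 : E) s ⊆ {x ∈ closedBall (0 : E) s | Γ * τ < -m + W x} ∪
      {x ∈ closedBall (0 : E) s | Γ * τ < m + O - W x} := by
    intro x hx
    by_cases h : Γ * τ < -m + W x
    · exact Or.inl ⟨hx, h⟩
    · exact Or.inr ⟨hx, by linarith⟩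
  have h3 := (measureReal_mono hcov ((measure_mono (union_subset (sep_subset _ _)
    (sep_subset _ _))).trans_lt hfin.lt_top).ne).trans (measureReal_union_le (μ := μ) _ _)
  linarith

theorem Super.exists_osc_decay {lam c : ℝ} (hlam : 0 < lam) (hc : 0 ≤ c) {η₀ : ℝ} (hη₀ : 0 < η₀) :
    ∃ ρ > (0 : ℝ), ρ ≤ 1 / 16 ∧ ∃ ε₀ > (0 : ℝ), ∀ (ε : ℝ) (W : E → ℝ) (M : ℝ), 0 < M →
      ε ≤ ε₀ * M → ContinuousOn W (closedBall 0 (1 / 16)) →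
      (∀ s ≤ 1 / 16, Super.TwoSided μ lam c ε (closedBall 0 s) W) →
      (∀ x ∈ closedBall (0 : E) (1 / 16), |W x| ≤ M) →
      ∀ x ∈ closedBall (0 : E) ρ, |W x - W 0| ≤ η₀ * M := by
  obtain ⟨η, ⟨hη0, hη1⟩, ε₀, hε₀, hstep⟩ := Super.exists_osc_step μ hlam hc
  obtain ⟨J, hJ⟩ := exists_pow_lt_of_lt_one (half_pos hη₀) hη1
  refine ⟨(1 / 5) ^ J / 16, by positivity, ?_, ε₀ * η ^ J * 2, by positivity, ?_⟩
  · have : (1 / 5 : ℝ) ^ J ≤ 1 := pow_le_one₀ (by norm_num) (by norm_num)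
    linarith
  intro ε W M hM hε hWc hW hWM
  have key : ∀ j ≤ J, ∃ m, ∀ x ∈ closedBall (0 : E) ((1 / 5) ^ j / 16),
      W x ∈ Icc m (m + η ^ j * (2 * M)) := by
    intro j
    induction j with
    | zero =>
      intro _
      refine ⟨-M, fun x hx => ?_⟩
      have := abs_le.1 (hWM x (by simpa using hx))
      exact ⟨this.1, by rw [pow_zero]; linarith⟩
    | succ j ih =>
      intro hj
      obtain ⟨m, hm⟩ := ih (by omega)
      have hp : (1 / 5 : ℝ) ^ (j + 1) ≤ 1 := pow_le_one₀ (by norm_num) (by norm_num)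
      have hp' : (1 / 5 : ℝ) ^ j ≤ 1 := pow_le_one₀ (by norm_num) (by norm_num)
      have e : 5 * ((1 / 5 : ℝ) ^ (j + 1) / 16) = (1 / 5) ^ j / 16 := by ring
      have hεj : ε ≤ ε₀ * (η ^ j * (2 * M)) := by
        refine hε.trans ?_
        have : η ^ J ≤ η ^ j := pow_le_pow_of_le_one hη0.le hη1.le (by omega)
        calc ε₀ * η ^ J * 2 * M = ε₀ * (η ^ J * (2 * M)) := by ring
          _ ≤ ε₀ * (η ^ j * (2 * M)) := by gcongr
      obtain ⟨m', hm'⟩ := hstep ε ((1 / 5) ^ (j + 1) / 16) W m (η ^ j * (2 * M)) (by positivity)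
        (by linarith) (by positivity) hεj
        (by rw [e]; exact hWc.mono (closedBall_subset_closedBall (by linarith)))
        (by rw [e]; exact hW _ (by linarith)) (by rwa [e])
      refine ⟨m', fun x hx => ?_⟩
      have := hm' x hx
      rwa [← mul_assoc, ← pow_succ'] at this
  obtain ⟨m, hm⟩ := key J le_rfl
  intro x hx
  have h1 := hm x hx
  have h2 := hm 0 (mem_closedBall_self (by positivity))
  have h3 : η ^ J * (2 * M) ≤ η₀ * M := by nlinarith
  rw [abs_le]
  constructor <;> linarith [h1.1, h1.2, h2.1, h2.2]

omit [FiniteDimensional ℝ E] [MeasurableSpace E] [BorelSpace E] in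
/-- Telescoping increments in a fixed direction. -/
theorem increment_estimate {v : E → ℝ} {K δ h ρ α : ℝ} {e : E} (he : ‖e‖ = 1) (hh : 0 < h)
    (hv : ∀ x ∈ closedBall (0 : E) ρ, ∀ y ∈ closedBall (0 : E) ρ, |v x - v y| ≤ K * ‖x - y‖)
    (hK : 0 ≤ K) (hδ : 0 ≤ δ) (hα : |α| ≤ K)
    (hinc : ∀ x ∈ closedBall (0 : E) ρ, |v (x + h • e) - v x - h * α| ≤ δ * h)
    {y : E} {t : ℝ} (hy : y ∈ closedBall (0 : E) ρ) (hyt : y + t • e ∈ closedBall (0 : E) ρ) :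
    |v (y + t • e) - v y - t * α| ≤ δ * |t| + 2 * K * h := by
  wlog ht : 0 ≤ t generalizing y t
  · have := this hyt (t := -t) (by simpa using hy) (by linarith)
    rw [add_assoc, ← add_smul, add_neg_cancel, zero_smul, add_zero, abs_neg] at this
    rw [← abs_neg]
    convert this using 2
    ring
  have hseg : ∀ r, 0 ≤ r → r ≤ t → y + r • e ∈ closedBall (0 : E) ρ := by
    intro r hr0 hrt
    rcases hr0.eq_or_lt with rfl | hr
    · simpa using hy
    have ht0 : 0 < t := hr.trans_le hrt
    have := (convex_closedBall (0 : E) ρ).add_smul_sub_mem hy hyt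
      (t := r / t) ⟨by positivity, (div_le_one ht0).2 hrt⟩
    rwa [add_sub_cancel_left, smul_smul, div_mul_cancel₀ _ ht0.ne'] at this
  have htel : ∀ N : ℕ, N * h ≤ t → |v (y + (N * h) • e) - v y - N * h * α| ≤ δ * (N * h) := by
    intro N
    induction N with
    | zero => intro _; simp
    | succ N ih =>
      intro hN
      push_cast at hN ⊢
      have hN' : N * h ≤ t := by nlinarith
      have h1 := ih hN'
      have h2 := hinc _ (hseg (N * h) (by positivity) hN')
      rw [add_assoc, ← add_smul] at h2
      rw [show ((N : ℝ) + 1) * h = N * h + h by ring]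
      rw [abs_le] at *
      constructor <;> linarith [h1.1, h1.2, h2.1, h2.2]
  set N := ⌊t / h⌋₊ with hN
  have hNt : N * h ≤ t := by
    have := Nat.floor_le (div_nonneg ht hh.le)
    rwa [le_div_iff₀ hh] at this
  have hNt' : t - N * h ≤ h := by
    have := (Nat.lt_floor_add_one (t / h)).le
    rw [div_le_iff₀ hh, ← hN] at this
    linarith
  have h1 := htel N hNt
  have h2 := hv _ hyt _ (hseg (N * h) (by positivity) hNt)
  rw [add_sub_add_left_eq_sub, ← sub_smul, norm_smul, he, mul_one,
    Real.norm_of_nonneg (by linarith)] at h2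
  have h3 : K * (t - N * h) ≤ K * h := by gcongr
  have h4 : |(t - N * h) * α| ≤ h * K := by
    rw [abs_mul, abs_of_nonneg (by linarith : 0 ≤ t - N * h)]
    exact mul_le_mul hNt' hα (abs_nonneg _) hh.le
  have h5 : δ * (N * h) ≤ δ * t := by gcongr
  rw [abs_of_nonneg ht]
  rw [abs_le] at *
  constructor <;> linarith [h1.1, h1.2, h2.1, h2.2, h4.1, h4.2]

/-- Solutions of almost homogeneous equations are close to affine functions at a fixed scale. -/
theorem exists_affine_approximation {lam c : ℝ} (hlam : 0 < lam) (hc : 0 ≤ c) :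
    ∃ ρ ∈ Ioo (0 : ℝ) (1 / 2), ∃ C ≥ (1 : ℝ), ∃ L ≥ (0 : ℝ), ∃ ε > (0 : ℝ),
      ∀ G : (E →L[ℝ] E) → ℝ, Ell lam c G → ∀ v : E → ℝ, ContinuousOn v (ball 0 1) →
      (∀ x ∈ ball (0 : E) 1, |v x| ≤ 1) → SubP G ε L (ball 0 1) v →
      SubP (dualOp G) ε L (ball 0 1) (fun x => -v x) →
      ∃ a : E, ∃ b : ℝ, ‖a‖ ≤ C ∧ |b| ≤ C ∧
        ∀ x ∈ ball (0 : E) ρ, |v x - (⟪a, x⟫ + b)| ≤ ρ / 2 := by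
  obtain ⟨K', hK'0, hK'⟩ : ∃ K ≥ 0, 258 * c + 2 < lam * (4 * K - 258) := by
    refine ⟨(258 * c + 3) / lam + 258, by positivity, ?_⟩
    have : lam * ((258 * c + 3) / lam) = 258 * c + 3 := by field_simp
    have h2 : lam * (4 * ((258 * c + 3) / lam + 258) - 258) =
      4 * (lam * ((258 * c + 3) / lam)) + 774 * lam := by ring
    rw [h2, this]
    linarith
  set K := K' + 16 with hK
  have hK1 : 1 ≤ K := by linarith
  set d : ℝ := Module.finrank ℝ E + 1 with hd
  have hd1 : 1 ≤ d := by rw [hd]; linarith [Nat.cast_nonneg (α := ℝ) (Module.finrank ℝ E)]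
  obtain ⟨ρ₁, hρ₁, hρ₁', ε₀, hε₀, hosc⟩ := Super.exists_osc_decay (volume : Measure E) hlam hc
    (by positivity : 0 < 1 / (8 * d * K))
  set ρ := ρ₁ / d with hρ
  have hρ0 : 0 < ρ := by positivity
  have hρρ : ρ ≤ ρ₁ := div_le_self hρ₁.le hd1
  set h := ρ / (8 * d * K) with hh
  have hh0 : 0 < h := by positivity
  have hdK : 8 ≤ 8 * d * K := by nlinarith
  have hh1 : h ≤ 1 / 32 := by
    rw [hh, div_le_iff₀ (by positivity)]; linarith
  refine ⟨ρ, ⟨hρ0, by linarith⟩, d * K, by nlinarith, 2 * K' + 66, by positivity,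
    min 1 (ε₀ * (K * h) / 2), by positivity, ?_⟩
  intro G hG v hv hv1 hsub hsup
  have hlip : ∀ x ∈ ball (0 : E) (1 / 8), ∀ y ∈ ball (0 : E) (1 / 8),
      |v x - v y| ≤ K * ‖x - y‖ := by
    intro x hx y hy
    refine lipschitz_estimate hlam hc hK'0 hK' hG hv hv1 ?_ ?_ hx hy
    · exact fun x₀ hx₀ p X hX hp ht =>
        (neg_le_neg (min_le_left _ _)).trans (hsub x₀ hx₀ p X hX hp ht)
    · exact fun x₀ hx₀ p X hX hp ht =>
        (neg_le_neg (min_le_left _ _)).trans (hsup x₀ hx₀ p X hX hp ht)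
  have hlip' : ∀ x ∈ closedBall (0 : E) ρ₁, ∀ y ∈ closedBall (0 : E) ρ₁,
      |v x - v y| ≤ K * ‖x - y‖ := fun x hx y hy =>
    hlip x (closedBall_subset_ball (by linarith) hx) y (closedBall_subset_ball (by linarith) hy)
  set ε := min 1 (ε₀ * (K * h) / 2) with hε
  have hball : ball (0 : E) (1 / 8) ⊆ ball 0 1 := ball_subset_ball (by norm_num)
  have hsubL : ∀ L, SubP G ε L (ball 0 (1 / 8)) v := by
    refine SubP.of_lipschitz (K := 2 * K' + 66) ?_ (by positivity) fun x hx y hy =>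
      (hlip x hx y hy).trans (mul_le_mul_of_nonneg_right (by linarith) (norm_nonneg _))
    exact fun x₀ hx₀ => hsub x₀ (hball hx₀)
  have hsupL : ∀ L, SubP (dualOp G) ε L (ball 0 (1 / 8)) fun x => -v x := by
    refine SubP.of_lipschitz (K := 2 * K' + 66) ?_ (by positivity) fun x hx y hy => ?_
    · exact fun x₀ hx₀ => hsup x₀ (hball hx₀)
    · rw [neg_sub_neg, abs_sub_comm]
      exact (hlip x hx y hy).trans (mul_le_mul_of_nonneg_right (by linarith) (norm_nonneg _))
  have hshift : ∀ e : E, ‖e‖ = 1 → ∀ s ≤ (1 / 16 : ℝ), ∀ x ∈ closedBall (0 : E) s,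
      x + h • e ∈ closedBall (0 : E) (3 / 32) := by
    intro e he s hs x hx
    rw [mem_closedBall_zero_iff] at *
    refine (norm_add_le _ _).trans ?_
    rw [norm_smul, he, Real.norm_of_nonneg hh0.le]
    linarith
  have hself : ∀ s ≤ (1 / 16 : ℝ), ∀ x ∈ closedBall (0 : E) s,
      x + 0 ∈ closedBall (0 : E) (3 / 32) := by
    intro s hs x hx
    rw [add_zero]
    exact closedBall_subset_closedBall (by linarith) hx
  have h38 : closedBall (0 : E) (3 / 32) ⊆ ball 0 (1 / 8) := closedBall_subset_ball (by norm_num)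
  have hvc : ContinuousOn v (ball 0 (1 / 8)) := hv.mono hball
  have hinc : ∀ e : E, ‖e‖ = 1 → ∀ x ∈ closedBall (0 : E) ρ₁,
      |v (x + h • e) - v x - h * ((v (h • e) - v 0) / h)| ≤ 1 / (8 * d) * h := by
    intro e he x hx
    have := hosc (2 * ε) (fun x => v (x + h • e) - v x) (K * h) (by positivity)
      (by linarith [min_le_right 1 (ε₀ * (K * h) / 2)]) ?_ ?_ ?_ x hx
    · simp only [zero_add] at this
      rw [mul_div_cancel₀ _ hh0.ne']
      refine this.trans_eq ?_
      field_simp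
    · refine ContinuousOn.sub (hvc.comp (by fun_prop) fun x hx => h38 (hshift e he _ le_rfl x hx))
        (hvc.mono (closedBall_subset_ball (by norm_num)))
    · intro s hs a
      have h1 := super_of_sub_translates volume hG hvc (by norm_num) (by norm_num : (3 / 32 : ℝ) < 1 / 8)
        hsubL hsupL (hshift e he s hs) (hself s hs) a
      have h2 := super_of_sub_translates volume hG hvc (by norm_num) (by norm_num : (3 / 32 : ℝ) < 1 / 8)
        hsubL hsupL (hself s hs) (hshift e he s hs) a
      simp only [add_zero] at h1 h2
      refine ⟨?_, ?_⟩
      · convert h1 using 2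
        ring
      · convert h2 using 2
        ring
    · intro x hx
      have := hlip _ (h38 (hshift e he _ le_rfl x hx)) x (closedBall_subset_ball (by norm_num) hx)
      rwa [add_sub_cancel_left, norm_smul, he, mul_one, Real.norm_of_nonneg hh0.le] at this
  have hαK : ∀ e : E, ‖e‖ = 1 → |(v (h • e) - v 0) / h| ≤ K := by
    intro e he
    have := hlip (h • e) (by
      rw [mem_ball_zero_iff, norm_smul, he, Real.norm_of_nonneg hh0.le]; linarith) 0
      (mem_ball_self (by norm_num))
    rw [sub_zero, norm_smul, he, mul_one, Real.norm_of_nonneg hh0.le] at this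
    rwa [abs_div, abs_of_pos hh0, div_le_iff₀ hh0]
  set B := stdOrthonormalBasis ℝ E with hB
  set α : Fin (Module.finrank ℝ E) → ℝ := fun i => (v (h • B i) - v 0) / h with hα
  have hBn : ∀ i, ‖B i‖ = 1 := fun i => B.orthonormal.1 i
  refine ⟨∑ i, α i • B i, v 0, ?_, ?_, ?_⟩
  · refine (norm_sum_le _ _).trans ?_
    calc ∑ i, ‖α i • B i‖ ≤ ∑ i : Fin (Module.finrank ℝ E), K := by
          refine Finset.sum_le_sum fun i _ => ?_
          rw [norm_smul, hBn, mul_one]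
          exact hαK _ (hBn i)
      _ ≤ d * K := by
        rw [Finset.sum_const, Finset.card_univ, Fintype.card_fin, nsmul_eq_mul]
        gcongr
        linarith
  · exact (hv1 0 (mem_ball_self one_pos)).trans (by nlinarith)
  intro x hx
  rw [mem_ball_zero_iff] at hx
  have hcoord : ∀ i, |⟪B i, x⟫| ≤ ρ := fun i =>
    (abs_real_inner_le_norm _ _).trans (by rw [hBn, one_mul]; exact hx.le)
  have hpart : ∀ S : Finset (Fin (Module.finrank ℝ E)),
      ∑ i ∈ S, ⟪B i, x⟫ • B i ∈ closedBall (0 : E) ρ₁ := by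
    intro S
    rw [mem_closedBall_zero_iff]
    refine (norm_sum_le _ _).trans ?_
    calc ∑ i ∈ S, ‖⟪B i, x⟫ • B i‖ ≤ ∑ i ∈ S, ρ := by
          refine Finset.sum_le_sum fun i _ => ?_
          rw [norm_smul, hBn, mul_one]
          exact hcoord i
      _ ≤ d * ρ := by
        rw [Finset.sum_const, nsmul_eq_mul]
        gcongr
        have := S.card_le_univ
        rw [Fintype.card_fin] at this
        have : (S.card : ℝ) ≤ Module.finrank ℝ E := by exact_mod_cast this
        linarith
      _ = ρ₁ := by rw [hρ]; field_simp
  have hsum : ∀ S : Finset (Fin (Module.finrank ℝ E)),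
      |v (∑ i ∈ S, ⟪B i, x⟫ • B i) - v 0 - ∑ i ∈ S, ⟪B i, x⟫ * α i| ≤
        S.card * (1 / (8 * d) * ρ + 2 * K * h) := by
    intro S
    induction S using Finset.induction_on with
    | empty => simp
    | insert i S hi ih =>
      have hS := hpart S
      have hS' := hpart (insert i S)
      rw [Finset.sum_insert hi, add_comm] at hS'
      have h1 := increment_estimate (hBn i) hh0 hlip' (by linarith)
        (by positivity : 0 ≤ 1 / (8 * d)) (hαK _ (hBn i)) (hinc _ (hBn i)) hS hS'
      have h2 : 1 / (8 * d) * |⟪B i, x⟫| ≤ 1 / (8 * d) * ρ := by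
        have := hcoord i
        gcongr
      rw [Finset.sum_insert hi, Finset.sum_insert hi, add_comm (⟪B i, x⟫ • B i),
        Finset.card_insert_of_notMem hi]
      push_cast
      rw [add_mul, one_mul]
      change |v (∑ i ∈ S, ⟪B i, x⟫ • B i + ⟪B i, x⟫ • B i) - v (∑ i ∈ S, ⟪B i, x⟫ • B i) -
        ⟪B i, x⟫ * α i| ≤ _ at h1
      rw [abs_le] at *
      constructor <;> linarith [h1.1, h1.2, ih.1, ih.2]
  have h1 := hsum Finset.univ
  have hx' : ∑ i, ⟪B i, x⟫ • B i = x := B.sum_repr' x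
  have hax : ⟪∑ i, α i • B i, x⟫ = ∑ i, ⟪B i, x⟫ * α i := by
    rw [sum_inner]
    exact Finset.sum_congr rfl fun i _ => by rw [real_inner_smul_left, mul_comm]
  rw [hx', Finset.card_univ, Fintype.card_fin] at h1
  rw [hax, show v x - (∑ i, ⟪B i, x⟫ * α i + v 0) = v x - v 0 - ∑ i, ⟪B i, x⟫ * α i by ring]
  refine h1.trans ?_
  have e : d * (1 / (8 * d) * ρ + 2 * K * h) = 3 / 8 * ρ := by
    rw [hh]; field_simp; norm_num
  have : (Module.finrank ℝ E : ℝ) * (1 / (8 * d) * ρ + 2 * K * h) ≤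
      d * (1 / (8 * d) * ρ + 2 * K * h) := by
    gcongr
    linarith
  linarith

end Flatness

section Pucci

/-- Matrix of the quadratic form of an operator. -/
def formMatrix {n : ℕ} (S : Euc n →L[ℝ] Euc n) : Matrix (Fin n) (Fin n) ℝ :=
  fun i j => ⟪S (EuclideanSpace.single i 1), EuclideanSpace.single j 1⟫

variable {n : ℕ}

theorem formMatrix_isSymm {S : Euc n →L[ℝ] Euc n} (hS : Symm S) : (formMatrix S).IsSymm := by
  ext i j
  simp only [formMatrix, Matrix.transpose_apply]
  rw [hS, real_inner_comm]

theorem formMatrix_sub (S T : Euc n →L[ℝ] Euc n) :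
    formMatrix (S - T) = formMatrix S - formMatrix T := by
  ext i j
  simp [formMatrix, inner_sub_left]

theorem formMatrix_neg (S : Euc n →L[ℝ] Euc n) : formMatrix (-S) = -formMatrix S := by
  ext i j
  simp [formMatrix]

theorem dotProduct_formMatrix_mulVec (S : Euc n →L[ℝ] Euc n) (ξ : Euc n) :
    (⇑ξ) ⬝ᵥ (formMatrix S).mulVec ⇑ξ = ⟪S ξ, ξ⟫ := by
  have hξ : ξ = ∑ i, ξ i • EuclideanSpace.single i (1 : ℝ) := by
    ext j; simp [Finset.sum_apply, Pi.single_apply]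
  have h : ⟪S (∑ i, ξ i • EuclideanSpace.single i (1 : ℝ)),
      ∑ i, ξ i • EuclideanSpace.single i (1 : ℝ)⟫ = ⇑ξ ⬝ᵥ (formMatrix S).mulVec ⇑ξ := by
    simp only [map_sum, map_smul, sum_inner, inner_sum, real_inner_smul_left,
      real_inner_smul_right, dotProduct, mulVec, formMatrix, Finset.mul_sum]
    rw [Finset.sum_comm]
    refine Finset.sum_congr rfl fun i _ => Finset.sum_congr rfl fun j _ => ?_
    ring
  rw [← hξ] at h
  exact h.symm

theorem le_trace_mul_transpose_mul {lam Lam : ℝ} (hlam : 0 ≤ lam)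
    {A : Matrix (Fin n) (Fin n) ℝ} (hA : A ∈ EllMat n lam Lam) (C : Matrix (Fin n) (Fin n) ℝ)
    {e : Fin n → ℝ} (he : e ⬝ᵥ e = 1) :
    lam * (e ⬝ᵥ (Cᵀ * C).mulVec e) ≤ (A * (Cᵀ * C)).trace := by
  have h1 : (A * (Cᵀ * C)).trace = ∑ i, C i ⬝ᵥ A.mulVec (C i) := by
    rw [← Matrix.mul_assoc, Matrix.trace_mul_comm, ← Matrix.mul_assoc]
    simp only [Matrix.trace, Matrix.diag_apply, Matrix.mul_apply, Matrix.transpose_apply,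
      dotProduct, mulVec, Finset.mul_sum, Finset.sum_mul]
    refine Finset.sum_congr rfl fun i _ => ?_
    rw [Finset.sum_comm]
    refine Finset.sum_congr rfl fun j _ => Finset.sum_congr rfl fun k _ => ?_
    ring
  have h2 : e ⬝ᵥ (Cᵀ * C).mulVec e = ∑ i, (C i ⬝ᵥ e) ^ 2 := by
    rw [← Matrix.mulVec_mulVec, Matrix.dotProduct_mulVec, Matrix.vecMul_transpose]
    simp only [dotProduct, mulVec, sq]
  rw [h1, h2, Finset.mul_sum]
  refine Finset.sum_le_sum fun i _ => ?_
  refine le_trans ?_ (hA.2 (C i)).1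
  refine mul_le_mul_of_nonneg_left ?_ hlam
  have hcs := Finset.sum_mul_sq_le_sq_mul_sq Finset.univ (C i) e
  have he' : ∑ j, e j ^ 2 = 1 := by rw [← he]; simp [dotProduct, sq]
  rw [he', mul_one] at hcs
  simpa [dotProduct, sq] using hcs

theorem trace_le_of_mem_EllMat {lam Lam : ℝ} {A : Matrix (Fin n) (Fin n) ℝ}
    (hA : A ∈ EllMat n lam Lam) : A.trace ≤ n * Lam := by
  have : ∀ i, A i i ≤ Lam := by
    intro i
    have := (hA.2 (Pi.single i 1)).2
    simpa using this
  calc A.trace ≤ ∑ _i : Fin n, Lam := Finset.sum_le_sum fun i _ => this i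
    _ = n * Lam := by simp

open scoped MatrixOrder Matrix.Norms.L2Operator in
theorem IsUniformlyElliptic.ell {lam Lam : ℝ} (hlam : 0 ≤ lam) (hLam : lam ≤ Lam)
    {F : Matrix (Fin n) (Fin n) ℝ → ℝ} (hF : IsUniformlyElliptic n lam Lam F) :
    Ell lam (n * Lam) fun S : Euc n →L[ℝ] Euc n => F (formMatrix S) := by
  intro X Y hX hY m B e hm he h1 h2
  refine (hF _ _ (formMatrix_isSymm hX) (formMatrix_isSymm hY)).2.trans ?_
  rw [← formMatrix_sub]
  have he' : ⇑e ⬝ᵥ ⇑e = 1 := by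
    have : ‖e‖ ^ 2 = 1 := by rw [he]; norm_num
    rw [EuclideanSpace.real_norm_sq_eq] at this
    simpa [dotProduct, sq] using this
  refine csSup_le ?_ ?_
  · refine ⟨_, lam • (1 : Matrix (Fin n) (Fin n) ℝ), ⟨?_, fun ξ => ?_⟩, rfl⟩
    · rw [Matrix.IsSymm, Matrix.transpose_smul, Matrix.transpose_one]
    · rw [Matrix.smul_mulVec, Matrix.one_mulVec, dotProduct_smul, smul_eq_mul]
      refine ⟨le_rfl, mul_le_mul_of_nonneg_right hLam ?_⟩
      exact Finset.sum_nonneg fun i _ => mul_self_nonneg _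
  rintro _ ⟨A, hA, rfl⟩
  set D := formMatrix (X - Y) with hD
  have hDs : D.IsSymm := by
    rw [hD, formMatrix_sub]
    exact (formMatrix_isSymm hX).sub (formMatrix_isSymm hY)
  have hP : (m • (1 : Matrix (Fin n) (Fin n) ℝ) - D).PosSemidef := by
    refine Matrix.PosSemidef.of_dotProduct_mulVec_nonneg ?_ ?_
    · rw [Matrix.IsHermitian, Matrix.conjTranspose_eq_transpose_of_trivial]
      rw [Matrix.transpose_sub, Matrix.transpose_smul, Matrix.transpose_one, hDs.eq]
    · intro ξ
      have := h1 (WithLp.toLp 2 ξ)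
      rw [← dotProduct_formMatrix_mulVec, ← hD, EuclideanSpace.real_norm_sq_eq] at this
      simp only [star_trivial, Matrix.sub_mulVec, Matrix.smul_mulVec, Matrix.one_mulVec,
        dotProduct_sub, dotProduct_smul, smul_eq_mul, sub_nonneg]
      simpa [dotProduct, sq] using this
  obtain ⟨C, hC⟩ := CStarAlgebra.nonneg_iff_eq_star_mul_self.1 hP.nonneg
  rw [Matrix.star_eq_conjTranspose, Matrix.conjTranspose_eq_transpose_of_trivial] at hC
  have h3 := le_trace_mul_transpose_mul hlam hA C he'
  rw [← hC, Matrix.sub_mulVec, Matrix.smul_mulVec, Matrix.one_mulVec, dotProduct_sub,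
    dotProduct_smul, he', hD, dotProduct_formMatrix_mulVec, ← hD, smul_eq_mul, mul_one,
    Matrix.mul_sub, Matrix.trace_sub, Matrix.mul_smul, Matrix.mul_one, Matrix.trace_smul,
    smul_eq_mul] at h3
  have h4 := mul_le_mul_of_nonneg_left (trace_le_of_mem_EllMat hA) hm
  have h5 : lam * (m + B) ≤ lam * (m - ⟪(X - Y) e, e⟫) :=
    mul_le_mul_of_nonneg_left (by linarith) hlam
  nlinarith [mul_nonneg hlam hm]

theorem Ell.rescale {lam c s : ℝ} (hs : 0 < s) {G : (Euc n →L[ℝ] Euc n) → ℝ} (hG : Ell lam c G) :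
    Ell lam c fun S => s * G (s⁻¹ • S) := by
  intro X Y hX hY m B e hm he h1 h2
  have hsm : ∀ {Z : Euc n →L[ℝ] Euc n}, Symm Z → Symm (s⁻¹ • Z) := fun hZ x y => by
    simp only [_root_.smul_apply, real_inner_smul_left, real_inner_smul_right, hZ x y]
  have hsub : ∀ ξ, ⟪(s⁻¹ • X - s⁻¹ • Y) ξ, ξ⟫ = s⁻¹ * ⟪(X - Y) ξ, ξ⟫ := fun ξ => by
    rw [← smul_sub, _root_.smul_apply, real_inner_smul_left]
  have := hG _ _ (hsm hX) (hsm hY) (s⁻¹ * m) (s⁻¹ * B) e (by positivity) he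
    (fun ξ => by rw [hsub, mul_assoc]; exact mul_le_mul_of_nonneg_left (h1 ξ) (by positivity))
    (by rw [hsub, ← mul_neg]; exact mul_le_mul_of_nonneg_left h2 (by positivity))
  have h3 := mul_le_mul_of_nonneg_left this hs.le
  have e : s * (c * (s⁻¹ * m) - lam * (s⁻¹ * B)) = c * m - lam * B := by field_simp
  rw [e, mul_sub] at h3
  exact h3

end Pucci

section Quadratic

variable {n : ℕ}

/-- Quadratic polynomial with slope `η` and second derivative `S` at `y₀`. -/
def quadPoly (η : Euc n) (S : Euc n →L[ℝ] Euc n) (y₀ y : Euc n) : ℝ :=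
  ⟪η, y⟫ + 1 / 2 * ⟪S (y - y₀), y - y₀⟫

theorem quadPoly_contDiff (η : Euc n) (S : Euc n →L[ℝ] Euc n) (y₀ : Euc n) :
    ContDiff ℝ 2 (quadPoly η S y₀) := by
  unfold quadPoly
  refine (contDiff_const.inner ℝ contDiff_id).add (contDiff_const.mul (ContDiff.inner ℝ ?_ ?_))
  · exact S.contDiff.comp (contDiff_id.sub contDiff_const)
  · exact contDiff_id.sub contDiff_const

theorem quadPoly_hasFDerivAt (η : Euc n) {S : Euc n →L[ℝ] Euc n} (hS : Symm S) (y₀ y : Euc n) :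
    HasFDerivAt (quadPoly η S y₀) (innerSL ℝ (η + S (y - y₀))) y := by
  have h0 : HasFDerivAt (fun y : Euc n => y - y₀) (ContinuousLinearMap.id ℝ (Euc n)) y :=
    (hasFDerivAt_id y).sub_const y₀
  have h1 := (S.hasFDerivAt (x := y - y₀)).comp y h0
  have h2 := ((hasFDerivAt_const η y).inner ℝ (hasFDerivAt_id y)).add
    ((h1.inner ℝ h0).const_mul (1 / 2))
  refine h2.congr_fderiv ?_
  ext w
  have h3 : ⟪w, S (y - y₀)⟫ = ⟪S (y - y₀), w⟫ := real_inner_comm _ _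
  simp only [_root_.add_apply, _root_.smul_apply, ContinuousLinearMap.comp_apply,
    ContinuousLinearMap.prod_apply, fderivInnerCLM_apply, ContinuousLinearMap.id_apply,
    _root_.zero_apply, inner_zero_left, add_zero, innerSL_apply_apply, inner_add_left, smul_eq_mul,
    Function.comp_apply, hS w, h3, id_eq]
  ring

theorem gradient_quadPoly (η : Euc n) {S : Euc n →L[ℝ] Euc n} (hS : Symm S) (y₀ : Euc n) :
    gradient (quadPoly η S y₀) y₀ = η := by
  refine HasGradientAt.gradient ?_
  have := quadPoly_hasFDerivAt η hS y₀ y₀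
  rwa [sub_self, map_zero, add_zero] at this

theorem hess_quadPoly (η : Euc n) {S : Euc n →L[ℝ] Euc n} (hS : Symm S) (y₀ y : Euc n) :
    hess (quadPoly η S y₀) y = formMatrix S := by
  ext i j
  rw [hess, iteratedFDeriv_two_apply]
  have h1 : fderiv ℝ (quadPoly η S y₀) = fun y => innerSL ℝ (η + S (y - y₀)) :=
    funext fun y => (quadPoly_hasFDerivAt η hS y₀ y).fderiv
  have h2 : HasFDerivAt (fun y : Euc n => η + S (y - y₀)) S y := by
    have := (S.hasFDerivAt (x := y - y₀)).comp y ((hasFDerivAt_id y).sub_const y₀)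
    exact (this.const_add η)
  have h3 : HasFDerivAt (fun y : Euc n => innerSL ℝ (η + S (y - y₀)))
      ((innerSL ℝ : Euc n →L[ℝ] Euc n →L[ℝ] ℝ).comp S) y :=
    ((innerSL ℝ : Euc n →L[ℝ] Euc n →L[ℝ] ℝ).hasFDerivAt).comp y h2
  rw [h1, h3.fderiv]
  simp [formMatrix]

end Quadratic

section Equation

variable {n : ℕ}

/-- `-u` is a subsolution of the dual equation. -/
theorem GradSupSol.neg {κ q : ℝ} {F : Matrix (Fin n) (Fin n) ℝ → ℝ} {f u : Euc n → ℝ}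
    {s : Set (Euc n)} (h : GradSupSol κ (mainG κ q F) f s u) :
    GradSubSol κ (mainG κ q fun M => -F (-M)) (fun x => -f x) s (fun x => -u x) := by
  intro x₀ hx₀ φ hφ hmax hslope
  have hgrad : gradient (fun x => -φ x) x₀ = -gradient φ x₀ := by
    simp only [gradient, fderiv_fun_neg, map_neg]
  have hhess : hess (fun x => -φ x) x₀ = -hess φ x₀ := by
    ext i j
    simp only [hess, Matrix.neg_apply, iteratedFDeriv_two_apply, fderiv_fun_neg,
      _root_.neg_apply]
    rw [show (fderiv ℝ fun x => -φ x) = fun x => -fderiv ℝ φ x from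
      funext fun x => fderiv_fun_neg, fderiv_fun_neg]
    rfl
  have := h x₀ hx₀ (fun x => -φ x) hφ.neg
    (by
      filter_upwards [hmax] with x hx
      linarith)
    (by rwa [hgrad, norm_neg])
  rw [hgrad, hhess] at this
  simp only [mainG, norm_neg] at this ⊢
  linarith

/-- Rescaled deviations from a steep affine function are tested by the uniformly elliptic
operator. -/
theorem GradSubSol.subP {κ q μ : ℝ} (hq : 0 ≤ q) (hμ : 0 < μ)
    {F : Matrix (Fin n) (Fin n) ℝ → ℝ} {f u : Euc n → ℝ}
    (h : GradSubSol κ (mainG κ q F) f (ball 0 1) u) {ς ε L r t : ℝ}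
    (hf : ∀ x ∈ ball (0 : Euc n) 1, |f x| ≤ ς) (hr : 0 < r) (hr1 : r ≤ 1) (ht : 0 < t)
    {ξ : Euc n} (hξ : κ + μ + t / r * L ≤ ‖ξ‖) (b : ℝ) (hε : r ^ 2 / t * ς ≤ ε * μ ^ q) :
    SubP (fun S => r ^ 2 / t * F (formMatrix ((r ^ 2 / t)⁻¹ • S))) ε L (ball 0 1)
      (fun x => (u (r • x) - (⟪ξ, r • x⟫ + b)) / t) := by
  intro x₀ hx₀ p X hX hp ⟨d, hd, htouch⟩
  set s := r ^ 2 / t with hs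
  have hs0 : 0 < s := by positivity
  have hX' : Symm (s⁻¹ • X) := fun x y => by
    simp only [_root_.smul_apply, real_inner_smul_left, real_inner_smul_right, hX x y]
  set η := ξ + (t / r) • p with hη
  set y₀ := r • x₀ with hy₀
  have hy₀b : y₀ ∈ ball (0 : Euc n) 1 := by
    rw [mem_ball_zero_iff] at *
    rw [hy₀, norm_smul, Real.norm_of_nonneg hr.le]
    nlinarith [norm_nonneg x₀]
  have hηn : κ + μ ≤ ‖η‖ := by
    have h1 : ‖ξ‖ ≤ ‖η‖ + ‖(t / r) • p‖ := by
      have := norm_sub_le η ((t / r) • p)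
      rwa [hη, add_sub_cancel_right] at this
    rw [norm_smul, Real.norm_of_nonneg (by positivity)] at h1
    have h2 : t / r * ‖p‖ ≤ t / r * L := by gcongr
    linarith
  have hmax : IsLocalMax (fun y => u y - quadPoly η (s⁻¹ • X) y₀ y) y₀ := by
    have hnhds : ball y₀ (r * d) ∈ 𝓝 y₀ := ball_mem_nhds _ (by positivity)
    filter_upwards [hnhds] with y hy
    rw [mem_ball, dist_eq_norm] at hy
    set x := r⁻¹ • y with hx
    have hrx : y = r • x := by rw [hx, smul_smul, mul_inv_cancel₀ hr.ne', one_smul]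
    have hyx : y - y₀ = r • (x - x₀) := by rw [hrx, hy₀, smul_sub]
    rw [hyx, norm_smul, Real.norm_of_nonneg hr.le] at hy
    have h1 := htouch x (lt_of_mul_lt_mul_left hy hr.le)
    beta_reduce at h1
    rw [← hrx, ← hy₀, div_le_iff₀ ht] at h1
    have h2 : (u y₀ - (⟪ξ, y₀⟫ + b)) / t * t = u y₀ - (⟪ξ, y₀⟫ + b) := div_mul_cancel₀ _ ht.ne'
    have h3 : ⟪η, y⟫ = ⟪η, y₀⟫ + (⟪ξ, y⟫ - ⟪ξ, y₀⟫) + t * ⟪p, x - x₀⟫ := by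
      have e1 : ⟪η, y⟫ - ⟪η, y₀⟫ = ⟪η, y - y₀⟫ := (inner_sub_right _ _ _).symm
      have e2 : ⟪ξ, y⟫ - ⟪ξ, y₀⟫ = ⟪ξ, y - y₀⟫ := (inner_sub_right _ _ _).symm
      have e3 : ⟪η, y - y₀⟫ = ⟪ξ, y - y₀⟫ + t * ⟪p, x - x₀⟫ := by
        rw [hη, inner_add_left, real_inner_smul_left, hyx, real_inner_smul_right p]
        field_simp
      linarith
    have h4 : ⟪(s⁻¹ • X) (y - y₀), y - y₀⟫ = t * ⟪X (x - x₀), x - x₀⟫ := by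
      rw [hyx, map_smul, _root_.smul_apply, real_inner_smul_left, real_inner_smul_left,
        real_inner_smul_right, hs]
      field_simp
    simp only [quadPoly, sub_self, map_zero, inner_zero_left, mul_zero, add_zero]
    rw [h4, h3]
    rw [add_mul, add_mul, h2] at h1
    linarith
  have hmain := h y₀ hy₀b _ (quadPoly_contDiff η (s⁻¹ • X) y₀) hmax
    (by rw [gradient_quadPoly η hX']; linarith)
  rw [gradient_quadPoly η hX', hess_quadPoly η hX'] at hmain
  simp only [mainG] at hmain
  rw [max_eq_left (by linarith)] at hmain
  have hfb := abs_le.1 (hf y₀ hy₀b)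
  have hς : 0 ≤ ς := (abs_nonneg _).trans (hf y₀ hy₀b)
  have hμq : 0 < μ ^ q := Real.rpow_pos_of_pos hμ q
  have hε0 : 0 ≤ ε := by
    by_contra! hneg
    have : 0 ≤ s * ς := by positivity
    nlinarith
  have ha : μ ^ q ≤ (‖η‖ - κ) ^ q := Real.rpow_le_rpow hμ.le (by linarith) hq
  rcases le_or_gt 0 (F (formMatrix (s⁻¹ • X))) with hF | hF
  · have : 0 ≤ s * F (formMatrix (s⁻¹ • X)) := by positivity
    linarith
  · have h1 : -ς ≤ μ ^ q * F (formMatrix (s⁻¹ • X)) := by nlinarith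
    have h2 : s * (-ς) ≤ s * (μ ^ q * F (formMatrix (s⁻¹ • X))) := by gcongr
    have h3 : -(ε * μ ^ q) ≤ (s * F (formMatrix (s⁻¹ • X))) * μ ^ q := by linarith
    by_contra! hneg
    nlinarith

/-- One improvement-of-flatness step for a solution close to a steep affine function. -/
theorem GradSol.exists_affine_improvement {lam Lam κ q μ ς ε L C ρ r t : ℝ} (hlam : 0 < lam)
    (hLam : lam ≤ Lam)
    (hflat : ∀ G : (Euc n →L[ℝ] Euc n) → ℝ, Ell lam (n * Lam) G → ∀ v : Euc n → ℝ,
      ContinuousOn v (ball 0 1) → (∀ x ∈ ball (0 : Euc n) 1, |v x| ≤ 1) →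
      SubP G ε L (ball 0 1) v → SubP (dualOp G) ε L (ball 0 1) (fun x => -v x) →
      ∃ a : Euc n, ∃ b : ℝ, ‖a‖ ≤ C ∧ |b| ≤ C ∧
        ∀ x ∈ ball (0 : Euc n) ρ, |v x - (⟪a, x⟫ + b)| ≤ ρ / 2)
    (hq : 0 ≤ q) (hμ : 0 < μ) {F : Matrix (Fin n) (Fin n) ℝ → ℝ}
    (hF : IsUniformlyElliptic n lam Lam F) {f u : Euc n → ℝ} (hu : ContinuousOn u (ball 0 1))
    (h : GradSol κ (mainG κ q F) f (ball 0 1) u)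
    (hf : ∀ x ∈ ball (0 : Euc n) 1, |f x| ≤ ς) (hr : 0 < r) (hr1 : r ≤ 1) (ht : 0 < t)
    {ξ : Euc n} (hξ : κ + μ + t / r * L ≤ ‖ξ‖) {b : ℝ} (hε : r ^ 2 / t * ς ≤ ε * μ ^ q)
    (hub : ∀ x ∈ ball (0 : Euc n) r, |u x - (⟪ξ, x⟫ + b)| ≤ t) :
    ∃ ξ' : Euc n, ∃ b' : ℝ, ‖ξ' - ξ‖ ≤ t / r * C ∧ |b' - b| ≤ t * C ∧
      ∀ x ∈ ball (0 : Euc n) (r * ρ), |u x - (⟪ξ', x⟫ + b')| ≤ t * (ρ / 2) := by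
  set s := r ^ 2 / t with hs
  have hs0 : 0 < s := by positivity
  have hmaps : ∀ x ∈ ball (0 : Euc n) 1, r • x ∈ ball (0 : Euc n) r := by
    intro x hx
    rw [mem_ball_zero_iff] at *
    rw [norm_smul, Real.norm_of_nonneg hr.le]
    nlinarith
  have hsub := h.1.subP hq hμ hf hr hr1 ht hξ b hε
  have hsup := h.2.neg.subP (ξ := -ξ) hq hμ (by simpa using hf) hr hr1 ht (by rwa [norm_neg]) (-b) hε
  obtain ⟨a, c, ha, hc, hac⟩ := hflat _ ((hF.ell hlam.le hLam).rescale hs0)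
    (fun x => (u (r • x) - (⟪ξ, r • x⟫ + b)) / t) (by
      have h1 : ContinuousOn (fun x : Euc n => u (r • x)) (ball 0 1) :=
        hu.comp (by fun_prop) fun x hx => ball_subset_ball hr1 (hmaps x hx)
      have h2 : ContinuousOn (fun x : Euc n => ⟪ξ, r • x⟫ + b) (ball 0 1) := by fun_prop
      exact (h1.sub h2).div_const t)
    (fun x hx => by
      rw [abs_div, abs_of_pos ht, div_le_one ht]
      exact hub _ (hmaps x hx))
    hsub (by
      convert hsup using 1
      · funext S
        simp only [dualOp, smul_neg, formMatrix_neg, mul_neg]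
        rfl
      · funext x
        rw [inner_neg_left]
        ring)
  refine ⟨ξ + (t / r) • a, b + t * c, ?_, ?_, ?_⟩
  · rw [add_sub_cancel_left, norm_smul, Real.norm_of_nonneg (by positivity)]
    gcongr
  · rw [add_sub_cancel_left, abs_mul, abs_of_pos ht]
    gcongr
  intro y hy
  set x := r⁻¹ • y with hx
  have hrx : y = r • x := by rw [hx, smul_smul, mul_inv_cancel₀ hr.ne', one_smul]
  have hxρ : x ∈ ball (0 : Euc n) ρ := by
    rw [mem_ball_zero_iff] at *
    rw [hrx, norm_smul, Real.norm_of_nonneg hr.le] at hy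
    exact lt_of_mul_lt_mul_left hy hr.le
  have h1 := hac x hxρ
  rw [← hrx] at h1
  have h2 : u y - (⟪ξ + (t / r) • a, y⟫ + (b + t * c)) =
      t * ((u y - (⟪ξ, y⟫ + b)) / t - (⟪a, x⟫ + c)) := by
    have e : ⟪(t / r) • a, y⟫ = t * ⟪a, x⟫ := by
      rw [hrx, real_inner_smul_left, real_inner_smul_right]
      field_simp
    rw [inner_add_left, e, mul_sub, mul_div_cancel₀ _ ht.ne']
    ring
  rw [h2, abs_mul, abs_of_pos ht]
  gcongr

end Equation

theorem exists_rpow_eq_half {ρ : ℝ} (hρ0 : 0 < ρ) (hρ1 : ρ < 1 / 2) :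
    ∃ γ : ℝ, 0 < γ ∧ γ < 1 ∧ ρ ^ γ = 1 / 2 := by
  have hlog : Real.log ρ < Real.log (1 / 2) := Real.log_lt_log hρ0 hρ1
  have hhalf : Real.log (1 / 2) < 0 := Real.log_neg (by norm_num) (by norm_num)
  refine ⟨Real.log (1 / 2) / Real.log ρ, div_pos_of_neg_of_neg hhalf (by linarith), ?_, ?_⟩
  · rw [div_lt_one_of_neg (by linarith)]; exact hlog
  · rw [Real.rpow_def_of_pos hρ0, mul_div_cancel₀ _ (by linarith), Real.exp_log (by norm_num)]

/-- Proposition 5.8, iterative affine approximation far from the free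
boundary. -/
theorem iterative_affine_approximation
    (n : ℕ) (hn : 1 ≤ n) (lam Lam : ℝ) (hlam : 0 < lam) (hlamLam : lam ≤ Lam) :
    ∃ ρ₀ ∈ Ioo (0 : ℝ) 1, ∃ γ ∈ Ioo (0 : ℝ) 1, ∃ κ₀ ∈ Ioo (0 : ℝ) 1, ∃ C ≥ (1 : ℝ),
      ∀ q μ : ℝ, 0 ≤ q → μ ∈ Ioo (0 : ℝ) 1 → ∃ ς₀ > 0, ∃ τ₀ > 0,
      ∀ κ : ℝ, 0 ≤ κ → κ ≤ κ₀ →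
      ∀ F : Matrix (Fin n) (Fin n) ℝ → ℝ, IsUniformlyElliptic n lam Lam F →
      ∀ f u : Euc n → ℝ,
        ContinuousOn f (ball 0 1) → ContinuousOn u (ball 0 1) →
        GradSol κ (mainG κ q F) f (ball 0 1) u →
        (∀ x ∈ ball (0 : Euc n) 1, |f x| ≤ ς₀) →
      ∀ ξ : Euc n, ∀ b : ℝ, κ + 3 * μ ≤ ‖ξ‖ →
        (∀ x ∈ ball (0 : Euc n) 1, |u x - (⟪ξ, x⟫ + b)| ≤ τ₀) →
        ∃ ξseq : ℕ → Euc n, ∃ bseq : ℕ → ℝ,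
          ξseq 0 = ξ ∧ ξseq 1 = ξ ∧ bseq 0 = b ∧ bseq 1 = b ∧
          ∀ k : ℕ, 1 ≤ k →
            ‖ξseq k - ξseq (k - 1)‖ ≤ C * τ₀ * ρ₀ ^ (((k : ℝ) - 1) * γ) ∧
            |bseq k - bseq (k - 1)| ≤ C * τ₀ * ρ₀ ^ (((k : ℝ) - 1) * (1 + γ)) ∧
            ∀ x ∈ ball (0 : Euc n) (ρ₀ ^ ((k : ℝ) - 1)),
              |u x - (⟪ξseq k, x⟫ + bseq k)| ≤ τ₀ * ρ₀ ^ (((k : ℝ) - 1) * (1 + γ)) := by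
  obtain ⟨ρ, ⟨hρ0, hρ1⟩, C, hC, L, hL, ε, hε, hflat⟩ :=
    exists_affine_approximation (E := Euc n) hlam (by have := hlam.trans_le hlamLam; positivity :
      0 ≤ (n : ℝ) * Lam)
  obtain ⟨γ, hγ0, hγ1, hγ⟩ := exists_rpow_eq_half hρ0 hρ1
  have hpow : ∀ j : ℕ, ρ ^ ((j : ℝ) * γ) = (1 / 2) ^ j := fun j => by
    rw [mul_comm, Real.rpow_mul hρ0.le, hγ, Real.rpow_natCast]
  have hpow' : ∀ j : ℕ, ρ ^ ((j : ℝ) * (1 + γ)) = (ρ / 2) ^ j := fun j => by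
    rw [mul_add, mul_one, Real.rpow_add hρ0, hpow, Real.rpow_natCast, ← mul_pow]
    ring
  refine ⟨ρ, ⟨hρ0, by linarith⟩, γ, ⟨hγ0, hγ1⟩, 1 / 2, by norm_num, 2 * C / ρ, ?_, ?_⟩
  · rw [ge_iff_le, le_div_iff₀ hρ0]; linarith
  rintro q μ hq ⟨hμ, -⟩
  have hμq : 0 < μ ^ q := Real.rpow_pos_of_pos hμ q
  set τ := μ / (C + L) with hτ
  have hτ0 : 0 < τ := by positivity
  have hτC : C * τ + L * τ = μ := by rw [hτ]; field_simp
  refine ⟨ε * τ * μ ^ q, by positivity, τ, hτ0, ?_⟩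
  intro κ hκ _ F hF f u _ hu hsol hf ξ b hξ hub
  have hLτ : 0 ≤ L * τ := by positivity
  have step : ∀ (j : ℕ) (p : Euc n × ℝ), ∃ p' : Euc n × ℝ,
      (‖p.1 - ξ‖ ≤ 2 * C * τ * (1 - (1 / 2) ^ j) ∧
        ∀ x ∈ ball (0 : Euc n) (ρ ^ j), |u x - (⟪p.1, x⟫ + p.2)| ≤ τ * (ρ / 2) ^ j) →
      (‖p'.1 - ξ‖ ≤ 2 * C * τ * (1 - (1 / 2) ^ (j + 1)) ∧
        ∀ x ∈ ball (0 : Euc n) (ρ ^ (j + 1)), |u x - (⟪p'.1, x⟫ + p'.2)| ≤ τ * (ρ / 2) ^ (j + 1)) ∧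
      ‖p'.1 - p.1‖ ≤ C * τ * (1 / 2) ^ j ∧ |p'.2 - p.2| ≤ C * τ * (ρ / 2) ^ j := by
    intro j p
    by_cases hp : ‖p.1 - ξ‖ ≤ 2 * C * τ * (1 - (1 / 2) ^ j) ∧
        ∀ x ∈ ball (0 : Euc n) (ρ ^ j), |u x - (⟪p.1, x⟫ + p.2)| ≤ τ * (ρ / 2) ^ j
    swap
    · exact ⟨p, fun h => absurd h hp⟩
    obtain ⟨hp1, hp2⟩ := hp
    have hr : 0 < ρ ^ j := by positivity
    have hr1 : ρ ^ j ≤ 1 := pow_le_one₀ hρ0.le (by linarith)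
    have hhalf0 : (0 : ℝ) < (1 / 2) ^ j := by positivity
    have hhalf : (1 / 2 : ℝ) ^ j ≤ 1 := pow_le_one₀ (by norm_num) (by norm_num)
    have htr : τ * (ρ / 2) ^ j / ρ ^ j = τ * (1 / 2) ^ j := by
      rw [div_pow, div_pow, one_pow]; field_simp
    have hr2 : (ρ ^ j) ^ 2 / (τ * (ρ / 2) ^ j) = (2 * ρ) ^ j / τ := by
      rw [div_pow, mul_pow]; field_simp
    have h2ρ : (2 * ρ) ^ j ≤ 1 := pow_le_one₀ (by positivity) (by linarith)
    obtain ⟨ξ', b', h1, h2, h3⟩ := hsol.exists_affine_improvement hlam hlamLam hflat hq hμ hF hu hf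
      hr hr1 (by positivity : 0 < τ * (ρ / 2) ^ j) (ξ := p.1) (by
        rw [htr]
        have hn : ‖ξ‖ ≤ ‖p.1‖ + ‖p.1 - ξ‖ := by
          have := norm_sub_le p.1 (p.1 - ξ)
          rwa [sub_sub_cancel] at this
        have hm1 : 2 * C * τ * (1 - (1 / 2) ^ j) ≤ 2 * C * τ := by
          have : 0 ≤ 2 * C * τ := by positivity
          nlinarith
        have hm2 : τ * (1 / 2) ^ j * L ≤ L * τ := by nlinarith
        linarith) (by
        rw [hr2]
        calc (2 * ρ) ^ j / τ * (ε * τ * μ ^ q) = (2 * ρ) ^ j * (ε * μ ^ q) := by field_simp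
          _ ≤ 1 * (ε * μ ^ q) := by gcongr
          _ = ε * μ ^ q := one_mul _) hp2
    rw [htr] at h1
    have h1' : ‖ξ' - p.1‖ ≤ C * τ * (1 / 2) ^ j := h1.trans_eq (by ring)
    refine ⟨(ξ', b'), fun _ => ⟨⟨?_, ?_⟩, h1', h2.trans_eq (by ring)⟩⟩
    · have := norm_add_le (ξ' - p.1) (p.1 - ξ)
      rw [sub_add_sub_cancel] at this
      rw [pow_succ]
      linarith
    · intro x hx
      rw [pow_succ] at hx ⊢
      exact (h3 x hx).trans_eq (by ring)
  choose next hnext using step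
  let P : ℕ → Euc n × ℝ := fun j => Nat.rec (ξ, b) next j
  have hP : ∀ j, ‖(P j).1 - ξ‖ ≤ 2 * C * τ * (1 - (1 / 2) ^ j) ∧
      ∀ x ∈ ball (0 : Euc n) (ρ ^ j), |u x - (⟪(P j).1, x⟫ + (P j).2)| ≤ τ * (ρ / 2) ^ j := by
    intro j
    induction j with
    | zero => simpa [P] using hub
    | succ j ih => exact (hnext j (P j) ih).1
  refine ⟨fun k => (P (k - 1)).1, fun k => (P (k - 1)).2, rfl, rfl, rfl, rfl, ?_⟩
  intro k hk
  obtain ⟨j, rfl⟩ : ∃ j, k = j + 1 := ⟨k - 1, by omega⟩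
  have hj : ((j + 1 : ℕ) : ℝ) - 1 = j := by push_cast; ring
  rw [hj, hpow, hpow', Real.rpow_natCast]
  simp only [Nat.add_sub_cancel]
  refine ⟨?_, ?_, (hP j).2⟩
  · cases j with
    | zero => simp only [Nat.zero_sub, sub_self, norm_zero]; positivity
    | succ i =>
      refine (hnext i (P i) (hP i)).2.1.trans ?_
      have : C * τ * (1 / 2) ^ i ≤ C * τ * (1 / 2) ^ i / ρ := by
        rw [le_div_iff₀ hρ0]
        exact mul_le_of_le_one_right (by positivity) (by linarith)
      exact this.trans_eq (by rw [pow_succ]; field_simp)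
  · cases j with
    | zero => simp only [Nat.zero_sub, sub_self, abs_zero]; positivity
    | succ i =>
      refine (hnext i (P i) (hP i)).2.2.trans_eq ?_
      rw [pow_succ]; field_simp

end
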